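/- arXiv:2005.02924 — 7 statements merged into one kernel-verified Lean document; each statement's English description precedes it below -/
import Mathlib

section
/- Let d ≥ 1 and let μ be a Radon measure on ℝ^d. If the Sobolev norm is closable on compactly-supported smooth functions (i.e., whenever a sequence (f_n)_n ⊆ C_c^∞(ℝ^d) satisfies f_n → 0 in L²(μ) and ∇f_n → v in L²(μ; ℝ^d) for some Borel map v : ℝ^d → ℝ^d with |v| ∈ L²(μ), it follows that v = 0 μ-almost everywhere), then μ is absolutely continuous with respect to the Lebesgue measure 𝓛^d. -/
open MeasureTheory Filter ENNReal

noncomputable section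

/-- The Sobolev norm of `(ℝ^d, d_Eucl, μ)` is closable on compactly-supported smooth
functions: whenever `f n ∈ C_c^∞(ℝ^d)` satisfy `f n → 0` in `L²(μ)` and `∇(f n) → v`
in `L²(μ; ℝ^d)` for some Borel `v` with `|v| ∈ L²(μ)`, then `v = 0` μ-a.e. -/
def SobolevClosable (d : ℕ) (μ : Measure (EuclideanSpace ℝ (Fin d))) : Prop :=
  ∀ (f : ℕ → EuclideanSpace ℝ (Fin d) → ℝ)
    (v : EuclideanSpace ℝ (Fin d) → EuclideanSpace ℝ (Fin d)),
    (∀ n, ContDiff ℝ (⊤ : ℕ∞) (f n)) → (∀ n, HasCompactSupport (f n)) →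
    Measurable v → (∫⁻ x, (‖v x‖₊ : ℝ≥0∞) ^ 2 ∂μ) < ⊤ →
    Tendsto (fun n => ∫⁻ x, (‖f n x‖₊ : ℝ≥0∞) ^ 2 ∂μ) atTop (nhds 0) →
    Tendsto (fun n => ∫⁻ x, (‖gradient (f n) x - v x‖₊ : ℝ≥0∞) ^ 2 ∂μ) atTop (nhds 0) →
    v =ᵐ[μ] 0

set_option linter.unusedSectionVars false
namespace Clos

abbrev EE (d : ℕ) := EuclideanSpace ℝ (Fin d)

/-- partial derivative -/
def pd {d : ℕ} (i : Fin d) (f : EE d → ℝ) (x : EE d) : ℝ :=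
  fderiv ℝ f x (EuclideanSpace.single i 1)

def chi (s : ℝ) : ℝ := Real.smoothTransition (2 * s - 1)

lemma chi_contDiff : ContDiff ℝ (⊤ : ℕ∞) chi := by
  unfold chi
  exact Real.smoothTransition.contDiff.comp (by fun_prop)

lemma chi_zero {s : ℝ} (hs : s ≤ 1/2) : chi s = 0 :=
  Real.smoothTransition.zero_of_nonpos (by linarith)

lemma chi_one {s : ℝ} (hs : 1 ≤ s) : chi s = 1 :=
  Real.smoothTransition.one_of_one_le (by linarith)

lemma chi_nonneg (s : ℝ) : 0 ≤ chi s := Real.smoothTransition.nonneg _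
lemma chi_le_one (s : ℝ) : chi s ≤ 1 := Real.smoothTransition.le_one _

lemma chi_mono : Monotone chi := fun a b h => Real.smoothTransition.monotone (by linarith)

lemma chi_deriv_nonneg (s : ℝ) : 0 ≤ deriv chi s := chi_mono.deriv_nonneg

lemma chi_deriv_zero {s : ℝ} (hs : s < 1/2) : deriv chi s = 0 := by
  have : chi =ᶠ[nhds s] fun _ => 0 := by
    filter_upwards [Iio_mem_nhds hs] with y hy using chi_zero (le_of_lt hy)
  rw [this.deriv_eq]; simp

lemma chi_deriv_cont : Continuous (deriv chi) :=
  chi_contDiff.continuous_deriv (by norm_cast)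

lemma chi_deriv_zero' {s : ℝ} (hs : 1 ≤ s) : deriv chi s = 0 := by
  apply IsLocalMax.deriv_eq_zero
  filter_upwards with y
  rw [chi_one hs]; exact chi_le_one y

lemma chi_deriv_pos : ∃ s, 0 < s ∧ deriv chi s ≠ 0 := by
  obtain ⟨c, hc, h⟩ := exists_deriv_eq_slope chi (show (1/2:ℝ) < 1 by norm_num)
    chi_contDiff.continuous.continuousOn
    (chi_contDiff.differentiable (by simp)).differentiableOn
  refine ⟨c, by linarith [hc.1], ?_⟩
  rw [h, chi_one le_rfl, chi_zero le_rfl]; norm_num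

def Qk (d : ℕ) (a s : ℝ) : ℝ := s ^ (-(d:ℝ)/2) * chi (s / a^2)

lemma Qk_zero {d : ℕ} {a s : ℝ} (ha : 0 < a) (hs : s ≤ a^2/2) : Qk d a s = 0 := by
  unfold Qk
  rw [chi_zero, mul_zero]
  rw [div_le_iff₀ (by positivity)]; linarith

lemma Qk_contDiff (d : ℕ) {a : ℝ} (ha : 0 < a) : ContDiff ℝ (⊤ : ℕ∞) (Qk d a) := by
  rw [contDiff_iff_contDiffAt]
  intro s
  by_cases hs : s < a^2/2
  · have : Qk d a =ᶠ[nhds s] fun _ => 0 := by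
      filter_upwards [Iio_mem_nhds hs] with y hy using Qk_zero ha (le_of_lt hy)
    exact contDiffAt_const.congr_of_eventuallyEq this
  · have hs' : 0 < s := lt_of_lt_of_le (by positivity) (not_lt.1 hs)
    unfold Qk
    refine ContDiffAt.mul (contDiffAt_id.rpow_const_of_ne hs'.ne') ?_
    exact (chi_contDiff.comp (contDiff_id.div_const (a^2))).contDiffAt

lemma Qk_deriv (d : ℕ) {a s : ℝ} (ha : 0 < a) :
    (d:ℝ) * Qk d a s + 2 * s * deriv (Qk d a) s
      = 2 * s ^ (1 - (d:ℝ)/2) * deriv chi (s / a^2) / a^2 := by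
  by_cases hs : s < a^2/2
  · have : Qk d a =ᶠ[nhds s] fun _ => 0 := by
      filter_upwards [Iio_mem_nhds hs] with y hy using Qk_zero ha (le_of_lt hy)
    rw [this.deriv_eq, Qk_zero ha hs.le, chi_deriv_zero]
    · simp
    · rw [div_lt_iff₀ (by positivity)]; linarith
  · have hs' : 0 < s := lt_of_lt_of_le (by positivity) (not_lt.1 hs)
    have h1 : HasDerivAt (fun s : ℝ => s ^ (-(d:ℝ)/2)) ((-(d:ℝ)/2) * s ^ (-(d:ℝ)/2 - 1)) s :=
      Real.hasDerivAt_rpow_const (Or.inl hs'.ne')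
    have h2 : HasDerivAt (fun s : ℝ => chi (s / a^2)) (deriv chi (s/a^2) * (1 / a^2)) s := by
      have hc : HasDerivAt chi (deriv chi (s/a^2)) (s/a^2) :=
        (chi_contDiff.differentiable (by simp) _).hasDerivAt
      exact HasDerivAt.comp (h₂ := chi) (h := fun s : ℝ => s / a^2) s hc ((hasDerivAt_id s).div_const (a^2))
    have h3 : deriv (Qk d a) s = _ := (h1.mul h2).deriv
    rw [h3]
    unfold Qk
    have e1 : s ^ (-(d:ℝ)/2) = s ^ (-(d:ℝ)/2 - 1) * s := by
      rw [← Real.rpow_add_one hs'.ne']; congr 1; ring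
    have e2 : s ^ (1 - (d:ℝ)/2) = s ^ (-(d:ℝ)/2 - 1) * s * s := by
      rw [← Real.rpow_add_one hs'.ne', ← Real.rpow_add_one hs'.ne']; congr 1; ring
    rw [e1, e2]
    field_simp
    ring

variable {d : ℕ}

def Vk (a : ℝ) (j : Fin d) (x : EE d) : ℝ := x j * Qk d a (‖x‖^2)

def eta (a : ℝ) (x : EE d) : ℝ := ∑ j : Fin d, pd j (Vk a j) x

lemma Vk_contDiff {a : ℝ} (ha : 0 < a) (j : Fin d) : ContDiff ℝ (⊤ : ℕ∞) (Vk a j) := by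
  unfold Vk
  refine ContDiff.mul (by fun_prop) ((Qk_contDiff d ha).comp (contDiff_norm_sq ℝ))

lemma pd_Vk {a : ℝ} (ha : 0 < a) (i j : Fin d) (x : EE d) :
    pd i (Vk a j) x = (if i = j then 1 else 0) * Qk d a (‖x‖^2)
      + 2 * x i * x j * deriv (Qk d a) (‖x‖^2) := by
  have h1 : HasFDerivAt (fun x : EE d => x j) (EuclideanSpace.proj (𝕜 := ℝ) j : EE d →L[ℝ] ℝ) x :=
    (EuclideanSpace.proj (𝕜 := ℝ) j : EE d →L[ℝ] ℝ).hasFDerivAt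
  have h2 : HasFDerivAt (fun x : EE d => ‖x‖^2) (2 • innerSL ℝ x) x :=
    (hasStrictFDerivAt_norm_sq x).hasFDerivAt
  have h3 : HasDerivAt (Qk d a) (deriv (Qk d a) (‖x‖^2)) (‖x‖^2) :=
    ((Qk_contDiff d ha).differentiable (by simp) _).hasDerivAt
  have h4 := h1.mul (h3.comp_hasFDerivAt x h2)
  unfold pd
  have h5 : fderiv ℝ (Vk a j) x = _ := h4.fderiv
  rw [h5]
  simp only [add_apply, smul_apply, innerSL_apply_apply,
    EuclideanSpace.inner_single_right, smul_eq_mul, nsmul_eq_mul, PiLp.proj_apply,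
    PiLp.single_apply, Function.comp]
  by_cases h : i = j
  · subst h; simp; ring
  · simp [h, Ne.symm h]; ring

lemma pd_Vk_symm {a : ℝ} (ha : 0 < a) (i j : Fin d) (x : EE d) :
    pd i (Vk a j) x = pd j (Vk a i) x := by
  rw [pd_Vk ha, pd_Vk ha]
  by_cases h : i = j
  · subst h; rfl
  · rw [if_neg h, if_neg (Ne.symm h)]; ring

lemma eta_formula {a : ℝ} (ha : 0 < a) (x : EE d) :
    eta a x = 2 * (‖x‖^2) ^ (1 - (d:ℝ)/2) * deriv chi (‖x‖^2 / a^2) / a^2 := by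
  rw [← Qk_deriv d ha]
  unfold eta
  simp_rw [pd_Vk ha]
  simp only [if_true, one_mul]
  rw [Finset.sum_add_distrib, EuclideanSpace.norm_sq_eq]
  simp only [Finset.sum_const, Finset.card_univ, Fintype.card_fin, nsmul_eq_mul, Real.norm_eq_abs, sq_abs]
  rw [Finset.mul_sum, Finset.sum_mul]
  congr 1
  refine Finset.sum_congr rfl fun i _ => ?_
  ring

lemma eta_nonneg {a : ℝ} (ha : 0 < a) (x : EE d) : 0 ≤ eta a x := by
  rw [eta_formula ha]
  have := chi_deriv_nonneg (‖x‖^2 / a^2)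
  positivity

lemma eta_zero {a : ℝ} (ha : 0 < a) {x : EE d} (hx : a ≤ ‖x‖) : eta a x = 0 := by
  rw [eta_formula ha, chi_deriv_zero']
  · simp
  · rw [one_le_div (by positivity)]; gcongr

lemma eta_scale {a : ℝ} (ha : 0 < a) (x : EE d) : eta a x = (a^d)⁻¹ * eta 1 (a⁻¹ • x) := by
  rw [eta_formula ha, eta_formula one_pos, norm_smul, Real.norm_eq_abs, abs_of_pos (inv_pos.2 ha)]
  have e1 : (a⁻¹ * ‖x‖)^2 = ‖x‖^2 * (a^2)⁻¹ := by field_simp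
  rw [e1, Real.mul_rpow (by positivity) (by positivity)]
  have e2 : ((a^2)⁻¹) ^ (1 - (d:ℝ)/2) = a^d * (a^2)⁻¹ := by
    rw [Real.inv_rpow (by positivity), ← Real.rpow_natCast a 2, ← Real.rpow_mul ha.le,
      ← Real.rpow_natCast a d, ← Real.rpow_neg ha.le, ← Real.rpow_neg ha.le, ← Real.rpow_add ha]
    congr 1; push_cast; ring
  rw [e2]
  field_simp

lemma Vk_far {a : ℝ} (ha : 0 < a) (j : Fin d) {x : EE d} (hx : a ≤ ‖x‖) :
    Vk a j x = x j * (‖x‖^d)⁻¹ := by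
  unfold Vk Qk
  rw [chi_one, mul_one]
  · congr 1
    rw [← Real.rpow_natCast ‖x‖ 2, ← Real.rpow_mul (norm_nonneg _), ← Real.rpow_natCast ‖x‖ d,
      ← Real.rpow_neg (norm_nonneg _)]
    congr 1; push_cast; ring
  · rw [one_le_div (by positivity)]; gcongr

lemma Vk_bound {a : ℝ} (ha : 0 < a) (j : Fin d) (x : EE d) :
    |Vk a j x| ≤ ‖x‖ * (‖x‖^d)⁻¹ := by
  unfold Vk Qk
  have e : (‖x‖^2) ^ (-(d:ℝ)/2) = (‖x‖^d)⁻¹ := by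
    rw [← Real.rpow_natCast ‖x‖ 2, ← Real.rpow_mul (norm_nonneg _), ← Real.rpow_natCast ‖x‖ d,
      ← Real.rpow_neg (norm_nonneg _)]
    congr 1; push_cast; ring
  rw [e, abs_mul, abs_mul]
  have h1 : |x j| ≤ ‖x‖ := by simpa using PiLp.norm_apply_le x j
  have h2 : |chi (‖x‖^2/a^2)| ≤ 1 := by
    rw [abs_of_nonneg (chi_nonneg _)]; exact chi_le_one _
  have h3 : |(‖x‖^d)⁻¹| = (‖x‖^d)⁻¹ := abs_of_nonneg (by positivity)
  rw [h3]
  calc |x j| * ((‖x‖^d)⁻¹ * |chi (‖x‖^2/a^2)|) ≤ ‖x‖ * ((‖x‖^d)⁻¹ * 1) := by gcongr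
    _ = _ := by ring

lemma pd_contDiff {f : EE d → ℝ} (hf : ContDiff ℝ (⊤ : ℕ∞) f) (i : Fin d) :
    ContDiff ℝ (⊤ : ℕ∞) (pd i f) := by
  unfold pd
  have : ContDiff ℝ (⊤ : ℕ∞) (fderiv ℝ f) := hf.fderiv_right (by norm_cast)
  exact this.clm_apply contDiff_const

lemma pd_hcs {f : EE d → ℝ} (hf : HasCompactSupport f) (i : Fin d) :
    HasCompactSupport (pd i f) := by
  unfold pd
  exact hf.fderiv_apply (𝕜 := ℝ) _

lemma eta_contDiff {a : ℝ} (ha : 0 < a) : ContDiff ℝ (⊤ : ℕ∞) (eta a : EE d → ℝ) := by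
  unfold eta
  exact ContDiff.sum fun j _ => pd_contDiff (Vk_contDiff ha j) j

lemma eta_hcs {a : ℝ} (ha : 0 < a) : HasCompactSupport (eta a : EE d → ℝ) := by
  refine HasCompactSupport.intro (isCompact_closedBall 0 a) fun x hx => eta_zero ha ?_
  simp at hx; exact hx.le

lemma eta_integral {a : ℝ} (ha : 0 < a) : ∫ x : EE d, eta a x = ∫ x : EE d, eta 1 x := by
  simp_rw [eta_scale ha]
  rw [integral_const_mul, Measure.integral_comp_smul]
  simp only [finrank_euclideanSpace, Fintype.card_fin, smul_eq_mul]
  rw [abs_of_nonneg (by positivity), inv_pow, inv_inv]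
  field_simp

lemma eta_sq_integral {a : ℝ} (ha : 0 < a) :
    ∫ x : EE d, (eta a x)^2 = (a^d)⁻¹ * ∫ x : EE d, (eta 1 x)^2 := by
  simp_rw [eta_scale ha, mul_pow]
  rw [integral_const_mul, Measure.integral_comp_smul volume (fun x : EE d => (eta 1 x)^2)]
  simp only [finrank_euclideanSpace, Fintype.card_fin, smul_eq_mul]
  rw [abs_of_nonneg (by positivity), inv_pow a, inv_inv]
  field_simp

lemma eta_integral_pos (hd : 1 ≤ d) : 0 < ∫ x : EE d, eta 1 x := by
  obtain ⟨s, hs, h⟩ := chi_deriv_pos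
  set x : EE d := EuclideanSpace.single (⟨0, hd⟩ : Fin d) (Real.sqrt s)
  have hx : ‖x‖^2 = s := by simp [x, hs.le]
  refine Continuous.integral_pos_of_hasCompactSupport_nonneg_nonzero (x := x)
    (eta_contDiff one_pos).continuous (eta_hcs one_pos) (fun x => eta_nonneg one_pos x) ?_
  rw [eta_formula one_pos, hx]
  have : s ^ (1 - (d:ℝ)/2) ≠ 0 := (Real.rpow_pos_of_pos hs _).ne'
  simp [this, h]

end Clos

namespace Clos
variable {d : ℕ}

def cv (f g : EE d → ℝ) : EE d → ℝ := convolution f g (ContinuousLinearMap.mul ℝ ℝ) volume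

lemma cv_apply (f g : EE d → ℝ) (x : EE d) : cv f g x = ∫ t, f t * g (x - t) := rfl

lemma cv_integrable {f g : EE d → ℝ} (hf : LocallyIntegrable f volume) (hg : Continuous g)
    (hc : HasCompactSupport g) (x : EE d) : Integrable (fun t => f t * g (x - t)) volume :=
  (hc.convolutionExists_right (ContinuousLinearMap.mul ℝ ℝ) hf hg x)

lemma cv_contDiff {f g : EE d → ℝ} (hf : LocallyIntegrable f volume)
    (hg : ContDiff ℝ (⊤ : ℕ∞) g) (hc : HasCompactSupport g) : ContDiff ℝ (⊤ : ℕ∞) (cv f g) :=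
  hc.contDiff_convolution_right _ hf hg

lemma cv_hcs {f g : EE d → ℝ} (hf : HasCompactSupport f) (hg : HasCompactSupport g) :
    HasCompactSupport (cv f g) := hf.convolution _ hg

lemma pd_cv_right {f g : EE d → ℝ} (hf : LocallyIntegrable f volume)
    (hg : ContDiff ℝ (⊤ : ℕ∞) g) (hc : HasCompactSupport g) (i : Fin d) (x : EE d) :
    pd i (cv f g) x = cv f (pd i g) x := by
  have h := hc.hasFDerivAt_convolution_right (ContinuousLinearMap.mul ℝ ℝ) hf
    (hg.of_le (by norm_cast)) x
  have h' : fderiv ℝ (cv f g) x = _ := h.fderiv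
  unfold pd
  rw [h']
  rw [convolution_precompR_apply _ hf (hc.fderiv ℝ)
    (hg.continuous_fderiv (by simp))]
  rfl

lemma cv_comm (f g : EE d → ℝ) : cv f g = cv g f := by
  unfold cv
  rw [← convolution_flip]
  congr 1
  ext; simp

lemma pd_cv_left {f g : EE d → ℝ} (hg : LocallyIntegrable g volume)
    (hf : ContDiff ℝ (⊤ : ℕ∞) f) (hc : HasCompactSupport f) (i : Fin d) (x : EE d) :
    pd i (cv f g) x = cv (pd i f) g x := by
  rw [cv_comm f g, pd_cv_right hg hf hc, cv_comm]

lemma pd_symm {f : EE d → ℝ} (hf : ContDiff ℝ (⊤ : ℕ∞) f) (i j : Fin d) (x : EE d) :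
    pd i (pd j f) x = pd j (pd i f) x := by
  have h1 : ContDiff ℝ (⊤ : ℕ∞) (fderiv ℝ f) := hf.fderiv_right (by norm_cast)
  have key : ∀ u v : EE d, fderiv ℝ (fun y => fderiv ℝ f y u) x v = fderiv ℝ (fderiv ℝ f) x v u := by
    intro u v
    rw [fderiv_clm_apply (h1.differentiable (by simp) x) (differentiableAt_const u)]
    simp
  unfold pd
  rw [key, key]
  exact (hf.contDiffAt (x := x)).isSymmSndFDerivAt (by simp; norm_cast) _ _

lemma pd_sum {ι : Type*} (s : Finset ι) {f : ι → EE d → ℝ} (hf : ∀ l, ContDiff ℝ (⊤ : ℕ∞) (f l))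
    (i : Fin d) (x : EE d) : pd i (fun y => ∑ l ∈ s, f l y) x = ∑ l ∈ s, pd i (f l) x := by
  unfold pd
  rw [fderiv_fun_sum fun l _ => (hf l).differentiable (by simp) x]
  simp

lemma pd_sub {f g : EE d → ℝ} (hf : ContDiff ℝ (⊤ : ℕ∞) f) (hg : ContDiff ℝ (⊤ : ℕ∞) g)
    (i : Fin d) (x : EE d) : pd i (fun y => f y - g y) x = pd i f x - pd i g x := by
  unfold pd
  rw [fderiv_fun_sub (hf.differentiable (by simp) x) (hg.differentiable (by simp) x)]
  simp

lemma cv_sum_right {ι : Type*} (s : Finset ι) {f : EE d → ℝ} (hf : LocallyIntegrable f volume)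
    {g : ι → EE d → ℝ} (hg : ∀ l, Continuous (g l))
    (hc : ∀ l, HasCompactSupport (g l)) (x : EE d) :
    cv f (fun y => ∑ l ∈ s, g l y) x = ∑ l ∈ s, cv f (g l) x := by
  simp_rw [cv_apply, Finset.mul_sum]
  rw [integral_finsetSum _ fun l _ => cv_integrable hf (hg l) (hc l) x]

lemma cv_sum_left {ι : Type*} (s : Finset ι) {f : EE d → ℝ} (hf : LocallyIntegrable f volume)
    {g : ι → EE d → ℝ} (hg : ∀ l, Continuous (g l))
    (hc : ∀ l, HasCompactSupport (g l)) (x : EE d) :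
    cv (fun y => ∑ l ∈ s, g l y) f x = ∑ l ∈ s, cv (g l) f x := by
  rw [cv_comm, cv_sum_right s hf hg hc]
  simp_rw [cv_comm f]

lemma cv_sub_right {f : EE d → ℝ} (hf : LocallyIntegrable f volume)
    {g g' : EE d → ℝ} (hg : Continuous g) (hc : HasCompactSupport g)
    (hg' : Continuous g') (hc' : HasCompactSupport g') (x : EE d) :
    cv f (fun y => g y - g' y) x = cv f g x - cv f g' x := by
  simp_rw [cv_apply, mul_sub]
  rw [integral_sub (cv_integrable hf hg hc x) (cv_integrable hf hg' hc' x)]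

/-- mean value identity -/
lemma mv {φ Z : Fin d → EE d → ℝ} (hφ : ∀ j, ContDiff ℝ (⊤ : ℕ∞) (φ j))
    (hφc : ∀ j, HasCompactSupport (φ j)) (hφs : ∀ i j x, pd i (φ j) x = pd j (φ i) x)
    (hZ : ∀ j, ContDiff ℝ (⊤ : ℕ∞) (Z j))
    (hZc : ∀ j, HasCompactSupport (Z j)) (hZs : ∀ i j x, pd i (Z j) x = pd j (Z i) x)
    (i j : Fin d) (x : EE d) :
    cv (pd i (φ j)) (fun y => ∑ l, pd l (Z l) y) x
      = cv (pd i (fun y => ∑ l, pd l (φ l) y)) (Z j) x := by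
  have li : ∀ {f : EE d → ℝ}, ContDiff ℝ (⊤ : ℕ∞) f → LocallyIntegrable f volume :=
    fun hf => hf.continuous.locallyIntegrable
  have sw : ∀ {f Y : EE d → ℝ}, ContDiff ℝ (⊤ : ℕ∞) f → HasCompactSupport f →
      ContDiff ℝ (⊤ : ℕ∞) Y → HasCompactSupport Y → ∀ k, cv f (pd k Y) x = cv (pd k f) Y x := by
    intro f Y hf hfc hY hYc k
    rw [← pd_cv_right (li hf) hY hYc, pd_cv_left (li hY) hf hfc]
  have h1 : ∀ i j, ContDiff ℝ (⊤ : ℕ∞) (pd i (φ j)) := fun i j => pd_contDiff (hφ j) i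
  have c1 : ∀ i j, HasCompactSupport (pd i (φ j)) := fun i j => pd_hcs (hφc j) i
  have e0 : pd i (fun y => ∑ l, pd l (φ l) y) = fun y => ∑ l, pd l (pd i (φ l)) y := by
    ext y
    rw [pd_sum Finset.univ (fun l => h1 l l)]
    exact Finset.sum_congr rfl fun l _ => pd_symm (hφ l) _ _ _
  rw [e0, cv_sum_right _ (li (h1 i j)) (fun l => (pd_contDiff (hZ l) l).continuous)
    (fun l => pd_hcs (hZc l) l),
    cv_sum_left _ (li (hZ j)) (fun l => (pd_contDiff (h1 i l) l).continuous)
    (fun l => pd_hcs (c1 i l) l)]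
  refine Finset.sum_congr rfl fun l _ => ?_
  rw [sw (h1 i j) (c1 i j) (hZ l) (hZc l), ← sw (h1 i l) (c1 i l) (hZ j) (hZc j)]
  have e1 : pd l (Z j) = pd j (Z l) := funext fun y => hZs _ _ _
  rw [e1, sw (h1 i l) (c1 i l) (hZ l) (hZc l)]
  congr 1
  ext y
  rw [pd_symm (hφ j), pd_symm (hφ l)]
  congr 1
  ext y
  exact hφs _ _ _

lemma ibp {f g : EE d → ℝ} (hf : ContDiff ℝ (⊤ : ℕ∞) f) (hfc : HasCompactSupport f)
    (hg : ContDiff ℝ (⊤ : ℕ∞) g) (i : Fin d) :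
    ∫ x, f x * pd i g x = - ∫ x, pd i f x * g x := by
  refine integral_mul_fderiv_eq_neg_fderiv_mul_of_integrable ?_ ?_ ?_
    (fun x _ => hf.differentiable (by simp) x) (fun x _ => hg.differentiable (by simp) x)
  · exact ((pd_contDiff hf i).continuous.mul hg.continuous).integrable_of_hasCompactSupport
      ((pd_hcs hfc i).mul_right)
  · exact (hf.continuous.mul (pd_contDiff hg i).continuous).integrable_of_hasCompactSupport
      (hfc.mul_right)
  · exact (hf.continuous.mul hg.continuous).integrable_of_hasCompactSupport (hfc.mul_right)

lemma l2id {φ : Fin d → EE d → ℝ} (hφ : ∀ j, ContDiff ℝ (⊤ : ℕ∞) (φ j))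
    (hφc : ∀ j, HasCompactSupport (φ j)) (hφs : ∀ i j x, pd i (φ j) x = pd j (φ i) x) :
    ∑ i, ∑ j, ∫ x, (pd i (φ j) x)^2 = ∫ x, (∑ j, pd j (φ j) x)^2 := by
  have h1 : ∀ i j, ContDiff ℝ (⊤ : ℕ∞) (pd i (φ j)) := fun i j => pd_contDiff (hφ j) i
  have c1 : ∀ i j, HasCompactSupport (pd i (φ j)) := fun i j => pd_hcs (hφc j) i
  have e1 : ∀ i j, ∫ x, (pd i (φ j) x)^2 = ∫ x, pd i (φ i) x * pd j (φ j) x := by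
    intro i j
    have a1 : ∫ x, (pd i (φ j) x)^2 = ∫ x, pd i (φ j) x * pd j (φ i) x := by
      congr 1; ext x; rw [hφs j i]; ring
    have a2 := ibp (hφ j) (hφc j) (h1 j i) i
    have a3 := ibp (hφ j) (hφc j) (h1 i i) j
    have a4 : pd i (pd j (φ i)) = pd j (pd i (φ i)) := funext fun x => pd_symm (hφ i) _ _ _
    rw [a4, a3] at a2
    rw [a1, ← neg_inj, ← a2]
    congr 2; ext x; ring
  simp_rw [e1, sq, Finset.sum_mul_sum]
  have int : ∀ i j, Integrable (fun x => pd i (φ i) x * pd j (φ j) x) volume := fun i j =>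
    ((h1 i i).continuous.mul (h1 j j).continuous).integrable_of_hasCompactSupport
      ((c1 i i).mul_right)
  rw [integral_finsetSum _ fun i _ => integrable_finsetSum _ fun j _ => int i j]
  refine Finset.sum_congr rfl fun i _ => ?_
  rw [integral_finsetSum _ fun j _ => int i j]

end Clos

namespace Clos
variable {d : ℕ}

def cc (d : ℕ) : ℝ := ∫ x : EE d, eta 1 x

def hh (Ω : Set (EE d)) : EE d → ℝ := Ω.indicator (fun _ => 1)

def kap (z : EE d) : ℝ := (Metric.closedBall (0 : EE d) 1).indicator (fun z => ‖z‖ * (‖z‖^d)⁻¹) z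

lemma kap_nonneg (z : EE d) : 0 ≤ kap z := by
  unfold kap; exact Set.indicator_nonneg (fun _ _ => by positivity) _

lemma kap_integrable (hd : 1 ≤ d) : Integrable (kap : EE d → ℝ) volume := by
  unfold kap
  rw [integrable_indicator_iff measurableSet_closedBall]
  refine IntegrableOn.mono_set (t := Metric.ball 0 2) ?_ ?_
  · refine integrableOn_ball_of_norm_le_rpow (α := (d:ℝ) - 1) (C := 1) (by simpa using hd) (by simp) ?_ ?_
    · refine ae_of_all _ fun x => ?_
      rw [Real.norm_eq_abs, abs_of_nonneg (by positivity), one_mul]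
      by_cases hx : ‖x‖ = 0
      · rw [hx]; simp; positivity
      · rw [neg_sub, Real.rpow_sub (lt_of_le_of_ne (norm_nonneg _) (Ne.symm hx)), Real.rpow_one,
          Real.rpow_natCast, div_eq_mul_inv]
    · exact (by fun_prop : Measurable (fun z : EE d => ‖z‖ * (‖z‖^d)⁻¹)).aestronglyMeasurable
  · exact Metric.closedBall_subset_ball (by norm_num)

lemma Vsub_bound {a b : ℝ} (ha : 0 < a) (hb : 0 < b) (ha1 : a ≤ 1) (hb1 : b ≤ 1) (j : Fin d)
    (z : EE d) : |Vk a j z - Vk b j z| ≤ 2 * kap z := by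
  by_cases hz : ‖z‖ ≤ 1
  · have : kap z = ‖z‖ * (‖z‖^d)⁻¹ := by
      unfold kap; rw [Set.indicator_of_mem (by simpa using hz)]
    rw [this]
    have h1 := Vk_bound ha j z
    have h2 := Vk_bound hb j z
    calc _ ≤ |Vk a j z| + |Vk b j z| := abs_sub _ _
      _ ≤ _ := by linarith
  · push Not at hz
    rw [Vk_far ha j (by linarith), Vk_far hb j (by linarith)]
    simp [kap_nonneg]

lemma Vsub_far {a b : ℝ} (ha : 0 < a) (hab : a ≤ b) (j : Fin d)
    {z : EE d} (hz : b ≤ ‖z‖) : Vk b j z - Vk a j z = 0 := by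
  rw [Vk_far ha j (by linarith), Vk_far (by linarith) j (by linarith)]; ring

lemma Vsub_hcs {a b : ℝ} (ha : 0 < a) (hb : 0 < b) (j : Fin d) :
    HasCompactSupport (fun z : EE d => Vk a j z - Vk b j z) := by
  refine HasCompactSupport.intro (isCompact_closedBall 0 (max a b)) fun x hx => ?_
  simp only [Metric.mem_closedBall, dist_zero_right, not_le, max_lt_iff] at hx
  rw [Vk_far ha j hx.1.le, Vk_far hb j hx.2.le]; ring

lemma Vsub_contDiff {a b : ℝ} (ha : 0 < a) (hb : 0 < b) (j : Fin d) :
    ContDiff ℝ (⊤ : ℕ∞) (fun z : EE d => Vk a j z - Vk b j z) :=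
  (Vk_contDiff ha j).sub (Vk_contDiff hb j)

lemma Vsub_symm {a b : ℝ} (ha : 0 < a) (hb : 0 < b) (i j : Fin d) (x : EE d) :
    pd i (fun z : EE d => Vk a j z - Vk b j z) x = pd j (fun z : EE d => Vk a i z - Vk b i z) x := by
  rw [pd_sub (Vk_contDiff ha j) (Vk_contDiff hb j), pd_sub (Vk_contDiff ha i) (Vk_contDiff hb i),
    pd_Vk_symm ha, pd_Vk_symm hb]

lemma Vsub_div {a b : ℝ} (ha : 0 < a) (hb : 0 < b) (x : EE d) :
    ∑ j, pd j (fun z : EE d => Vk a j z - Vk b j z) x = eta a x - eta b x := by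
  simp_rw [fun j => pd_sub (Vk_contDiff (d := d) ha j) (Vk_contDiff hb j) j x]
  rw [Finset.sum_sub_distrib]; rfl

def phi (δ : ℝ) (Ω : Set (EE d)) (j : Fin d) : EE d → ℝ :=
  cv (hh Ω) (fun y => Vk δ j y - Vk 1 j y)

def vv (δ : ℝ) (Ω : Set (EE d)) (j : Fin d) : EE d → ℝ := cv (phi δ Ω j) (eta δ)

section
variable {Ω : Set (EE d)} (hO : IsOpen Ω) (hOf : volume Ω ≠ ⊤) {δ : ℝ} (hδ : 0 < δ) (hδ1 : δ ≤ 1)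
include hO hOf

lemma hh_int : Integrable (hh Ω) volume := by
  unfold hh
  rw [integrable_indicator_iff hO.measurableSet]
  exact integrableOn_const hOf

lemma hh_integral : ∫ x, hh Ω x = volume.real Ω := by
  unfold hh
  rw [integral_indicator hO.measurableSet]; simp

omit hO hOf in
lemma hh_nonneg (x : EE d) : 0 ≤ hh Ω x := Set.indicator_nonneg (fun _ _ => zero_le_one) _

omit hO hOf in
lemma hh_le (x : EE d) : hh Ω x ≤ 1 := Set.indicator_le_self' (fun _ _ => zero_le_one) _

lemma hh_bound {g : EE d → ℝ} (hg : Continuous g) (hc : HasCompactSupport g) {M : ℝ}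
    (hM : ∀ x, |g x| ≤ M) (x : EE d) : |cv (hh Ω) g x| ≤ M * volume.real Ω := by
  rw [cv_apply, ← hh_integral hO hOf, ← integral_const_mul, ← Real.norm_eq_abs]
  refine norm_integral_le_of_norm_le ((hh_int hO hOf).const_mul M) (ae_of_all _ fun t => ?_)
  rw [norm_mul, Real.norm_eq_abs, Real.norm_eq_abs, abs_of_nonneg (hh_nonneg t), mul_comm]
  exact mul_le_mul_of_nonneg_right (hM _) (hh_nonneg t)

lemma heta_nonneg {a : ℝ} (ha : 0 < a) (x : EE d) : 0 ≤ cv (hh Ω) (eta a) x :=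
  integral_nonneg fun t => mul_nonneg (hh_nonneg t) (eta_nonneg ha _)

omit hO hOf in
lemma eta_int' {a : ℝ} (ha : 0 < a) (x : EE d) : Integrable (fun t => eta a (x - t)) volume :=
  (((eta_contDiff ha).continuous.integrable_of_hasCompactSupport (eta_hcs ha))).comp_sub_left x

omit hO hOf in
lemma eta_integral' {a : ℝ} (ha : 0 < a) (x : EE d) : ∫ t, eta a (x - t) = cc d := by
  rw [integral_sub_left_eq_self (fun t => eta a t) volume x, eta_integral ha]; rfl

lemma heta_le {a : ℝ} (ha : 0 < a) (x : EE d) : cv (hh Ω) (eta a) x ≤ cc d := by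
  rw [cv_apply, ← eta_integral' ha x]
  refine integral_mono (cv_integrable (hh_int hO hOf).locallyIntegrable
    (eta_contDiff ha).continuous (eta_hcs ha) x) (eta_int' ha x) fun t => ?_
  exact mul_le_of_le_one_left (eta_nonneg ha _) (hh_le t)

lemma heta_eq {a : ℝ} (ha : 0 < a) {x : EE d} (hx : Metric.ball x a ⊆ Ω) :
    cv (hh Ω) (eta a) x = cc d := by
  rw [cv_apply, ← eta_integral' ha x]
  congr 1; ext t
  by_cases ht : t ∈ Ω
  · simp [hh, ht]
  · have : a ≤ ‖x - t‖ := by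
      by_contra h
      push Not at h
      exact ht (hx (by rwa [Metric.mem_ball, dist_comm, dist_eq_norm]))
    rw [eta_zero ha this]; simp

lemma heta_integral {a : ℝ} (ha : 0 < a) :
    Integrable (cv (hh Ω) (eta a)) volume ∧ ∫ x, cv (hh Ω) (eta a) x = cc d * volume.real Ω := by
  have hi := (eta_contDiff (d := d) ha).continuous.integrable_of_hasCompactSupport (eta_hcs ha)
    (μ := volume)
  constructor
  · exact (hh_int hO hOf).integrable_convolution _ hi
  · have := integral_convolution (μ := volume) (ν := volume) (ContinuousLinearMap.mul ℝ ℝ)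
      (hh_int hO hOf) hi
    unfold cv
    rw [this, hh_integral hO hOf, eta_integral ha]
    simp [cc, mul_comm]

include hδ

lemma phi_contDiff (j : Fin d) : ContDiff ℝ (⊤ : ℕ∞) (phi δ Ω j) :=
  cv_contDiff (hh_int hO hOf).locallyIntegrable (Vsub_contDiff hδ one_pos j) (Vsub_hcs hδ one_pos j)

lemma pd_phi (i j : Fin d) (x : EE d) :
    pd i (phi δ Ω j) x = cv (hh Ω) (pd i (fun y => Vk δ j y - Vk 1 j y)) x :=
  pd_cv_right (hh_int hO hOf).locallyIntegrable (Vsub_contDiff hδ one_pos j)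
    (Vsub_hcs hδ one_pos j) i x

lemma phi_symm (i j : Fin d) (x : EE d) : pd i (phi δ Ω j) x = pd j (phi δ Ω i) x := by
  rw [pd_phi hO hOf hδ, pd_phi hO hOf hδ]
  congr 1; ext y; exact Vsub_symm hδ one_pos _ _ _

lemma phi_div (x : EE d) :
    ∑ j, pd j (phi δ Ω j) x = cv (hh Ω) (eta δ) x - cv (hh Ω) (eta 1) x := by
  simp_rw [pd_phi hO hOf hδ]
  have li := (hh_int hO hOf).locallyIntegrable
  rw [← cv_sum_right _ li (fun l => (pd_contDiff (Vsub_contDiff hδ one_pos l) l).continuous)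
    (fun l => pd_hcs (Vsub_hcs hδ one_pos l) l)]
  simp_rw [Vsub_div hδ one_pos]
  rw [cv_sub_right li (eta_contDiff hδ).continuous (eta_hcs hδ) (eta_contDiff one_pos).continuous
    (eta_hcs one_pos)]

lemma phi_div_sq : ∫ x, (∑ j, pd j (phi δ Ω j) x)^2 ≤ 2 * (cc d)^2 * volume.real Ω := by
  simp_rw [phi_div hO hOf hδ]
  have h1 := heta_integral hO hOf hδ
  have h2 := heta_integral hO hOf one_pos
  have : ∫ x, cc d * (cv (hh Ω) (eta δ) x + cv (hh Ω) (eta 1) x) = 2 * (cc d)^2 * volume.real Ω := by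
    rw [integral_const_mul, integral_add h1.1 h2.1, h1.2, h2.2]; ring
  rw [← this]
  refine integral_mono_of_nonneg (ae_of_all _ fun x => sq_nonneg _)
    ((h1.1.add h2.1).const_mul _) (ae_of_all _ fun x => ?_)
  have a1 := heta_nonneg hO hOf hδ x
  have a2 := heta_le hO hOf hδ x
  have b1 := heta_nonneg hO hOf one_pos x
  have b2 := heta_le hO hOf one_pos x
  dsimp only
  nlinarith [mul_nonneg a1 b1, mul_nonneg a1 (sub_nonneg.2 a2), mul_nonneg b1 (sub_nonneg.2 b2)]

include hδ1

lemma phi_bound {ε : ℝ} (hd : 1 ≤ d)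
    (hε : ∀ A : Set (EE d), MeasurableSet A → volume A = volume Ω → ∫ z in A, kap z ≤ ε)
    (j : Fin d) (x : EE d) : |phi δ Ω j x| ≤ 2 * ε := by
  set A : Set (EE d) := (fun z => x - z) ⁻¹' Ω
  have mp := Measure.measurePreserving_sub_left (volume : Measure (EE d)) x
  have hA : MeasurableSet A := mp.measurable hO.measurableSet
  have hvA : volume A = volume Ω := mp.measure_preimage hO.measurableSet.nullMeasurableSet
  have h1 : |phi δ Ω j x| ≤ ∫ t, hh Ω t * (2 * kap (x - t)) := by
    unfold phi
    rw [cv_apply, ← Real.norm_eq_abs]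
    refine norm_integral_le_of_norm_le ?_ (ae_of_all _ fun t => ?_)
    · have : Integrable (fun t => 2 * kap (x - t)) (volume : Measure (EE d)) :=
        ((kap_integrable hd).comp_sub_left x).const_mul 2
      have h := this.indicator hO.measurableSet
      refine h.congr (ae_of_all _ fun t => ?_)
      by_cases ht : t ∈ Ω <;> simp [hh, ht]
    · rw [norm_mul, Real.norm_eq_abs, Real.norm_eq_abs, abs_of_nonneg (hh_nonneg t)]
      exact mul_le_mul_of_nonneg_left (Vsub_bound hδ one_pos hδ1 le_rfl j _) (hh_nonneg t)
  have h2 : ∫ t, hh Ω t * (2 * kap (x - t)) = 2 * ∫ z in A, kap z := by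
    rw [← integral_indicator hA, ← integral_const_mul,
      ← integral_sub_left_eq_self (fun z => 2 * A.indicator kap z) volume x]
    congr 1; ext t
    by_cases ht : t ∈ Ω <;> simp [hh, ht, A]
  rw [h2] at h1
  linarith [hε A hA hvA]

end

lemma cauchy_eta {g : EE d → ℝ} (hg : Continuous g) {ρ : ℝ} (hρ : 0 < ρ) (x : EE d) :
    (cv g (eta ρ) x)^2 ≤
      (ρ^d)⁻¹ * (∫ z : EE d, (eta 1 z)^2) * ∫ y in Metric.closedBall x ρ, (g y)^2 := by
  set B := Metric.closedBall x ρ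
  have e1 : cv g (eta ρ) x = ∫ t in B, g t * eta ρ (x - t) := by
    rw [cv_apply, setIntegral_eq_integral_of_forall_compl_eq_zero]
    intro t ht
    rw [eta_zero hρ, mul_zero]
    simp only [B, Metric.mem_closedBall, not_le] at ht
    rw [← dist_eq_norm, dist_comm]; exact ht.le
  have hgc : Continuous (fun t => eta ρ (x - t)) :=
    (eta_contDiff hρ).continuous.comp (by fun_prop)
  have fin : IsFiniteMeasure (volume.restrict B) :=
    ⟨by simpa [B] using (isCompact_closedBall x ρ).measure_lt_top⟩
  have mem : ∀ {f : EE d → ℝ}, Continuous f → MemLp f (ENNReal.ofReal 2) (volume.restrict B) := by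
    intro f hf
    obtain ⟨C, hC⟩ := (isCompact_closedBall x ρ).exists_bound_of_continuousOn hf.continuousOn
    exact MemLp.of_bound hf.aestronglyMeasurable C
      ((ae_restrict_iff' measurableSet_closedBall).2 (ae_of_all _ hC))
  have cs := integral_mul_norm_le_Lp_mul_Lq (μ := volume.restrict B) Real.HolderConjugate.two_two (mem hg) (mem hgc)
  have e2 : |cv g (eta ρ) x| ≤ ∫ t in B, ‖g t‖ * ‖eta ρ (x - t)‖ := by
    rw [e1, ← Real.norm_eq_abs]
    refine (norm_integral_le_integral_norm _).trans (le_of_eq ?_)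
    simp_rw [norm_mul]
  have h1 : 0 ≤ ∫ t in B, ‖g t‖ ^ (2:ℝ) := integral_nonneg fun t => by positivity
  have h2 : 0 ≤ ∫ t in B, ‖eta ρ (x - t)‖ ^ (2:ℝ) := integral_nonneg fun t => by positivity
  have e3 : (cv g (eta ρ) x)^2 ≤ (∫ t in B, ‖g t‖ ^ (2:ℝ)) * (∫ t in B, ‖eta ρ (x - t)‖ ^ (2:ℝ)) := by
    rw [← sq_abs]
    refine (pow_le_pow_left₀ (abs_nonneg _) (e2.trans cs) 2).trans (le_of_eq ?_)
    rw [mul_pow, ← Real.sqrt_eq_rpow, ← Real.sqrt_eq_rpow, Real.sq_sqrt h1, Real.sq_sqrt h2]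
  simp only [Real.rpow_two, Real.norm_eq_abs, sq_abs] at e3
  have e4 : ∫ t in B, (eta ρ (x - t))^2 ≤ (ρ^d)⁻¹ * (∫ z : EE d, (eta 1 z)^2) := by
    rw [← eta_sq_integral hρ, ← integral_sub_left_eq_self (fun t => (eta ρ t)^2) volume x]
    refine setIntegral_le_integral ?_ (ae_of_all _ fun t => sq_nonneg _)
    have : Integrable (fun t : EE d => (eta ρ t)^2) volume := by
      refine Continuous.integrable_of_hasCompactSupport ((eta_contDiff hρ).continuous.pow 2) ?_
      exact (eta_hcs hρ).comp_left (g := fun s : ℝ => s^2) (by simp)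
    exact this.comp_sub_left x
  refine e3.trans ?_
  rw [mul_comm]
  exact mul_le_mul_of_nonneg_right e4 (integral_nonneg fun t => sq_nonneg _)

end Clos

namespace Clos
variable {d : ℕ}

lemma cc_nonneg : 0 ≤ cc d := integral_nonneg fun x => eta_nonneg one_pos x

lemma cv_eta_bound {f : EE d → ℝ} {a M : ℝ} (ha : 0 < a) (hM : ∀ x, |f x| ≤ M) (x : EE d) :
    |cv f (eta a) x| ≤ M * cc d := by
  rw [cv_apply, ← eta_integral' ha x, ← integral_const_mul, ← Real.norm_eq_abs]
  refine norm_integral_le_of_norm_le ((eta_int' ha x).const_mul M) (ae_of_all _ fun t => ?_)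
  rw [norm_mul, Real.norm_eq_abs, Real.norm_eq_abs, abs_of_nonneg (eta_nonneg ha _)]
  exact mul_le_mul_of_nonneg_right (hM _) (eta_nonneg ha _)

section
variable {Ω : Set (EE d)} (hO : IsOpen Ω) (hOb : Bornology.IsBounded Ω) {δ : ℝ} (hδ : 0 < δ) (hδ1 : δ ≤ 1)
include hO hOb

lemma Of : volume Ω ≠ ⊤ := hOb.measure_lt_top.ne

include hδ

lemma phi_hcs (j : Fin d) : HasCompactSupport (phi δ Ω j) := by
  refine cv_hcs ?_ (Vsub_hcs hδ one_pos j)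
  refine HasCompactSupport.intro hOb.isCompact_closure fun x hx => ?_
  exact Set.indicator_of_notMem (fun h => hx (subset_closure h)) _

lemma vv_contDiff (j : Fin d) : ContDiff ℝ (⊤ : ℕ∞) (vv δ Ω j) :=
  cv_contDiff (phi_contDiff hO (Of hO hOb) hδ j).continuous.locallyIntegrable
    (eta_contDiff hδ) (eta_hcs hδ)

lemma pd_vv (i j : Fin d) (x : EE d) :
    pd i (vv δ Ω j) x = cv (pd i (phi δ Ω j)) (eta δ) x :=
  pd_cv_left (eta_contDiff hδ).continuous.locallyIntegrable
    (phi_contDiff hO (Of hO hOb) hδ j) (phi_hcs hO hOb hδ j) i x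

lemma div_vv (x : EE d) :
    ∑ j, pd j (vv δ Ω j) x
      = cv (fun y => cv (hh Ω) (eta δ) y - cv (hh Ω) (eta 1) y) (eta δ) x := by
  simp_rw [pd_vv hO hOb hδ, ← phi_div hO (Of hO hOb) hδ]
  rw [cv_sum_left _ (eta_contDiff hδ).continuous.locallyIntegrable
    (fun l => (pd_contDiff (phi_contDiff hO (Of hO hOb) hδ l) l).continuous)
    (fun l => pd_hcs (phi_hcs hO hOb hδ l) l)]

lemma div_vv_lower {M : ℝ} (hM : ∀ z : EE d, |eta 1 z| ≤ M) (x : EE d) :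
    - (M * volume.real Ω * cc d) ≤ ∑ j, pd j (vv δ Ω j) x ∧
    (Metric.ball x (2 * δ) ⊆ Ω → cc d * cc d - M * volume.real Ω * cc d
      ≤ ∑ j, pd j (vv δ Ω j) x) := by
  rw [div_vv hO hOb hδ]
  have li := (hh_int hO (Of hO hOb)).locallyIntegrable
  have c1 : ∀ {a : ℝ}, 0 < a → Continuous (cv (hh Ω) (eta a)) := fun ha =>
    (cv_contDiff li (eta_contDiff ha) (eta_hcs ha)).continuous
  have e : cv (fun y => cv (hh Ω) (eta δ) y - cv (hh Ω) (eta 1) y) (eta δ) x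
      = cv (cv (hh Ω) (eta δ)) (eta δ) x - cv (cv (hh Ω) (eta 1)) (eta δ) x := by
    simp_rw [cv_apply _ (eta δ) x, sub_mul]
    rw [integral_sub (cv_integrable (c1 hδ).locallyIntegrable (eta_contDiff hδ).continuous (eta_hcs hδ) x)
      (cv_integrable (c1 one_pos).locallyIntegrable (eta_contDiff hδ).continuous (eta_hcs hδ) x)]
  rw [e]
  have b1 := abs_le.1 (cv_eta_bound hδ (hh_bound hO (Of hO hOb) (eta_contDiff one_pos).continuous
    (eta_hcs one_pos) hM) x)
  constructor
  · have b2 : 0 ≤ cv (cv (hh Ω) (eta δ)) (eta δ) x := integral_nonneg fun t =>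
      mul_nonneg (heta_nonneg hO (Of hO hOb) hδ t) (eta_nonneg hδ _)
    linarith [b1.2]
  · intro hx
    have b2 : cv (cv (hh Ω) (eta δ)) (eta δ) x = cc d * cc d := by
      rw [cv_apply, ← eta_integral' hδ x, ← integral_const_mul]
      congr 1; ext t
      by_cases ht : ‖x - t‖ < δ
      · rw [heta_eq hO (Of hO hOb) hδ, eta_integral' hδ x]
        intro z hz
        apply hx
        rw [Metric.mem_ball] at *
        have := dist_triangle z t x
        rw [← dist_eq_norm, dist_comm] at ht
        linarith
      · rw [eta_zero hδ (not_lt.1 ht)]; simp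
    linarith [b1.2]

include hδ1

lemma vv_bound {ε : ℝ} (hd : 1 ≤ d)
    (hε : ∀ A : Set (EE d), MeasurableSet A → volume A = volume Ω → ∫ z in A, kap z ≤ ε)
    (j : Fin d) (x : EE d) : |vv δ Ω j x| ≤ 2 * ε * cc d :=
  cv_eta_bound hδ (phi_bound hO (Of hO hOb) hδ hδ1 hd hε j) x

lemma ptA (hd : 1 ≤ d) {M : ℝ} (hM : ∀ i, ∀ z : EE d, |pd i (eta 1) z| ≤ M) {ρ : ℝ} (hρδ : δ ≤ ρ) (hρ1 : ρ ≤ 1)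
    {x : EE d} (hx : ρ = δ ∨ Metric.ball x (3 * ρ) ⊆ Ω) (i j : Fin d) :
    (pd i (vv δ Ω j) x)^2 ≤
      2 * ((ρ^d)⁻¹ * (∫ z : EE d, (eta 1 z)^2) *
        ∫ y in Metric.closedBall x ρ, (pd i (phi δ Ω j) y)^2)
      + 2 * (2 * (M * volume.real Ω) * ∫ z : EE d, kap z)^2 := by
  have hρ : 0 < ρ := by linarith
  have hpc := phi_contDiff (d := d) hO (Of hO hOb) hδ
  have hph := phi_hcs (d := d) hO hOb hδ
  have cs := cauchy_eta (pd_contDiff (hpc j) i).continuous hρ x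
  have M0 : 0 ≤ M := (abs_nonneg _).trans (hM i 0)
  suffices h : |pd i (vv δ Ω j) x - cv (pd i (phi δ Ω j)) (eta ρ) x|
      ≤ 2 * (M * volume.real Ω) * ∫ z : EE d, kap z by
    have h2 := sq_le_sq' (abs_le.1 h).1 (abs_le.1 h).2
    nlinarith [sq_nonneg (pd i (vv δ Ω j) x - 2 * cv (pd i (phi δ Ω j)) (eta ρ) x)]
  rw [pd_vv hO hOb hδ]
  have k0 : 0 ≤ ∫ z : EE d, kap z := integral_nonneg fun z => kap_nonneg z
  rcases hx with rfl | hx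
  · rw [sub_self, abs_zero]; positivity
  have li := (hh_int hO (Of hO hOb)).locallyIntegrable
  have m := mv hpc hph (phi_symm hO (Of hO hOb) hδ)
    (Z := fun j z => Vk ρ j z - Vk δ j z) (Vsub_contDiff hρ hδ) (Vsub_hcs hρ hδ) (Vsub_symm hρ hδ) i j x
  simp_rw [Vsub_div hρ hδ] at m
  rw [cv_sub_right (pd_contDiff (hpc j) i).continuous.locallyIntegrable (eta_contDiff hρ).continuous
    (eta_hcs hρ) (eta_contDiff hδ).continuous (eta_hcs hδ)] at m
  rw [abs_sub_comm, m]
  simp_rw [phi_div hO (Of hO hOb) hδ]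
  rw [← integral_sub_left_eq_self kap volume x, ← integral_const_mul, cv_apply, ← Real.norm_eq_abs]
  refine norm_integral_le_of_norm_le (((kap_integrable hd).comp_sub_left x).const_mul _)
    (ae_of_all _ fun t => ?_)
  rw [norm_mul, Real.norm_eq_abs, Real.norm_eq_abs]
  by_cases ht : ‖x - t‖ < ρ
  · have ev : (fun y => cv (hh Ω) (eta δ) y - cv (hh Ω) (eta 1) y)
        =ᶠ[nhds t] fun y => cc d - cv (hh Ω) (eta 1) y := by
      filter_upwards [Metric.ball_mem_nhds t hρ] with y hy
      rw [heta_eq hO (Of hO hOb) hδ]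
      intro z hz
      apply hx
      rw [Metric.mem_ball] at *
      have h1 := dist_triangle z y x
      have h2 := dist_triangle y t x
      rw [← dist_eq_norm, dist_comm] at ht
      linarith
    have e1 : pd i (fun y => cv (hh Ω) (eta δ) y - cv (hh Ω) (eta 1) y) t
        = - cv (hh Ω) (pd i (eta 1)) t := by
      rw [← pd_cv_right li (eta_contDiff one_pos) (eta_hcs one_pos)]
      unfold pd
      rw [ev.fderiv_eq, fderiv_const_sub]
      simp
    rw [e1, abs_neg]
    have b := hh_bound hO (Of hO hOb) (pd_contDiff (eta_contDiff one_pos) i).continuous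
      (pd_hcs (eta_hcs one_pos) i) (hM i) t
    have b2 := Vsub_bound hρ hδ hρ1 hδ1 j (x - t)
    calc _ ≤ (M * volume.real Ω) * (2 * kap (x - t)) := by gcongr
      _ = _ := by ring
  · rw [Vsub_far hδ hρδ j (not_lt.1 ht), abs_zero, mul_zero]
    have := kap_nonneg (x - t)
    positivity

end
end Clos

namespace Clos
variable {d : ℕ}

def Om (m : Measure (EE d)) (t : ℝ≥0∞) : Set (EE d) :=
  {x | ∃ r > 0, t * volume (Metric.closedBall x r) < m (Metric.closedBall x r)}

lemma vol_cb (x : EE d) {r : ℝ} (hr : 0 ≤ r) :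
    volume (Metric.closedBall x r) = ENNReal.ofReal (r ^ d) * volume (Metric.ball (0 : EE d) 1) := by
  rw [Measure.addHaar_closedBall _ _ hr]; simp

lemma om_pos : 0 < volume (Metric.ball (0 : EE d) 1) := Metric.measure_ball_pos _ _ one_pos
lemma om_fin : volume (Metric.ball (0 : EE d) 1) ≠ ⊤ := measure_ball_lt_top.ne

lemma Om_open (m : Measure (EE d)) {t : ℝ≥0∞} (ht : t ≠ ⊤) : IsOpen (Om m t) := by
  rw [Metric.isOpen_iff]
  rintro x ⟨r, hr, h⟩
  have cont : Tendsto (fun s : ℝ => t * (ENNReal.ofReal ((r + s) ^ d) * volume (Metric.ball (0 : EE d) 1)))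
      (nhdsWithin 0 (Set.Ioi 0)) (nhds (t * (ENNReal.ofReal ((r + 0) ^ d) * volume (Metric.ball (0 : EE d) 1)))) := by
    refine Tendsto.mono_left ?_ nhdsWithin_le_nhds
    refine ENNReal.Tendsto.const_mul (ENNReal.Tendsto.mul_const ?_ (Or.inr om_fin)) (Or.inr ht)
    exact (ENNReal.continuous_ofReal.comp (by fun_prop)).tendsto 0
  rw [add_zero, ← vol_cb x hr.le] at cont
  obtain ⟨s, hs1, hs2⟩ := ((cont.eventually (gt_mem_nhds h)).and self_mem_nhdsWithin).exists
  have hs : 0 < s := hs2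
  refine ⟨s, hs, fun y hy => ⟨r + s, by linarith, ?_⟩⟩
  rw [vol_cb y (by linarith)]
  refine hs1.trans_le (measure_mono ?_)
  intro z hz
  rw [Metric.mem_closedBall] at *
  rw [Metric.mem_ball] at hy
  have := dist_triangle z x y
  rw [dist_comm x y] at this
  linarith

lemma Om_radius {m : Measure (EE d)} {t : ℝ≥0∞}
    (ht : m Set.univ ≤ t * volume (Metric.ball (0 : EE d) 1)) {x : EE d} {r : ℝ} (hr : 0 < r)
    (h : t * volume (Metric.closedBall x r) < m (Metric.closedBall x r)) : r ≤ 1 := by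
  by_contra hr1
  push Not at hr1
  refine absurd (h.trans_le ((measure_mono (Set.subset_univ _)).trans ht)) (not_lt.2 ?_)
  rw [vol_cb x hr.le]
  gcongr
  refine le_mul_of_one_le_left (zero_le) ?_
  rw [ENNReal.one_le_ofReal]
  exact one_le_pow₀ hr1.le

lemma Om_vol {m : Measure (EE d)} [IsFiniteMeasure m] {t : ℝ≥0∞}
    (ht : m Set.univ ≤ t * volume (Metric.ball (0 : EE d) 1)) :
    t * volume (Om m t) ≤ 4 ^ d * m Set.univ := by
  have hc : ∀ x : EE d, ∃ r : ℝ, x ∈ Om m t →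
      0 < r ∧ t * volume (Metric.closedBall x r) < m (Metric.closedBall x r) := by
    intro x
    by_cases hx : x ∈ Om m t
    · obtain ⟨r, hr, h⟩ := hx
      exact ⟨r, fun _ => ⟨hr, h⟩⟩
    · exact ⟨0, fun h => absurd h hx⟩
  choose r hr using hc
  obtain ⟨u, hu, hdis, hcov⟩ := Vitali.exists_disjoint_subfamily_covering_enlargement_closedBall
    (Om m t) id r 1 (fun a ha => Om_radius ht (hr a ha).1 (hr a ha).2) 4 (by norm_num)
  have hcount : u.Countable := by
    refine hdis.countable_of_nonempty_interior fun a ha => ?_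
    refine ⟨a, ?_⟩
    exact Metric.ball_subset_interior_closedBall (Metric.mem_ball_self (hr a (hu ha)).1)
  have hsub : Om m t ⊆ ⋃ b ∈ u, Metric.closedBall b (4 * r b) := by
    intro a ha
    obtain ⟨b, hb, hab⟩ := hcov a ha
    exact Set.mem_biUnion hb (hab (Metric.mem_closedBall_self (hr a ha).1.le))
  calc t * volume (Om m t) ≤ t * ∑' b : u, volume (Metric.closedBall (b : EE d) (4 * r b)) := by
        gcongr
        exact (measure_mono hsub).trans (measure_biUnion_le _ hcount _)
    _ = ∑' b : u, 4 ^ d * (t * volume (Metric.closedBall (b : EE d) (r b))) := by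
        rw [← ENNReal.tsum_mul_left]
        refine tsum_congr fun b => ?_
        have := (hr b (hu b.2)).1
        rw [vol_cb _ (by positivity), vol_cb _ this.le, mul_pow, ENNReal.ofReal_mul (by positivity),
          ENNReal.ofReal_pow (by norm_num)]
        simp only [ENNReal.ofReal_ofNat]
        ring
    _ ≤ ∑' b : u, 4 ^ d * m (Metric.closedBall (b : EE d) (r b)) := by
        refine ENNReal.tsum_le_tsum fun b => ?_
        gcongr
        exact (hr b (hu b.2)).2.le
    _ = 4 ^ d * m (⋃ b ∈ u, Metric.closedBall (b : EE d) (r b)) := by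
        have hdis' : u.PairwiseDisjoint fun a => Metric.closedBall a (r a) := hdis
        rw [ENNReal.tsum_mul_left, measure_biUnion hcount hdis' fun b _ => measurableSet_closedBall]
    _ ≤ _ := by gcongr; exact Set.subset_univ _

lemma Om_bdd {m : Measure (EE d)} {t : ℝ≥0∞}
    (ht : m Set.univ ≤ t * volume (Metric.ball (0 : EE d) 1)) {N : ℝ}
    (hN : m (Metric.closedBall 0 N)ᶜ = 0) : Om m t ⊆ Metric.closedBall 0 (N + 1) := by
  rintro x ⟨r, hr, h⟩
  have hr1 := Om_radius ht hr h
  by_contra hx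
  simp only [Metric.mem_closedBall, dist_zero_right, not_le] at hx
  have : Metric.closedBall x r ⊆ (Metric.closedBall 0 N)ᶜ := by
    intro y hy
    simp only [Set.mem_compl_iff, Metric.mem_closedBall, dist_zero_right, not_le] at *
    have h1 := norm_sub_norm_le x y
    rw [← dist_eq_norm, dist_comm] at h1
    linarith
  rw [measure_mono_null this hN] at h
  simp at h

lemma Om_growth {m : Measure (EE d)} {t : ℝ≥0∞} (ht : t ≠ ⊤) (hne : (Om m t)ᶜ.Nonempty)
    (y : EE d) {ρ : ℝ} (hρ : 0 < ρ) (hD : Metric.infDist y (Om m t)ᶜ / 4 ≤ ρ) :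
    m (Metric.closedBall y (2 * ρ))
      ≤ t * 6 ^ d * volume (Metric.ball (0 : EE d) 1) * ENNReal.ofReal (ρ ^ d) := by
  obtain ⟨z, hz, hyz⟩ := (Om_open m ht).isClosed_compl.exists_infDist_eq_dist hne y
  have h1 : Metric.closedBall y (2 * ρ) ⊆ Metric.closedBall z (6 * ρ) := by
    apply Metric.closedBall_subset_closedBall'
    linarith
  have h2 : m (Metric.closedBall z (6 * ρ)) ≤ t * volume (Metric.closedBall z (6 * ρ)) := by
    by_contra h
    exact hz ⟨6 * ρ, by positivity, not_le.1 h⟩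
  refine (measure_mono h1).trans (h2.trans (le_of_eq ?_))
  rw [vol_cb _ (by positivity), mul_pow, ENNReal.ofReal_mul (by positivity),
          ENNReal.ofReal_pow (by norm_num)]
  simp only [ENNReal.ofReal_ofNat]
  ring

lemma fub {m : Measure (EE d)} [IsFiniteMeasure m] {ρ : EE d → ℝ} (hρc : Continuous ρ)
    (hρ : ∀ x, 0 < ρ x) (hL : ∀ x y, |ρ x - ρ y| ≤ dist x y / 4) {T : ℝ≥0∞}
    (hT : ∀ y, m (Metric.closedBall y (2 * ρ y)) ≤ T * ENNReal.ofReal (ρ y ^ d))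
    {G : EE d → ℝ≥0∞} (hG : Measurable G) :
    ∫⁻ x, (ENNReal.ofReal ((ρ x ^ d)⁻¹) * ∫⁻ y in Metric.closedBall x (ρ x), G y) ∂m
      ≤ 2 ^ d * T * ∫⁻ y, G y := by
  let F : EE d → EE d → ℝ≥0∞ := fun x y =>
    {p : EE d × EE d | dist p.2 p.1 ≤ ρ p.1}.indicator (fun p => ENNReal.ofReal ((ρ p.1 ^ d)⁻¹) * G p.2) (x, y)
  have hFm : Measurable (Function.uncurry F) := by
    refine Measurable.indicator (Measurable.mul ?_ (hG.comp measurable_snd)) ?_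
    · have := hρc.measurable
      fun_prop
    · exact (isClosed_le (by fun_prop) (by fun_prop)).measurableSet
  have e1 : ∀ x, ENNReal.ofReal ((ρ x ^ d)⁻¹) * ∫⁻ y in Metric.closedBall x (ρ x), G y = ∫⁻ y, F x y := by
    intro x
    rw [← lintegral_indicator measurableSet_closedBall, ← lintegral_const_mul _
      (hG.indicator measurableSet_closedBall)]
    congr 1; ext y
    by_cases h : dist y x ≤ ρ x <;> simp [F, Set.indicator, h]
  simp_rw [e1]
  rw [lintegral_lintegral_swap hFm.aemeasurable, ← lintegral_const_mul _ hG]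
  refine lintegral_mono fun y => ?_
  have hy := hρ y
  calc ∫⁻ x, F x y ∂m ≤ ∫⁻ x, (Metric.closedBall y (2 * ρ y)).indicator
          (fun _ => 2 ^ d * ENNReal.ofReal ((ρ y ^ d)⁻¹) * G y) x ∂m := by
        refine lintegral_mono fun x => ?_
        by_cases h : dist y x ≤ ρ x
        · have h1 := abs_le.1 (hL x y)
          have hx := hρ x
          rw [dist_comm] at h1
          have hm : x ∈ Metric.closedBall y (2 * ρ y) := by
            rw [Metric.mem_closedBall, dist_comm]; linarith
          have hle : (ρ x ^ d)⁻¹ ≤ 2 ^ d * (ρ y ^ d)⁻¹ := by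
            rw [← inv_pow, ← inv_pow, ← mul_pow]
            apply pow_le_pow_left₀ (by positivity)
            rw [← div_eq_mul_inv, inv_eq_one_div, div_le_div_iff₀ hx hy]
            linarith
          rw [Set.indicator_of_mem hm]
          simp only [F, Set.indicator, Set.mem_setOf_eq, h, if_true]
          gcongr
          refine (ENNReal.ofReal_le_ofReal hle).trans (le_of_eq ?_)
          rw [ENNReal.ofReal_mul (by positivity), ENNReal.ofReal_pow (by norm_num)]
          simp
        · simp [F, Set.indicator, h]
    _ = 2 ^ d * ENNReal.ofReal ((ρ y ^ d)⁻¹) * G y * m (Metric.closedBall y (2 * ρ y)) := by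
        rw [lintegral_indicator measurableSet_closedBall]; simp
    _ ≤ 2 ^ d * ENNReal.ofReal ((ρ y ^ d)⁻¹) * G y * (T * ENNReal.ofReal (ρ y ^ d)) := by
        gcongr; exact hT y
    _ = 2 ^ d * T * G y * (ENNReal.ofReal ((ρ y ^ d)⁻¹) * ENNReal.ofReal (ρ y ^ d)) := by ring
    _ = _ := by
        rw [← ENNReal.ofReal_mul (by positivity), inv_mul_cancel₀ (by positivity)]; simp

end Clos

namespace Clos
variable {d : ℕ}

lemma ofReal_setInt {g : EE d → ℝ} (hg : Continuous g) (hgn : ∀ x, 0 ≤ g x) (x : EE d) (r : ℝ) :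
    ENNReal.ofReal (∫ y in Metric.closedBall x r, g y)
      = ∫⁻ y in Metric.closedBall x r, ENNReal.ofReal (g y) :=
  ofReal_integral_eq_lintegral_ofReal
    (hg.continuousOn.integrableOn_compact (isCompact_closedBall x r)) (ae_of_all _ hgn)

lemma grad_bound (hd : 1 ≤ d) {m : Measure (EE d)} [IsFiniteMeasure m] {t : ℝ≥0∞} (ht : t ≠ ⊤)
    (hb : Bornology.IsBounded (Om m t))
    (hvol : volume (Om m t) < volume (Metric.ball (0 : EE d) 1))
    {δ : ℝ} (hδ : 0 < δ) (hδ1 : δ ≤ 1) {M : ℝ} (hM : ∀ (i : Fin d) (z : EE d), |pd i (eta 1) z| ≤ M) (i j : Fin d) :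
    ∫⁻ x, ENNReal.ofReal ((pd i (vv δ (Om m t) j) x) ^ 2) ∂m ≤
      ENNReal.ofReal (2 * ∫ z : EE d, (eta 1 z) ^ 2) * (2 ^ d * (t * 6 ^ d * volume (Metric.ball (0 : EE d) 1)) *
        ENNReal.ofReal (2 * (cc d) ^ 2 * volume.real (Om m t)))
      + ENNReal.ofReal (2 * (2 * (M * volume.real (Om m t)) * ∫ z : EE d, kap z) ^ 2) * m Set.univ := by
  have hO := Om_open m ht
  set Ω := Om m t with hΩ
  have hne : Ωᶜ.Nonempty := by
    rw [Set.nonempty_compl]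
    intro h
    rw [h] at hvol
    exact absurd hvol (not_lt.2 (measure_mono (Set.subset_univ _)))
  let D : EE d → ℝ := fun x => Metric.infDist x Ωᶜ
  have hDball : ∀ x, Metric.ball x (D x) ⊆ Ω := by
    intro x y hy
    by_contra h
    have := Metric.infDist_le_dist_of_mem (x := x) (show y ∈ Ωᶜ from h)
    rw [Metric.mem_ball, dist_comm] at hy
    exact absurd hy (not_lt.2 this)
  have hD1 : ∀ x, D x ≤ 1 := by
    intro x
    by_contra h
    push Not at h
    refine absurd hvol (not_lt.2 ?_)
    rw [← Measure.addHaar_ball_center volume x 1]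
    exact measure_mono ((Metric.ball_subset_ball h.le).trans (hDball x))
  have hD0 : ∀ x, 0 ≤ D x := fun x => Metric.infDist_nonneg
  have hDL : ∀ x y, |D x - D y| ≤ dist x y := by
    intro x y
    have := (Metric.lipschitz_infDist_pt Ωᶜ).dist_le_mul x y
    simpa [Real.dist_eq] using this
  let ρ : EE d → ℝ := fun x => max δ (D x / 4)
  have hρc : Continuous ρ := continuous_const.max ((Metric.continuous_infDist_pt _).div_const 4)
  have hρ : ∀ x, 0 < ρ x := fun x => lt_max_of_lt_left hδ
  have hL : ∀ x y, |ρ x - ρ y| ≤ dist x y / 4 := by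
    intro x y
    refine (abs_max_sub_max_le_max _ _ _ _).trans ?_
    rw [max_le_iff]
    constructor
    · simp; positivity
    · rw [← sub_div, abs_div]
      have := hDL x y
      norm_num
      linarith
  have hT : ∀ y, m (Metric.closedBall y (2 * ρ y))
      ≤ (t * 6 ^ d * volume (Metric.ball (0 : EE d) 1)) * ENNReal.ofReal (ρ y ^ d) :=
    fun y => Om_growth ht hne y (hρ y) (le_max_right _ _)
  have hphi := phi_contDiff hO (Of hO hb) hδ
  have hphic := phi_hcs hO hb hδ
  have hpc : ∀ i j, Continuous (pd i (phi δ Ω j)) := fun i j => (pd_contDiff (hphi j) i).continuous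
  let G : EE d → ℝ≥0∞ := fun y => ENNReal.ofReal ((pd i (phi δ Ω j) y) ^ 2)
  have hG : Measurable G := (((hpc i j).pow 2).measurable).ennreal_ofReal
  have hF := fub hρc hρ hL hT hG
  have hint : ∀ i j, Integrable (fun y => (pd i (phi δ Ω j) y) ^ 2) := by
    intro i j
    refine ((hpc i j).pow 2).integrable_of_hasCompactSupport ?_
    have := pd_hcs (hphic j) i
    exact this.mono (fun y hy => by contrapose! hy; simp [Function.notMem_support.1 hy])
  have hGi : ∫⁻ y, G y ≤ ENNReal.ofReal (2 * (cc d) ^ 2 * volume.real Ω) := by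
    rw [← ofReal_integral_eq_lintegral_ofReal (hint i j) (ae_of_all _ fun _ => sq_nonneg _)]
    apply ENNReal.ofReal_le_ofReal
    refine le_trans ?_ (phi_div_sq hO (Of hO hb) hδ)
    rw [← l2id hphi hphic (phi_symm hO (Of hO hb) hδ)]
    have n : ∀ i j, 0 ≤ ∫ y, (pd i (phi δ Ω j) y) ^ 2 := fun i j => integral_nonneg fun _ => sq_nonneg _
    refine le_trans ?_ (Finset.single_le_sum (f := fun i => ∑ j, ∫ y, (pd i (phi δ Ω j) y) ^ 2)
      (fun i _ => Finset.sum_nonneg fun j _ => n i j) (Finset.mem_univ i))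
    exact Finset.single_le_sum (f := fun j => ∫ y, (pd i (phi δ Ω j) y) ^ 2)
      (fun j _ => n i j) (Finset.mem_univ j)
  have hA : 0 ≤ ∫ z : EE d, (eta 1 z) ^ 2 := integral_nonneg fun _ => sq_nonneg _
  have hpt : ∀ x, ENNReal.ofReal ((pd i (vv δ Ω j) x) ^ 2) ≤
      ENNReal.ofReal (2 * ∫ z : EE d, (eta 1 z) ^ 2) *
        (ENNReal.ofReal ((ρ x ^ d)⁻¹) * ∫⁻ y in Metric.closedBall x (ρ x), G y) +
      ENNReal.ofReal (2 * (2 * (M * volume.real Ω) * ∫ z : EE d, kap z) ^ 2) := by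
    intro x
    have hx : ρ x = δ ∨ Metric.ball x (3 * ρ x) ⊆ Ω := by
      rcases le_total (D x / 4) δ with h | h
      · left; exact max_eq_left h
      · right
        have e : ρ x = D x / 4 := max_eq_right h
        refine (Metric.ball_subset_ball ?_).trans (hDball x)
        rw [e]; have := hD0 x; linarith
    have hp := ptA (ρ := ρ x) hO hb hδ hδ1 hd hM (le_max_left _ _ : δ ≤ ρ x)
      (max_le hδ1 (by have := hD1 x; linarith)) hx i j
    refine (ENNReal.ofReal_le_ofReal hp).trans ?_
    have e2 : ∫⁻ y in Metric.closedBall x (ρ x), G y =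
        ENNReal.ofReal (∫ y in Metric.closedBall x (ρ x), (pd i (phi δ Ω j) y) ^ 2) :=
      (ofReal_setInt ((hpc i j).pow 2) (fun _ => sq_nonneg _) x (ρ x)).symm
    rw [e2]
    have h0 : 0 ≤ (ρ x ^ d)⁻¹ := by have := hρ x; positivity
    have h1 : 0 ≤ ∫ y in Metric.closedBall x (ρ x), (pd i (phi δ Ω j) y) ^ 2 :=
      integral_nonneg fun _ => sq_nonneg _
    rw [← ENNReal.ofReal_mul h0, ← ENNReal.ofReal_mul (by positivity),
      ← ENNReal.ofReal_add (by positivity) (by positivity)]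
    apply le_of_eq; congr 1; ring
  calc _ ≤ ∫⁻ x, (ENNReal.ofReal (2 * ∫ z : EE d, (eta 1 z) ^ 2) *
        (ENNReal.ofReal ((ρ x ^ d)⁻¹) * ∫⁻ y in Metric.closedBall x (ρ x), G y) +
      ENNReal.ofReal (2 * (2 * (M * volume.real Ω) * ∫ z : EE d, kap z) ^ 2)) ∂m := lintegral_mono hpt
    _ = ENNReal.ofReal (2 * ∫ z : EE d, (eta 1 z) ^ 2) * ∫⁻ x,
        (ENNReal.ofReal ((ρ x ^ d)⁻¹) * ∫⁻ y in Metric.closedBall x (ρ x), G y) ∂m +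
      ENNReal.ofReal (2 * (2 * (M * volume.real Ω) * ∫ z : EE d, kap z) ^ 2) * m Set.univ := by
        rw [lintegral_add_right _ measurable_const, lintegral_const,
          lintegral_const_mul' _ _ ENNReal.ofReal_ne_top]
    _ ≤ _ := by
        gcongr
        exact hF.trans (by gcongr)

lemma ae_mem_Om {m : Measure (EE d)} [IsFiniteMeasure m] {S : Set (EE d)} (hS : MeasurableSet S)
    (hS0 : volume S = 0) : ∀ᵐ x ∂m, x ∈ S → ∀ t : ℝ≥0∞, t ≠ 0 → t ≠ ⊤ → x ∈ Om m t := by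
  have h0 : ∀ᵐ x ∂m, x ∈ S → (volume : Measure (EE d)).rnDeriv m x = 0 := by
    have : ∫⁻ x in S, (volume : Measure (EE d)).rnDeriv m x ∂m = 0 :=
      le_antisymm ((Measure.setLIntegral_rnDeriv_le S).trans hS0.le) zero_le
    rw [lintegral_eq_zero_iff (Measure.measurable_rnDeriv _ _)] at this
    exact (ae_restrict_iff' hS).1 this
  filter_upwards [h0, Besicovitch.ae_tendsto_rnDeriv (volume : Measure (EE d)) m] with x hx hB hxS t ht0 ht
  rw [hx hxS] at hB
  have : (0 : ℝ≥0∞) < t⁻¹ := ENNReal.inv_pos.2 ht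
  obtain ⟨r, h1, h2⟩ := ((hB.eventually (gt_mem_nhds this)).and self_mem_nhdsWithin).exists
  refine ⟨r, h2, ?_⟩
  have hm0 : m (Metric.closedBall x r) ≠ 0 := by
    intro h
    rw [h, ENNReal.div_zero] at h1
    · simp at h1
    · exact (Metric.measure_closedBall_pos _ _ h2).ne'
  rw [ENNReal.div_lt_iff (Or.inl hm0) (Or.inl (measure_ne_top _ _)), mul_comm, ← div_eq_mul_inv,
    ENNReal.lt_div_iff_mul_lt (Or.inl ht0) (Or.inl ht)] at h1
  rwa [mul_comm]

lemma exists_t (m : Measure (EE d)) [IsFiniteMeasure m] {η : ℝ≥0∞} (hη : η ≠ 0) :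
    ∃ t : ℝ≥0∞, t ≠ 0 ∧ t ≠ ⊤ ∧ m Set.univ ≤ t * volume (Metric.ball (0 : EE d) 1) ∧
      volume (Om m t) ≤ η := by
  by_cases hηt : η = ⊤
  · refine ⟨m Set.univ / volume (Metric.ball (0 : EE d) 1) + 1, by simp, ?_, ?_, by simp [hηt]⟩
    · exact ENNReal.add_ne_top.2 ⟨ENNReal.div_ne_top (measure_ne_top _ _) om_pos.ne', by simp⟩
    · calc _ = m Set.univ / volume (Metric.ball (0 : EE d) 1) * volume (Metric.ball (0 : EE d) 1) :=
            (ENNReal.div_mul_cancel om_pos.ne' om_fin).symm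
        _ ≤ _ := by gcongr; exact le_self_add
  have h1 : m Set.univ ≤ (m Set.univ / volume (Metric.ball (0 : EE d) 1) + (4 ^ d * m Set.univ / η + 1)) * volume (Metric.ball (0 : EE d) 1) := by
    calc _ = m Set.univ / volume (Metric.ball (0 : EE d) 1) * volume (Metric.ball (0 : EE d) 1) :=
            (ENNReal.div_mul_cancel om_pos.ne' om_fin).symm
        _ ≤ _ := by gcongr; exact le_self_add
  have h0 : m Set.univ / volume (Metric.ball (0 : EE d) 1) + (4 ^ d * m Set.univ / η + 1) ≠ 0 := by simp
  have ht : m Set.univ / volume (Metric.ball (0 : EE d) 1) + (4 ^ d * m Set.univ / η + 1) ≠ ⊤ :=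
    ENNReal.add_ne_top.2 ⟨ENNReal.div_ne_top (measure_ne_top _ _) om_pos.ne',
      ENNReal.add_ne_top.2 ⟨ENNReal.div_ne_top (ENNReal.mul_ne_top (by simp) (measure_ne_top _ _)) hη, by simp⟩⟩
  refine ⟨_, h0, ht, h1, ?_⟩
  have := Om_vol h1
  refine (ENNReal.mul_le_mul_iff_right h0 ht).1 (this.trans ?_)
  calc 4 ^ d * m Set.univ = 4 ^ d * m Set.univ / η * η := (ENNReal.div_mul_cancel hη hηt).symm
    _ ≤ _ := by
      gcongr
      exact le_self_add.trans le_add_self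

lemma exists_delta (m : Measure (EE d)) [IsFiniteMeasure m] {Ω : Set (EE d)} (hO : IsOpen Ω)
    {ε : ℝ≥0∞} (hε : 0 < ε) :
    ∃ δ : ℝ, 0 < δ ∧ δ ≤ 1 ∧ m {x | x ∈ Ω ∧ ¬ Metric.ball x (2 * δ) ⊆ Ω} ≤ ε := by
  have h := tendsto_measure_thickening_of_isClosed (μ := m.restrict Ω) (s := Ωᶜ)
    ⟨1, one_pos, measure_ne_top _ _⟩ hO.isClosed_compl
  have h0 : m.restrict Ω Ωᶜ = 0 := by
    rw [Measure.restrict_apply hO.measurableSet.compl]; simp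
  rw [h0] at h
  have hmem : ∀ᶠ r : ℝ in nhdsWithin 0 (Set.Ioi 0), r < 2 := by
    exact nhdsWithin_le_nhds (gt_mem_nhds (by norm_num))
  obtain ⟨r, ⟨h1, h3⟩, h2⟩ := (((h.eventually (gt_mem_nhds hε)).and hmem).and self_mem_nhdsWithin).exists
  have hr : 0 < r := h2
  refine ⟨r / 2, by linarith, by linarith, ?_⟩
  refine le_trans ?_ h1.le
  rw [Measure.restrict_apply Metric.isOpen_thickening.measurableSet]
  refine measure_mono ?_
  rintro x ⟨hx, hn⟩
  refine ⟨?_, hx⟩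
  rw [Set.not_subset] at hn
  obtain ⟨y, hy, hyn⟩ := hn
  rw [Metric.mem_thickening_iff]
  refine ⟨y, hyn, ?_⟩
  rw [Metric.mem_ball, dist_comm] at hy
  linarith

end Clos

namespace Clos
variable {d : ℕ}

lemma key (hd : 1 ≤ d) (m : Measure (EE d)) [IsFiniteMeasure m] {N : ℝ}
    (hN : m (Metric.closedBall 0 N)ᶜ = 0) {S : Set (EE d)} (hS : MeasurableSet S)
    (hS0 : volume S = 0) :
    ∃ C : ℝ≥0∞, C ≠ ⊤ ∧ ∀ ε : ℝ, 0 < ε → ∃ v : Fin d → EE d → ℝ,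
      (∀ j, ContDiff ℝ (⊤ : ℕ∞) (v j)) ∧ (∀ j x, |v j x| ≤ ε) ∧
      (∀ i j, ∫⁻ x, ENNReal.ofReal ((pd i (v j) x) ^ 2) ∂m ≤ C) ∧
      (∀ x, -ε ≤ ∑ j, pd j (v j) x) ∧
      m {x | x ∈ S ∧ ∑ j, pd j (v j) x < cc d * cc d - ε} ≤ ENNReal.ofReal ε := by
  obtain ⟨M0, hM0⟩ := (eta_hcs (d := d) one_pos).exists_bound_of_continuous
    (eta_contDiff one_pos).continuous
  have hM0n : 0 ≤ M0 := (norm_nonneg _).trans (hM0 0)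
  have hMi : ∀ i : Fin d, ∃ M, ∀ z, ‖pd i (eta 1) z‖ ≤ M := fun i =>
    (pd_hcs (eta_hcs (d := d) one_pos) i).exists_bound_of_continuous
      (pd_contDiff (eta_contDiff one_pos) i).continuous
  choose Mi hMi using hMi
  have hMin : ∀ i, 0 ≤ Mi i := fun i => (norm_nonneg _).trans (hMi i 0)
  set M := ∑ i, Mi i with hMdef
  have hMn : 0 ≤ M := Finset.sum_nonneg fun i _ => hMin i
  have hM : ∀ (i : Fin d) (z : EE d), |pd i (eta 1) z| ≤ M := fun i z =>
    (hMi i z).trans (Finset.single_le_sum (fun i _ => hMin i) (Finset.mem_univ i))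
  set ω := volume (Metric.ball (0 : EE d) 1) with hω
  set A := ∫ z : EE d, (eta 1 z) ^ 2 with hA
  set K := ∫ z : EE d, kap z with hK
  have hKn : 0 ≤ K := integral_nonneg kap_nonneg
  have hcc : 0 ≤ cc d := cc_nonneg
  refine ⟨ENNReal.ofReal (2 * A) * (2 ^ d * 6 ^ d * ω * ENNReal.ofReal (2 * (cc d) ^ 2) *
      (4 ^ d * m Set.univ)) + ENNReal.ofReal (2 * (2 * (M * ω.toReal) * K) ^ 2) * m Set.univ, ?_, ?_⟩
  · refine ENNReal.add_ne_top.2 ⟨?_, ?_⟩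
    · refine ENNReal.mul_ne_top ENNReal.ofReal_ne_top (ENNReal.mul_ne_top (ENNReal.mul_ne_top
        (ENNReal.mul_ne_top (ENNReal.mul_ne_top ?_ ?_) om_fin) ENNReal.ofReal_ne_top)
        (ENNReal.mul_ne_top ?_ (measure_ne_top _ _)))
      all_goals simp
    · exact ENNReal.mul_ne_top ENNReal.ofReal_ne_top (measure_ne_top _ _)
  intro ε hε
  have hkfin : ∫⁻ z : EE d, ENNReal.ofReal (kap z) ≠ ⊤ :=
    (ofReal_integral_eq_lintegral_ofReal (kap_integrable hd) (ae_of_all _ kap_nonneg)) ▸ ENNReal.ofReal_ne_top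
  set ε1 := ε / (2 * cc d + 1) with hε1
  have hε1p : 0 < ε1 := by positivity
  obtain ⟨η1, hη1, hη1'⟩ := exists_pos_setLIntegral_lt_of_measure_lt hkfin
    (ENNReal.ofReal_pos.2 hε1p).ne'
  have hε2p : 0 < ε / (M0 * cc d + 1) := by positivity
  have hpos : 0 < min η1 (min ω (ENNReal.ofReal (ε / (M0 * cc d + 1)))) :=
    lt_min hη1 (lt_min om_pos (ENNReal.ofReal_pos.2 hε2p))
  obtain ⟨η, hη0, hη⟩ := exists_between hpos
  obtain ⟨t, ht0, ht, htm, htv⟩ := exists_t m hη0.ne'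
  have hvlt := htv.trans_lt hη
  rw [lt_min_iff, lt_min_iff] at hvlt
  obtain ⟨v1, v2, v3⟩ := hvlt
  have hO := Om_open m ht
  have hb : Bornology.IsBounded (Om m t) := Metric.isBounded_closedBall.subset (Om_bdd htm hN)
  have hv2 : volume.real (Om m t) ≤ ω.toReal := ENNReal.toReal_mono om_fin v2.le
  have hv3 : volume.real (Om m t) ≤ ε / (M0 * cc d + 1) := ENNReal.toReal_le_of_le_ofReal hε2p.le v3.le
  have hOmV := Om_vol htm
  obtain ⟨δ, hδ, hδ1, hδm⟩ := exists_delta m hO (ENNReal.ofReal_pos.2 hε)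
  have hsmall : M0 * volume.real (Om m t) * cc d ≤ ε := by
    calc _ = (M0 * cc d) * volume.real (Om m t) := by ring
      _ ≤ (M0 * cc d + 1) * (ε / (M0 * cc d + 1)) := by gcongr; linarith
      _ = ε := by field_simp
  have hdiv := fun x => div_vv_lower hO hb hδ (fun z => hM0 z) x
  refine ⟨vv δ (Om m t), fun j => vv_contDiff hO hb hδ j, ?_, ?_, ?_, ?_⟩
  · intro j x
    have hA : ∀ A : Set (EE d), MeasurableSet A → volume A = volume (Om m t) → ∫ z in A, kap z ≤ ε1 := by
      intro A hA hAv
      have := hη1' A (hAv ▸ v1)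
      rw [← ofReal_integral_eq_lintegral_ofReal (kap_integrable hd).integrableOn (ae_of_all _ kap_nonneg)] at this
      exact ((ENNReal.ofReal_lt_ofReal_iff hε1p).1 this).le
    refine (vv_bound hO hb hδ hδ1 hd hA j x).trans ?_
    calc 2 * ε1 * cc d ≤ (2 * cc d + 1) * ε1 := by nlinarith
      _ = ε := by rw [hε1]; field_simp
  · intro i j
    refine (grad_bound hd ht hb v2 hδ hδ1 hM i j).trans ?_
    have e : ENNReal.ofReal (2 * (cc d) ^ 2 * volume.real (Om m t)) =
        ENNReal.ofReal (2 * (cc d) ^ 2) * volume (Om m t) := by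
      rw [ENNReal.ofReal_mul (by positivity), Measure.real, ENNReal.ofReal_toReal (Of hO hb)]
    rw [e]
    refine add_le_add ?_ ?_
    · calc _ = ENNReal.ofReal (2 * A) * (2 ^ d * 6 ^ d * ω * ENNReal.ofReal (2 * (cc d) ^ 2) *
      (t * volume (Om m t))) := by ring
        _ ≤ _ := by gcongr
    · gcongr
  · intro x
    linarith [(hdiv x).1]
  · refine le_trans (measure_mono_ae ?_) hδm
    filter_upwards [ae_mem_Om hS hS0] with x hx hx2
    obtain ⟨hxS, hlt⟩ := hx2
    refine ⟨hx hxS t ht0 ht, fun hsub => ?_⟩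
    linarith [(hdiv x).2 hsub]

end Clos

namespace Clos
variable {d : ℕ}

lemma lint_sq {F : Type*} [NormedAddCommGroup F] {μ : Measure (EE d)} (h : EE d → F) :
    ∫⁻ x, (‖h x‖₊ : ℝ≥0∞) ^ 2 ∂μ = (eLpNorm h 2 μ) ^ 2 := by
  have := eLpNorm_nnreal_pow_eq_lintegral (f := h) (μ := μ) (p := 2) (by norm_num)
  simp only [NNReal.coe_ofNat, ENNReal.rpow_ofNat, ENNReal.coe_ofNat] at this
  rw [this]; rfl

lemma grad_add {f g : EE d → ℝ} (hf : ContDiff ℝ (⊤ : ℕ∞) f) (hg : ContDiff ℝ (⊤ : ℕ∞) g) :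
    gradient (f + g) = gradient f + gradient g := by
  ext1 x
  have hf' := (hf.differentiable (by simp)) x
  have hg' := (hg.differentiable (by simp)) x
  simp [gradient, fderiv_add hf' hg']

lemma grad_smul {f : EE d → ℝ} (c : ℝ) (hf : ContDiff ℝ (⊤ : ℕ∞) f) :
    gradient (c • f) = c • gradient f := by
  ext1 x
  have hf' := (hf.differentiable (by simp)) x
  simp [gradient, fderiv_const_smul hf']

lemma grad_zero : gradient (0 : EE d → ℝ) = 0 := by
  ext1 x
  simp [gradient]

lemma grad_cont {f : EE d → ℝ} (hf : ContDiff ℝ (⊤ : ℕ∞) f) : Continuous (gradient f) := by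
  unfold gradient
  exact (LinearIsometryEquiv.continuous _).comp (hf.continuous_fderiv (by simp))

lemma grad_hcs {f : EE d → ℝ} (hf : HasCompactSupport f) : HasCompactSupport (gradient f) := by
  refine (hf.fderiv (𝕜 := ℝ)).mono fun x hx => ?_
  contrapose! hx
  simp [gradient, Function.notMem_support.1 hx]

lemma f_mem {μ : Measure (EE d)} [IsFiniteMeasureOnCompacts μ] {f : EE d → ℝ}
    (hf : ContDiff ℝ (⊤ : ℕ∞) f) (hc : HasCompactSupport f) : MemLp f 2 μ :=
  hf.continuous.memLp_of_hasCompactSupport hc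

lemma g_mem {μ : Measure (EE d)} [IsFiniteMeasureOnCompacts μ] {f : EE d → ℝ}
    (hf : ContDiff ℝ (⊤ : ℕ∞) f) (hc : HasCompactSupport f) : MemLp (gradient f) 2 μ :=
  (grad_cont hf).memLp_of_hasCompactSupport (grad_hcs hc)

abbrev HH (μ : Measure (EE d)) := WithLp 2 (Lp ℝ 2 μ × Lp (EE d) 2 μ)

def Gam (μ : Measure (EE d)) : Submodule ℝ (HH μ) where
  carrier := {p | ∃ f : EE d → ℝ, ContDiff ℝ (⊤ : ℕ∞) f ∧ HasCompactSupport f ∧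
    (p.fst : EE d → ℝ) =ᵐ[μ] f ∧ (p.snd : EE d → EE d) =ᵐ[μ] gradient f}
  add_mem' := by
    rintro p q ⟨f, hf, hfc, h1, h2⟩ ⟨g, hg, hgc, h3, h4⟩
    refine ⟨f + g, hf.add hg, hfc.add hgc, ?_, ?_⟩
    · exact (Lp.coeFn_add p.fst q.fst).trans (h1.add h3)
    · rw [grad_add hf hg]
      exact (Lp.coeFn_add p.snd q.snd).trans (h2.add h4)
  zero_mem' := by
    refine ⟨0, contDiff_const, HasCompactSupport.zero, ?_, ?_⟩
    · exact Lp.coeFn_zero _ _ _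
    · rw [grad_zero]; exact Lp.coeFn_zero _ _ _
  smul_mem' := by
    rintro c p ⟨f, hf, hfc, h1, h2⟩
    refine ⟨c • f, hf.const_smul c, hfc.smul_left (f := fun _ => c), ?_, ?_⟩
    · exact (Lp.coeFn_smul c p.fst).trans (h1.const_smul c)
    · rw [grad_smul c hf]
      exact (Lp.coeFn_smul c p.snd).trans (h2.const_smul c)

lemma closed_zero {μ : Measure (EE d)} (hcl : SobolevClosable d μ) {v : Lp (EE d) 2 μ}
    (hv : WithLp.toLp 2 ((0 : Lp ℝ 2 μ), v) ∈ closure (Gam μ : Set (HH μ))) : v = 0 := by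
  obtain ⟨p, hp, hlim⟩ := mem_closure_iff_seq_limit.1 hv
  choose f hf hfc h1 h2 using hp
  have l1 : Tendsto (fun n => (p n).fst) atTop (nhds 0) :=
    ((WithLp.continuous_fst 2 _ _).tendsto _).comp hlim
  have l2 : Tendsto (fun n => (p n).snd) atTop (nhds v) :=
    ((WithLp.continuous_snd 2 _ _).tendsto _).comp hlim
  have e1 : ∀ n, eLpNorm (f n) 2 μ = ‖(p n).fst‖ₑ := fun n => by
    rw [Lp.enorm_def]; exact (eLpNorm_congr_ae (h1 n)).symm
  have e2 : ∀ n, eLpNorm (fun x => gradient (f n) x - v x) 2 μ = ‖(p n).snd - v‖ₑ := fun n => by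
    rw [Lp.enorm_def]
    refine (eLpNorm_congr_ae ?_).symm
    filter_upwards [Lp.coeFn_sub (p n).snd v, h2 n] with x hx hx2
    rw [hx, Pi.sub_apply, hx2]
  have sq : ∀ {F : Type} [NormedAddCommGroup F] {u : ℕ → F}, Tendsto u atTop (nhds 0) →
      Tendsto (fun n => ‖u n‖ₑ ^ 2) atTop (nhds 0) := by
    intro F _ u hu
    have : Tendsto (fun n => ‖u n‖ₑ) atTop (nhds 0) := by
      have := (continuous_enorm.tendsto (0 : F)).comp hu
      rw [enorm_zero] at this
      exact this
    have := ENNReal.Tendsto.pow (n := 2) this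
    simpa using this
  have hvm : MemLp (v : EE d → EE d) 2 μ := Lp.memLp v
  have := hcl f v hf hfc (Lp.stronglyMeasurable v).measurable
    (by rw [lint_sq]; exact ENNReal.pow_lt_top hvm.2)
    (by simp_rw [lint_sq, e1]; exact sq l1)
    (by simp_rw [lint_sq, e2]; exact sq (by simpa using l2.sub_const v))
  exact (Lp.eq_zero_iff_ae_eq_zero).2 this

lemma fa {μ : Measure (EE d)} (hcl : SobolevClosable d μ) (w : Lp (EE d) 2 μ) {ε : ℝ} (hε : 0 < ε) :
    ∃ q : HH μ, q ∈ (Gam μ)ᗮ ∧ ‖w - q.snd‖ < ε := by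
  let D : Submodule ℝ (Lp (EE d) 2 μ) := (Gam μ)ᗮ.map (WithLp.sndL 2 ℝ _ _).toLinearMap
  have hD : Dᗮ = ⊥ := by
    rw [Submodule.eq_bot_iff]
    intro v hv
    apply closed_zero hcl
    rw [← Submodule.topologicalClosure_coe, ← Submodule.orthogonal_orthogonal_eq_closure]
    rw [SetLike.mem_coe, Submodule.mem_orthogonal]
    intro q hq
    have := (Submodule.mem_orthogonal _ _).1 hv q.snd ⟨q, hq, rfl⟩
    rw [WithLp.prod_inner_apply]
    simpa using this
  have : w ∈ D.topologicalClosure := by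
    rw [(Submodule.topologicalClosure_eq_top_iff).2 hD]; trivial
  obtain ⟨_, ⟨q, hq, rfl⟩, h⟩ := Metric.mem_closure_iff.1 this ε hε
  exact ⟨q, hq, by rw [← dist_eq_norm]; exact h⟩

lemma fa' {μ : Measure (EE d)} [IsFiniteMeasureOnCompacts μ] (hcl : SobolevClosable d μ)
    {w : EE d → EE d} (hw : MemLp w 2 μ) {ε : ℝ} (hε : 0 < ε) :
    ∃ K : ℝ, 0 ≤ K ∧ ∀ f : EE d → ℝ, ContDiff ℝ (⊤ : ℕ∞) f → HasCompactSupport f →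
      |∫ x, inner ℝ (gradient f x) (w x) ∂μ| ≤
        K * (eLpNorm f 2 μ).toReal + ε * (eLpNorm (gradient f) 2 μ).toReal := by
  obtain ⟨q, hq, hqe⟩ := fa hcl (hw.toLp w) hε
  refine ⟨‖q.fst‖, norm_nonneg _, fun f hf hc => ?_⟩
  have hfm := f_mem (μ := μ) hf hc
  have hgm := g_mem (μ := μ) hf hc
  set a := hfm.toLp f with ha
  set b := hgm.toLp (gradient f) with hb
  have h0 := (Submodule.mem_orthogonal _ _).1 hq (WithLp.toLp 2 (a, b))
    ⟨f, hf, hc, hfm.coeFn_toLp, hgm.coeFn_toLp⟩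
  rw [WithLp.prod_inner_apply] at h0
  simp only at h0
  have hI : ∫ x, inner ℝ (gradient f x) (w x) ∂μ = inner ℝ b (hw.toLp w) := by
    rw [L2.inner_def]
    refine integral_congr_ae ?_
    filter_upwards [hgm.coeFn_toLp, hw.coeFn_toLp] with x h1 h2
    rw [h1, h2]
  have hsplit : inner ℝ b (hw.toLp w) = inner ℝ b (hw.toLp w - q.snd) - inner ℝ a q.fst := by
    rw [inner_sub_right]
    have h0' : inner ℝ a q.fst + inner ℝ b q.snd = 0 := h0
    linarith
  rw [hI, hsplit, ← Lp.norm_toLp f hfm, ← Lp.norm_toLp _ hgm, ← ha, ← hb]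
  refine (abs_sub _ _).trans ?_
  have i1 := abs_real_inner_le_norm b (hw.toLp w - q.snd)
  have i2 := abs_real_inner_le_norm a q.fst
  have : ‖b‖ * ‖hw.toLp w - q.snd‖ ≤ ‖b‖ * ε := by gcongr
  linarith

end Clos

namespace Clos
variable {d : ℕ}

lemma inner_grad (f : EE d → ℝ) (x : EE d) (j : Fin d) :
    inner ℝ (gradient f x) (EuclideanSpace.single j (1 : ℝ)) = pd j f x := by
  simp [gradient, pd, InnerProductSpace.toDual_symm_apply]

lemma grad_coord (f : EE d → ℝ) (x : EE d) (j : Fin d) : gradient f x j = pd j f x := by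
  rw [← inner_grad, EuclideanSpace.inner_single_right]; simp

lemma grad_norm (f : EE d → ℝ) (x : EE d) :
    (‖gradient f x‖₊ : ℝ≥0∞) ^ 2 = ∑ i, ENNReal.ofReal ((pd i f x) ^ 2) := by
  rw [← ENNReal.ofReal_sum_of_nonneg fun _ _ => sq_nonneg _]
  have : ∑ i, (pd i f x) ^ 2 = ‖gradient f x‖ ^ 2 := by
    rw [EuclideanSpace.norm_sq_eq]
    refine Finset.sum_congr rfl fun i _ => ?_
    rw [grad_coord, Real.norm_eq_abs, sq_abs]
  rw [this, ENNReal.ofReal_pow (norm_nonneg _), ofReal_norm]; rfl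

lemma pd_mul {f g : EE d → ℝ} (hf : ContDiff ℝ (⊤ : ℕ∞) f) (hg : ContDiff ℝ (⊤ : ℕ∞) g)
    (i : Fin d) (x : EE d) : pd i (fun y => f y * g y) x = f x * pd i g x + g x * pd i f x := by
  have hf' := (hf.differentiable (by simp)) x
  have hg' := (hg.differentiable (by simp)) x
  simp [pd, fderiv_fun_mul hf' hg']

lemma lint_ind {μ : Measure (EE d)} {B : Set (EE d)} (hB : MeasurableSet B) {g h : EE d → ℝ≥0∞}
    (h0 : ∀ x, x ∉ B → g x = 0) (h1 : ∀ x, g x ≤ h x) : ∫⁻ x, g x ∂μ ≤ ∫⁻ x in B, h x ∂μ := by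
  rw [← lintegral_indicator hB]
  refine lintegral_mono fun x => ?_
  by_cases hx : x ∈ B
  · simpa [hx] using h1 x
  · simp [h0 x hx]

lemma toReal_le_of_sq {a b : ℝ≥0∞} (hb : b ≠ ⊤) (h : a ^ 2 ≤ b) : a.toReal ≤ Real.sqrt b.toReal := by
  apply Real.le_sqrt_of_sq_le
  rw [← ENNReal.toReal_pow]
  exact ENNReal.toReal_mono hb h

lemma cut_bounds {μ : Measure (EE d)} {B : Set (EE d)} (hB : IsClosed B)
    {χ v : EE d → ℝ} (hχ : ContDiff ℝ (⊤ : ℕ∞) χ) (hv : ContDiff ℝ (⊤ : ℕ∞) v)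
    (hχ0 : ∀ x, 0 ≤ χ x) (hχ1 : ∀ x, χ x ≤ 1) (hχB : tsupport χ ⊆ B)
    {L ε : ℝ} (hε1 : ε ≤ 1) (hL : ∀ i x, |pd i χ x| ≤ L) (hve : ∀ x, |v x| ≤ ε) {C : ℝ≥0∞}
    (hC : ∀ i, ∫⁻ x in B, ENNReal.ofReal ((pd i v x) ^ 2) ∂μ ≤ C) :
    (eLpNorm (fun x => χ x * v x) 2 μ) ^ 2 ≤ ENNReal.ofReal (ε ^ 2) * μ B ∧
    (eLpNorm (gradient (fun x => χ x * v x)) 2 μ) ^ 2 ≤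
      d * (2 * C + ENNReal.ofReal (2 * L ^ 2) * μ B) := by
  have hχz : ∀ x, x ∉ B → χ x = 0 := fun x hx => image_eq_zero_of_notMem_tsupport fun h => hx (hχB h)
  have hpz : ∀ i x, x ∉ B → pd i χ x = 0 := by
    intro i x hx
    have : x ∉ tsupport (fderiv ℝ χ) := fun h => hx (hχB (tsupport_fderiv_subset ℝ h))
    simp [pd, image_eq_zero_of_notMem_tsupport this]
  constructor
  · rw [← lint_sq]
    refine (lint_ind (h := fun _ => ENNReal.ofReal (ε ^ 2)) hB.measurableSet ?_ ?_).trans ?_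
    · intro x hx; simp [hχz x hx]
    · intro x
      have : |χ x * v x| ≤ ε := by
        rw [abs_mul, abs_of_nonneg (hχ0 x)]
        have := hve x
        have := hχ1 x
        have := hχ0 x
        nlinarith [abs_nonneg (v x)]
      have e : (‖χ x * v x‖₊ : ℝ≥0∞) ^ 2 = ENNReal.ofReal (|χ x * v x| ^ 2) := by
        rw [ENNReal.ofReal_pow (abs_nonneg _), ← Real.norm_eq_abs, ofReal_norm]; rfl
      rw [e]
      gcongr
    · simp
  · rw [← lint_sq]
    simp_rw [grad_norm]
    have hc : ∀ i, Measurable fun x => ENNReal.ofReal ((pd i (fun x => χ x * v x) x) ^ 2) := fun i =>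
      ((pd_contDiff (hχ.mul hv) i).continuous.pow 2).measurable.ennreal_ofReal
    rw [lintegral_finsetSum _ fun i _ => hc i]
    have key : ∀ i, ∫⁻ x, ENNReal.ofReal ((pd i (fun x => χ x * v x) x) ^ 2) ∂μ ≤
        2 * C + ENNReal.ofReal (2 * L ^ 2) * μ B := by
      intro i
      refine (lint_ind (h := fun x => 2 * ENNReal.ofReal ((pd i v x) ^ 2) + ENNReal.ofReal (2 * L ^ 2))
        hB.measurableSet ?_ ?_).trans ?_
      · intro x hx
        rw [pd_mul hχ hv, hχz x hx, hpz i x hx]; simp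
      · intro x
        have e : 2 * ENNReal.ofReal ((pd i v x) ^ 2) + ENNReal.ofReal (2 * L ^ 2) =
            ENNReal.ofReal (2 * (pd i v x) ^ 2 + 2 * L ^ 2) := by
          rw [ENNReal.ofReal_add (by positivity) (by positivity), ENNReal.ofReal_mul (by norm_num)]; simp
        rw [e, pd_mul hχ hv]
        apply ENNReal.ofReal_le_ofReal
        have a1 : (χ x * pd i v x) ^ 2 ≤ (pd i v x) ^ 2 := by
          rw [mul_pow]
          have : χ x ^ 2 ≤ 1 := pow_le_one₀ (hχ0 x) (hχ1 x)
          nlinarith [sq_nonneg (pd i v x)]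
        have a2 : (v x * pd i χ x) ^ 2 ≤ L ^ 2 := by
          rw [mul_pow]
          have b1 : v x ^ 2 ≤ 1 := by
            rw [← sq_abs]; exact pow_le_one₀ (abs_nonneg _) ((hve x).trans hε1)
          have b2 : (pd i χ x) ^ 2 ≤ L ^ 2 := by
            rw [← sq_abs]; exact pow_le_pow_left₀ (abs_nonneg _) (hL i x) 2
          nlinarith [sq_nonneg (pd i χ x)]
        nlinarith [sq_nonneg (χ x * pd i v x - v x * pd i χ x)]
      · rw [lintegral_add_right _ measurable_const, lintegral_const_mul' _ _ (by simp)]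
        simp only [lintegral_const, Measure.restrict_apply_univ]
        gcongr
        exact hC i
    refine (Finset.sum_le_sum fun i _ => key i).trans ?_
    rw [Finset.sum_const, Finset.card_univ, Fintype.card_fin, nsmul_eq_mul]

lemma lower_int {μ : Measure (EE d)} {S : Set (EE d)} (hS : MeasurableSet S) (hSf : μ S ≠ ⊤)
    {D : EE d → ℝ} (hD : Continuous D) (hDi : IntegrableOn D S μ) {q ε : ℝ} (hq : 0 ≤ q) (hε : 0 ≤ ε)
    (h1 : ∀ x, -ε ≤ D x) (h2 : μ {x | x ∈ S ∧ D x < q - ε} ≤ ENNReal.ofReal ε) :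
    (q - ε) * μ.real S - q * ε ≤ ∫ x in S, D x ∂μ := by
  set Bd := {x | x ∈ S ∧ D x < q - ε} with hBd
  have hBm : MeasurableSet Bd := hS.inter (isOpen_lt hD continuous_const).measurableSet
  have hBr : μ.real Bd ≤ ε := ENNReal.toReal_le_of_le_ofReal hε h2
  have hBS : Bd ⊆ S := fun x hx => hx.1
  have hi1 : IntegrableOn (fun _ : EE d => q - ε) S μ := integrableOn_const hSf
  have hi2 : IntegrableOn (Bd.indicator fun _ : EE d => q) S μ := (integrableOn_const hSf).indicator hBm
  have : ∫ x in S, ((q - ε) - Bd.indicator (fun _ => q) x) ∂μ ≤ ∫ x in S, D x ∂μ := by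
    refine setIntegral_mono_on (hi1.sub hi2) hDi hS fun x hx => ?_
    by_cases hb : x ∈ Bd
    · rw [Set.indicator_of_mem hb]; linarith [h1 x]
    · rw [Set.indicator_of_notMem hb]
      have : ¬ D x < q - ε := fun h => hb ⟨hx, h⟩
      linarith
  refine le_trans ?_ this
  rw [integral_sub hi1 hi2, setIntegral_const, integral_indicator hBm, Measure.restrict_restrict hBm,
    Set.inter_eq_left.2 hBS, setIntegral_const, smul_eq_mul, smul_eq_mul]
  nlinarith

end Clos

namespace Clos
variable {d : ℕ}

lemma main_bdd (hd : 1 ≤ d) {μ : Measure (EE d)} [IsFiniteMeasureOnCompacts μ]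
    (hcl : SobolevClosable d μ) {S : Set (EE d)} (hS : MeasurableSet S) (hS0 : volume S = 0)
    {R : ℝ} (hR : 0 < R) (hSR : S ⊆ Metric.ball 0 R) : μ S = 0 := by
  by_contra hne
  set B := Metric.closedBall (0 : EE d) (2 * R) with hBdef
  have hBfin : μ B ≠ ⊤ := (isCompact_closedBall _ _).measure_lt_top.ne
  have hSB : S ⊆ B := hSR.trans ((Metric.ball_subset_ball (by linarith)).trans Metric.ball_subset_closedBall)
  have hSf : μ S ≠ ⊤ := ((measure_mono hSB).trans_lt hBfin.lt_top).ne
  have hs : 0 < μ.real S := ENNReal.toReal_pos hne hSf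
  let b : ContDiffBump (0 : EE d) := ⟨R, 2 * R, hR, by linarith⟩
  let χ : EE d → ℝ := b
  have hχ : ContDiff ℝ (⊤ : ℕ∞) χ := b.contDiff
  have hχc : HasCompactSupport χ := b.hasCompactSupport
  have hχB : tsupport χ ⊆ B := b.tsupport_eq.le
  have hχone : ∀ x ∈ Metric.closedBall (0 : EE d) R, χ x = 1 := fun x hx => b.one_of_mem_closedBall hx
  have hLi : ∀ i : Fin d, ∃ M, ∀ z, ‖pd i χ z‖ ≤ M := fun i =>
    (pd_hcs hχc i).exists_bound_of_continuous (pd_contDiff hχ i).continuous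
  choose Li hLi using hLi
  have hLin : ∀ i, 0 ≤ Li i := fun i => (norm_nonneg _).trans (hLi i 0)
  set L := ∑ i, Li i with hLdef
  have hL : ∀ (i : Fin d) (z : EE d), |pd i χ z| ≤ L := fun i z =>
    (hLi i z).trans (Finset.single_le_sum (fun i _ => hLin i) (Finset.mem_univ i))
  haveI : IsFiniteMeasure (μ.restrict B) := ⟨by simpa using hBfin.lt_top⟩
  have hmN : (μ.restrict B) (Metric.closedBall 0 (2 * R))ᶜ = 0 := by
    rw [Measure.restrict_apply measurableSet_closedBall.compl]; simp [B]
  obtain ⟨C, hC, hkey⟩ := key hd (μ.restrict B) hmN hS hS0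
  have hq : 0 < cc d * cc d := by
    have : 0 < cc d := eta_integral_pos hd
    positivity
  set q := cc d * cc d with hqdef
  set C2 : ℝ≥0∞ := d * (2 * C + ENNReal.ofReal (2 * L ^ 2) * μ B) with hC2
  have hC2f : C2 ≠ ⊤ := by
    refine ENNReal.mul_ne_top (by simp) (ENNReal.add_ne_top.2 ⟨ENNReal.mul_ne_top (by simp) hC,
      ENNReal.mul_ne_top ENNReal.ofReal_ne_top hBfin⟩)
  set G := Real.sqrt C2.toReal with hG
  have hGn : 0 ≤ G := Real.sqrt_nonneg _
  set s := μ.real S with hsdef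
  set ε' := q * s / (4 * (d * G + 1)) with hε'
  have hε'p : 0 < ε' := by positivity
  have hw : ∀ j : Fin d, MemLp (S.indicator fun _ => EuclideanSpace.single j (1 : ℝ) : EE d → EE d) 2 μ :=
    fun j => memLp_indicator_const 2 hS _ (Or.inr hSf)
  choose K hKn hK using fun j => fa' hcl (hw j) hε'p
  set A := Real.sqrt (μ B).toReal with hA
  have hAn : 0 ≤ A := Real.sqrt_nonneg _
  set KK := ∑ j, K j with hKK
  have hKKn : 0 ≤ KK := Finset.sum_nonneg fun j _ => hKn j
  set ε := min 1 (q * s / (2 * (s + q + KK * A))) with hεdef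
  have hε : 0 < ε := by
    refine lt_min one_pos ?_
    positivity
  have hε1 : ε ≤ 1 := min_le_left _ _
  have hε2 : ε * (s + q + KK * A) ≤ q * s / 2 := by
    have h1 : ε ≤ q * s / (2 * (s + q + KK * A)) := min_le_right _ _
    have h2 : 0 < s + q + KK * A := by positivity
    rw [le_div_iff₀ (by positivity)] at h1
    linarith
  obtain ⟨v, hv, hvb, hvg, hvd, hvm⟩ := hkey ε hε
  let f : Fin d → EE d → ℝ := fun j x => χ x * v j x
  have hf : ∀ j, ContDiff ℝ (⊤ : ℕ∞) (f j) := fun j => hχ.mul (hv j)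
  have hfc : ∀ j, HasCompactSupport (f j) := fun j => hχc.mul_right
  have hcut := fun j => cut_bounds (μ := μ) (B := B) Metric.isClosed_closedBall hχ (hv j)
    (fun x => b.nonneg) (fun x => b.le_one) hχB hε1 hL (hvb j) (fun i => hvg i j)
  have hpdS : ∀ j, ∀ x ∈ S, pd j (f j) x = pd j (v j) x := by
    intro j x hx
    have : f j =ᶠ[nhds x] v j := by
      filter_upwards [Metric.isOpen_ball.mem_nhds (hSR hx)] with y hy
      simp [f, hχone y (Metric.ball_subset_closedBall hy)]
    simp [pd, this.fderiv_eq]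
  have hup : ∀ j, |∫ x in S, pd j (v j) x ∂μ| ≤ K j * (ε * A) + ε' * G := by
    intro j
    have h1 := hK j (f j) (hf j) (hfc j)
    have e : ∫ x, inner ℝ (gradient (f j) x) ((S.indicator fun _ => EuclideanSpace.single j (1 : ℝ)) x) ∂μ
        = ∫ x in S, pd j (v j) x ∂μ := by
      rw [← integral_indicator hS]
      congr 1; ext x
      by_cases hx : x ∈ S
      · rw [Set.indicator_of_mem hx, Set.indicator_of_mem hx, inner_grad, hpdS j x hx]
      · rw [Set.indicator_of_notMem hx, Set.indicator_of_notMem hx, inner_zero_right]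
    rw [e] at h1
    have g1 : (eLpNorm (f j) 2 μ).toReal ≤ ε * A := by
      refine (toReal_le_of_sq (ENNReal.mul_ne_top ENNReal.ofReal_ne_top hBfin) (hcut j).1).trans ?_
      rw [ENNReal.toReal_mul, ENNReal.toReal_ofReal (by positivity), Real.sqrt_mul (by positivity),
        Real.sqrt_sq hε.le]
    have g2 : (eLpNorm (gradient (f j)) 2 μ).toReal ≤ G := toReal_le_of_sq hC2f (hcut j).2
    refine h1.trans (add_le_add ?_ ?_)
    · exact mul_le_mul_of_nonneg_left g1 (hKn j)
    · exact mul_le_mul_of_nonneg_left g2 hε'p.le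
  have hpc : ∀ j, Continuous (pd j (v j)) := fun j => (pd_contDiff (hv j) j).continuous
  have hint : ∀ j, IntegrableOn (pd j (v j)) S μ := fun j =>
    ((hpc j).continuousOn.integrableOn_compact (isCompact_closedBall 0 (2 * R))).mono_set hSB
  have hDc : Continuous fun x => ∑ j, pd j (v j) x := continuous_finsetSum _ fun j _ => hpc j
  have hvm' : μ {x | x ∈ S ∧ ∑ j, pd j (v j) x < q - ε} ≤ ENNReal.ofReal ε := by
    refine le_trans (le_of_eq ?_) hvm
    rw [Measure.restrict_apply' measurableSet_closedBall, Set.inter_eq_left.2]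
    exact fun x hx => hSB hx.1
  have hlow := lower_int hS hSf hDc (integrable_finsetSum _ fun j _ => hint j) hq.le hε.le hvd hvm'
  rw [integral_finsetSum _ fun j _ => hint j] at hlow
  have hupS : ∑ j, ∫ x in S, pd j (v j) x ∂μ ≤ KK * (ε * A) + d * (ε' * G) := by
    calc _ ≤ ∑ j : Fin d, (K j * (ε * A) + ε' * G) :=
          Finset.sum_le_sum fun j _ => (le_abs_self _).trans (hup j)
      _ = _ := by
          rw [Finset.sum_add_distrib, ← Finset.sum_mul, Finset.sum_const, Finset.card_univ,
            Fintype.card_fin, nsmul_eq_mul]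
  have hlast : d * (ε' * G) ≤ q * s / 4 := by
    calc d * (ε' * G) = ε' * (d * G) := by ring
      _ ≤ ε' * (d * G + 1) := by gcongr; linarith
      _ = q * s / 4 := by rw [hε']; field_simp
  have hqs : 0 < q * s := by positivity
  nlinarith

end Clos

/-- If `d ≥ 1` and `μ` is a Radon measure on `ℝ^d` such that the Sobolev norm is closable
on compactly-supported smooth functions, then `μ` is absolutely continuous with respect
to the Lebesgue measure. -/
theorem closable_implies_absolutelyContinuous (d : ℕ) (hd : 1 ≤ d)
    (μ : Measure (EuclideanSpace ℝ (Fin d)))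
    [IsFiniteMeasureOnCompacts μ] [μ.Regular]
    (hclos : SobolevClosable d μ) :
    μ ≪ (volume : Measure (EuclideanSpace ℝ (Fin d))) := by
  refine Measure.AbsolutelyContinuous.mk fun S hS hS0 => ?_
  have hcov : S ⊆ ⋃ n : ℕ, S ∩ Metric.ball 0 ((n : ℝ) + 1) := by
    intro x hx
    obtain ⟨n, hn⟩ := exists_nat_gt ‖x‖
    refine Set.mem_iUnion.2 ⟨n, hx, ?_⟩
    rw [mem_ball_zero_iff]; linarith
  refine measure_mono_null hcov (measure_iUnion_null fun n => ?_)
  exact Clos.main_bdd hd hclos (hS.inter measurableSet_ball)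
    (measure_mono_null Set.inter_subset_left hS0) (by positivity : (0 : ℝ) < (n : ℝ) + 1)
    Set.inter_subset_right
end
end

section
/- There is no nonzero Radon measure μ on ℝ² that is singular with respect to the Lebesgue measure 𝓛² and for which the Sobolev norm is closable on compactly-supported smooth functions. Equivalently: for every nonzero Radon measure μ on ℝ² with μ ⊥ 𝓛², there exist a sequence (f_n)_n ⊆ C_c^∞(ℝ²) and a Borel map v : ℝ² → ℝ² with |v| ∈ L²(μ) such that f_n → 0 in L²(μ), ∇f_n → v in L²(μ; ℝ²), and v is not μ-almost everywhere equal to 0. -/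
open MeasureTheory Filter ENNReal

noncomputable section

/-- Splitting a finite set into a part without long `A`-chains and a part without long `B`-chains. -/
theorem chain_split {α : Type*} [DecidableEq α] (A B : α → α → Prop)
    (hAB : ∀ p q, (A p q ∨ A q p) → (B p q ∨ B q p) → False) (m : ℕ) :
    ∀ (n : ℕ) (P : Finset α), P.card ≤ m * n → ∃ P1 P2 : Finset α, P ⊆ P1 ∪ P2 ∧
      (∀ C ⊆ P1, IsChain A (C : Set α) → C.card ≤ m) ∧
      (∀ C ⊆ P2, IsChain B (C : Set α) → C.card ≤ n) := by
  intro n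
  induction n with
  | zero =>
    intro P hP
    have : P = ∅ := by simpa using hP
    subst this
    refine ⟨∅, ∅, by simp, ?_, ?_⟩ <;> simp
  | succ n ih =>
    intro P hP
    by_cases h : ∀ C ⊆ P, IsChain A (C : Set α) → C.card ≤ m
    · exact ⟨P, ∅, by simp, h, by simp⟩
    · push Not at h
      obtain ⟨C, hCP, hC, hm⟩ := h
      have hc : (P \ C).card ≤ m * n := by
        rw [Finset.card_sdiff_of_subset hCP]
        rw [mul_add] at hP; omega
      obtain ⟨P1, P2, h12, h1, h2⟩ := ih _ hc
      refine ⟨P1, P2 ∪ C, ?_, h1, ?_⟩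
      · intro x hx
        by_cases hxC : x ∈ C
        · simp [hxC]
        · have := h12 (Finset.mem_sdiff.2 ⟨hx, hxC⟩)
          simp at this ⊢; tauto
      · intro D hD hDc
        have e : D = (D \ C) ∪ (D ∩ C) := by ext x; simp; tauto
        have c1 : (D \ C).card ≤ n := by
          apply h2
          · intro x hx
            have hx' := Finset.mem_sdiff.1 hx
            have := hD hx'.1
            simp at this; tauto
          · exact hDc.mono (by simp)
        have c2 : (D ∩ C).card ≤ 1 := by
          rw [Finset.card_le_one]
          intro x hx y hy
          by_contra hne
          have hx' := Finset.mem_inter.1 hx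
          have hy' := Finset.mem_inter.1 hy
          exact hAB x y (hC hx'.2 hy'.2 hne) (hDc hx'.1 hy'.1 hne)
        calc D.card = ((D \ C) ∪ (D ∩ C)).card := by rw [← e]
          _ ≤ _ := Finset.card_union_le _ _
          _ ≤ n + 1 := by omega

theorem exists_height {α : Type*} [DecidableEq α] (A : α → α → Prop)
    (hirr : ∀ p, ¬ A p p) (htr : ∀ p q r, A p q → A q r → A p r) (m : ℕ) (P : Finset α)
    (hP : ∀ C ⊆ P, IsChain A (C : Set α) → C.card ≤ m) :
    ∃ h : α → ℕ, (∀ p ∈ P, h p < m) ∧ ∀ p ∈ P, ∀ q ∈ P, A q p → h q + 1 ≤ h p := by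
  classical
  let S : α → Finset (Finset α) := fun p =>
    P.powerset.filter (fun C => IsChain A (C : Set α) ∧ ∀ r ∈ C, A r p)
  have hins : ∀ p ∈ P, ∀ C ∈ S p, insert p C ⊆ P ∧ IsChain A ((insert p C : Finset α) : Set α)
      ∧ (insert p C).card = C.card + 1 := by
    intro p hp C hC
    simp only [S, Finset.mem_filter, Finset.mem_powerset] at hC
    refine ⟨?_, ?_, ?_⟩
    · intro x hx
      rcases Finset.mem_insert.1 hx with rfl | h
      · exact hp
      · exact hC.1 h
    · rw [Finset.coe_insert]
      exact hC.2.1.insert (fun b hb _ => Or.inr (hC.2.2 b hb))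
    · exact Finset.card_insert_of_notMem (fun h => hirr p (hC.2.2 p h))
  refine ⟨fun p => (S p).sup Finset.card, ?_, ?_⟩
  · intro p hp
    have hne : (S p).Nonempty := ⟨∅, by simp [S]⟩
    obtain ⟨C, hC, e⟩ := Finset.exists_mem_eq_sup (S p) hne Finset.card
    obtain ⟨h1, h2, h3⟩ := hins p hp C hC
    have := hP _ h1 h2
    simp only
    omega
  · intro p hp q hq hqp
    have hne : (S q).Nonempty := ⟨∅, by simp [S]⟩
    obtain ⟨C, hC, e⟩ := Finset.exists_mem_eq_sup (S q) hne Finset.card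
    obtain ⟨h1, h2, h3⟩ := hins q hq C hC
    simp only
    rw [e, ← h3]
    apply Finset.le_sup (f := Finset.card)
    simp only [S, Finset.mem_filter, Finset.mem_powerset] at hC ⊢
    refine ⟨h1, h2, ?_⟩
    intro r hr
    rcases Finset.mem_insert.1 hr with rfl | h
    · exact hqp
    · exact htr _ _ _ (hC.2.2 r h) hqp

/-- The Lipschitz staircase function. -/
theorem staircase {E : Type*} [NormedAddCommGroup E] [NormedSpace ℝ E]
    (a b : E →L[ℝ] ℝ) (ha : ∀ z, |a z| ≤ ‖z‖) (hb : ∀ z, |b z| ≤ ‖z‖) (e : E)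
    (hae : a e = 1) (hbe : b e = 1) (s : ℝ) (hs : 0 < s) (m : ℕ) (P : Finset E) (h : E → ℕ)
    (hm : ∀ p ∈ P, h p < m)
    (hh : ∀ p ∈ P, ∀ q ∈ P, (a q < a p ∧ b q < b p) → h q + 1 ≤ h p) :
    ∃ f : E → ℝ, (∀ z, 0 ≤ f z) ∧ (∀ z, f z ≤ s * m) ∧ (∀ z w, f z ≤ f w + ‖z - w‖) ∧
      (∀ z (t : ℝ), 0 ≤ t → f z ≤ f (z + t • e)) ∧
      (∀ p ∈ P, ∀ z t, 0 ≤ t → -(s/2) ≤ a z - a p → -(s/2) ≤ b z - b p →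
        a z + t - a p ≤ s/2 → b z + t - b p ≤ s/2 → f z + t ≤ f (z + t • e)) := by
  classical
  let F : E → Option E → ℝ := fun z o => o.elim 0
    (fun p => s * h p + min (min (a z - a p + s/2) (b z - b p + s/2)) s)
  have hne : (Finset.insertNone P).Nonempty := ⟨none, by simp⟩
  let f : E → ℝ := fun z => (Finset.insertNone P).sup' hne (F z)
  have hle0 : ∀ z, 0 ≤ f z := fun z =>
    Finset.le_sup' (F z) (show none ∈ Finset.insertNone P by simp)
  have hleP : ∀ z, ∀ p ∈ P,
      s * h p + min (min (a z - a p + s/2) (b z - b p + s/2)) s ≤ f z := fun z p hp =>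
    Finset.le_sup' (F z) (show some p ∈ Finset.insertNone P by simpa using hp)
  have hcase : ∀ z, f z = 0 ∨ ∃ p ∈ P,
      f z = s * h p + min (min (a z - a p + s/2) (b z - b p + s/2)) s := by
    intro z
    obtain ⟨o, ho, e⟩ := Finset.exists_mem_eq_sup' hne (F z)
    cases o with
    | none => exact Or.inl e
    | some p => exact Or.inr ⟨p, by simpa using ho, e⟩
  refine ⟨f, hle0, ?_, ?_, ?_, ?_⟩
  · intro z
    rcases hcase z with h0 | ⟨p, hp, h0⟩
    · rw [h0]; positivity
    · rw [h0]
      have h1 : min (min (a z - a p + s/2) (b z - b p + s/2)) s ≤ s := min_le_right _ _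
      have h2 : (h p : ℝ) + 1 ≤ m := by exact_mod_cast hm p hp
      nlinarith
  · intro z w
    rcases hcase z with h0 | ⟨p, hp, h0⟩
    · rw [h0]; have := hle0 w; positivity
    · rw [h0]
      have h1 := hleP w p hp
      have h2 := abs_le.1 (ha (z - w))
      have h3 := abs_le.1 (hb (z - w))
      rw [map_sub] at h2 h3
      have h4 : min (min (a z - a p + s/2) (b z - b p + s/2)) s ≤
        min (min (a w - a p + s/2) (b w - b p + s/2)) s + ‖z - w‖ := by
        rw [← min_add_add_right, ← min_add_add_right]
        refine min_le_min (min_le_min ?_ ?_) ?_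
        · linarith
        · linarith
        · have := norm_nonneg (z - w); linarith
      linarith
  · intro z t ht
    rcases hcase z with h0 | ⟨p, hp, h0⟩
    · rw [h0]; exact hle0 _
    · rw [h0]
      refine le_trans ?_ (hleP _ p hp)
      simp only [map_add, map_smul, hae, hbe, smul_eq_mul, mul_one]
      gcongr <;> linarith
  · intro p hp z t ht h1 h2 h3 h4
    have key := hleP (z + t • e) p hp
    simp only [map_add, map_smul, hae, hbe, smul_eq_mul, mul_one] at key
    have k2 : t ≤ min (min (a z + t - a p + s/2) (b z + t - b p + s/2)) s :=
      le_min (le_min (by linarith) (by linarith)) (by linarith)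
    rcases hcase z with h0 | ⟨q, hq, h0⟩
    · rw [h0]
      have : 0 ≤ s * (h p : ℝ) := by positivity
      linarith
    · by_cases hc : a q + s/2 < a z + t ∧ b q + s/2 < b z + t
      · have h5 : (h q : ℝ) + 1 ≤ h p := by
          exact_mod_cast hh p hp q hq ⟨by linarith, by linarith⟩
        have h6 : min (min (a z - a q + s/2) (b z - b q + s/2)) s ≤ s := min_le_right _ _
        nlinarith
      · have key2 := hleP (z + t • e) q hq
        simp only [map_add, map_smul, hae, hbe, smul_eq_mul, mul_one] at key2
        rw [h0]
        refine le_trans ?_ key2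
        rw [add_assoc]
        gcongr
        rw [not_and_or] at hc
        refine le_min (le_min ?_ ?_) ?_
        · have := (min_le_left (min (a z - a q + s/2) (b z - b q + s/2)) s).trans (min_le_left _ _)
          linarith
        · have := (min_le_left (min (a z - a q + s/2) (b z - b q + s/2)) s).trans (min_le_right _ _)
          linarith
        · have i1 := (min_le_left (min (a z - a q + s/2) (b z - b q + s/2)) s).trans
            (min_le_left _ _)
          have i2 := (min_le_left (min (a z - a q + s/2) (b z - b q + s/2)) s).trans
            (min_le_right _ _)
          rcases hc with hc | hc <;> linarith

theorem deriv_lower {E : Type*} [NormedAddCommGroup E] [NormedSpace ℝ E] (g : E → ℝ) (z e : E)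
    (hg : DifferentiableAt ℝ g z) (c δ : ℝ) (hδ : 0 < δ)
    (h : ∀ t, 0 ≤ t → t ≤ δ → g z + c * t ≤ g (z + t • e)) : c ≤ fderiv ℝ g z e := by
  have h1 : HasDerivAt (fun t : ℝ => g (z + t • e)) (fderiv ℝ g z e) 0 := by
    have hl : HasDerivAt (fun t : ℝ => z + t • e) e 0 := by
      simpa using ((hasDerivAt_id (0:ℝ)).smul_const e).const_add z
    have hg' : HasFDerivAt g (fderiv ℝ g z) (z + (0:ℝ) • e) := by simpa using hg.hasFDerivAt
    exact hg'.comp_hasDerivAt (0:ℝ) hl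
  have h2 := h1.tendsto_slope_zero_right
  refine ge_of_tendsto h2 ?_
  have : Set.Ioo (0:ℝ) δ ∈ nhdsWithin (0:ℝ) (Set.Ioi 0) := Ioo_mem_nhdsGT hδ
  filter_upwards [this] with t ht
  have h3 := h t ht.1.le ht.2.le
  simp only [zero_add, zero_smul, add_zero, smul_eq_mul]
  rw [← div_eq_inv_mul, le_div_iff₀ ht.1]
  linarith

theorem mollify (f : EuclideanSpace ℝ (Fin 2) → ℝ) (M δ : ℝ) (hδ : 0 < δ)
    (e : EuclideanSpace ℝ (Fin 2)) (h0 : ∀ z, 0 ≤ f z) (hM : ∀ z, f z ≤ M)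
    (hlip : ∀ z w, f z ≤ f w + ‖z - w‖)
    (hmono : ∀ z (t : ℝ), 0 ≤ t → f z ≤ f (z + t • e)) :
    ∃ g : EuclideanSpace ℝ (Fin 2) → ℝ, ContDiff ℝ (⊤ : ℕ∞) g ∧ (∀ z, 0 ≤ g z) ∧ (∀ z, g z ≤ M) ∧
      (∀ z, ‖fderiv ℝ g z‖ ≤ 1) ∧ (∀ z, 0 ≤ fderiv ℝ g z e) ∧
      (∀ z, (∀ y (t : ℝ), ‖y - z‖ ≤ δ → 0 ≤ t → t ≤ δ → f y + t ≤ f (y + t • e)) →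
        1 ≤ fderiv ℝ g z e) := by
  have hf : LipschitzWith 1 f := by
    apply LipschitzWith.of_dist_le_mul
    intro x y
    rw [Real.dist_eq, abs_le, dist_eq_norm]
    have h1 := hlip x y
    have h2 := hlip y x
    rw [norm_sub_rev] at h2
    constructor <;> simp <;> linarith
  let φ : ContDiffBump (0 : EuclideanSpace ℝ (Fin 2)) := ⟨δ / 2, δ, by positivity, by linarith⟩
  let ψ := φ.normed volume
  have hψc : Continuous ψ := φ.continuous_normed
  have hψs : HasCompactSupport ψ := φ.hasCompactSupport_normed
  have hψ0 : ∀ x, 0 ≤ ψ x := φ.nonneg_normed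
  have hψ1 : ∫ x, ψ x = 1 := φ.integral_normed
  have hψi : Integrable ψ := φ.integrable_normed
  let g := convolution ψ f (ContinuousLinearMap.lsmul ℝ ℝ) volume
  have hgdef : ∀ z, g z = ∫ τ, ψ τ * f (z - τ) := fun z => by
    simp only [g, convolution, ContinuousLinearMap.lsmul_apply, smul_eq_mul]
  have hgs : ContDiff ℝ (⊤ : ℕ∞) g :=
    hψs.contDiff_convolution_left _ φ.contDiff_normed hf.continuous.locallyIntegrable
  have hint : ∀ z, Integrable (fun τ => ψ τ * f (z - τ)) := fun z => by
    apply Continuous.integrable_of_hasCompactSupport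
    · have := hf.continuous
      fun_prop
    · exact hψs.mul_right
  have hcmp : ∀ z w c, (∀ τ, ‖τ‖ ≤ δ → f (z - τ) + c ≤ f (w - τ)) → g z + c ≤ g w := by
    intro z w c h
    rw [hgdef, hgdef]
    have : c = ∫ τ, ψ τ * c := by rw [integral_mul_const, hψ1, one_mul]
    rw [this, ← integral_add (hint z) (hψi.mul_const c)]
    refine integral_mono ((hint z).add (hψi.mul_const c)) (hint w) ?_
    intro τ
    by_cases hτ : ‖τ‖ ≤ δ
    · have := mul_le_mul_of_nonneg_left (h τ hτ) (hψ0 τ)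
      simp only; linarith
    · have : ψ τ = 0 := by
        by_contra hne
        have h1 : τ ∈ Function.support ψ := hne
        rw [φ.support_normed_eq] at h1
        simp at h1
        exact hτ h1.le
      simp [this]
  have hglip : LipschitzWith 1 g := by
    apply LipschitzWith.of_dist_le_mul
    intro x y
    rw [Real.dist_eq, abs_le, dist_eq_norm]
    have h1 := hcmp x y (-‖x - y‖) (fun τ _ => by
      have := hlip (x - τ) (y - τ); simp at this; linarith)
    have h2 := hcmp y x (-‖x - y‖) (fun τ _ => by
      have := hlip (y - τ) (x - τ); rw [norm_sub_rev] at this; simp at this; linarith)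
    constructor <;> simp <;> linarith
  have hgd : ∀ z, DifferentiableAt ℝ g z := fun z => hgs.differentiable (by simp) z
  refine ⟨g, hgs, ?_, ?_, ?_, ?_, ?_⟩
  · intro z
    rw [hgdef]
    exact integral_nonneg (fun τ => mul_nonneg (hψ0 τ) (h0 _))
  · intro z
    have : M = ∫ τ, ψ τ * M := by rw [integral_mul_const, hψ1, one_mul]
    rw [hgdef, this]
    exact integral_mono (hint z) (hψi.mul_const M)
      (fun τ => mul_le_mul_of_nonneg_left (hM _) (hψ0 τ))
  · intro z
    simpa using norm_fderiv_le_of_lipschitz ℝ (x₀ := z) hglip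
  · intro z
    refine deriv_lower g z e (hgd z) 0 1 one_pos ?_
    intro t ht _
    have := hcmp z (z + t • e) 0 (fun τ _ => by
      have := hmono (z - τ) t ht
      rw [add_sub_right_comm]; linarith)
    linarith
  · intro z hz
    refine deriv_lower g z e (hgd z) 1 δ hδ ?_
    intro t ht htδ
    have := hcmp z (z + t • e) t (fun τ hτ => by
      rw [add_sub_right_comm]
      exact hz (z - τ) t (by simpa using hτ) ht htδ)
    linarith

/-- one direction -/
theorem one_direction (a b : EuclideanSpace ℝ (Fin 2) →L[ℝ] ℝ) (ha : ∀ z, |a z| ≤ ‖z‖)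
    (hb : ∀ z, |b z| ≤ ‖z‖) (e : EuclideanSpace ℝ (Fin 2))
    (hae : a e = 1) (hbe : b e = 1) (δ : ℝ) (hδ : 0 < δ) (m : ℕ)
    (P : Finset (EuclideanSpace ℝ (Fin 2)))
    (hP : ∀ C ⊆ P, IsChain (fun p q => a p < a q ∧ b p < b q)
      (C : Set (EuclideanSpace ℝ (Fin 2))) → C.card ≤ m) :
    ∃ g : EuclideanSpace ℝ (Fin 2) → ℝ, ContDiff ℝ (⊤ : ℕ∞) g ∧ (∀ z, 0 ≤ g z) ∧
      (∀ z, g z ≤ 6 * δ * m) ∧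
      (∀ z, ‖fderiv ℝ g z‖ ≤ 1) ∧ (∀ z, 0 ≤ fderiv ℝ g z e) ∧
      (∀ p ∈ P, ∀ z, ‖z - p‖ ≤ δ → 1 ≤ fderiv ℝ g z e) := by
  classical
  obtain ⟨h, hm, hh⟩ := exists_height (fun p q => a p < a q ∧ b p < b q) (by simp)
    (fun p q r h1 h2 => ⟨h1.1.trans h2.1, h1.2.trans h2.2⟩) m P hP
  obtain ⟨f, f0, fM, flip, fmono, fgrow⟩ := staircase a b ha hb e hae hbe (6 * δ) (by positivity)
    m P h hm hh
  obtain ⟨g, gs, g0, gM, gl, ge, g1⟩ := mollify f _ δ hδ e f0 fM flip fmono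
  refine ⟨g, gs, g0, gM, gl, ge, ?_⟩
  intro p hp z hz
  apply g1 z
  intro y t hy ht htδ
  have k1 := abs_le.1 (ha (y - z))
  have k2 := abs_le.1 (hb (y - z))
  have k3 := abs_le.1 (ha (z - p))
  have k4 := abs_le.1 (hb (z - p))
  rw [map_sub] at k1 k2 k3 k4
  apply fgrow p hp y t ht <;> linarith

theorem packing (K : Set (EuclideanSpace ℝ (Fin 2))) (hK : IsCompact K) (hK0 : volume K = 0)
    (η δ₀ : ℝ) (hη : 0 < η) (hδ₀ : 0 < δ₀) :
    ∃ (δ : ℝ) (P : Finset (EuclideanSpace ℝ (Fin 2))), 0 < δ ∧ δ ≤ δ₀ ∧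
      (∀ z ∈ K, ∃ p ∈ P, ‖z - p‖ ≤ δ) ∧ P.card * δ ^ 2 ≤ η := by
  obtain ⟨U, hKU, hU, hUv⟩ := K.exists_isOpen_lt_of_lt (μ := volume) (ENNReal.ofReal (η / 2))
    (by rw [hK0]; simpa using hη)
  obtain ⟨ρ, hρ, hρU⟩ := hK.exists_thickening_subset_open hU hKU
  let δ : ℝ := min δ₀ ρ
  have hδ : 0 < δ := lt_min hδ₀ hρ
  let δ' : NNReal := ⟨δ / 2, by positivity⟩
  have hδ'0 : δ' ≠ 0 := by
    intro h
    have : δ / 2 = 0 := congrArg NNReal.toReal h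
    linarith
  have hfin : Metric.packingNumber (2 * δ') K ≠ ⊤ := by
    obtain ⟨N, hNK, hN, hcov⟩ := Metric.exists_finite_isCover_of_isCompact hδ'0 hK
    refine ne_top_of_le_ne_top ?_ ((Metric.packingNumber_two_mul_le_externalCoveringNumber δ' K).trans
      hcov.externalCoveringNumber_le_encard)
    exact Set.encard_ne_top_iff.2 hN
  have h1 := Metric.isCover_maximalSeparatedSet hfin
  have h2 := Metric.isSeparated_maximalSeparatedSet (ε := 2 * δ') (A := K)
  have h3 := Metric.maximalSeparatedSet_subset (ε := 2 * δ') (A := K)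
  have h4 := Metric.encard_maximalSeparatedSet hfin
  have hPf : (Metric.maximalSeparatedSet (2 * δ') K).Finite := by
    rw [← Set.encard_ne_top_iff, h4]; exact hfin
  have h2δ : ((2 * δ' : NNReal) : ℝ) = δ := by
    change 2 * (δ / 2) = δ
    ring
  generalize Metric.maximalSeparatedSet (2 * δ') K = S at h1 h2 h3 h4 hPf
  refine ⟨δ, hPf.toFinset, hδ, min_le_left _ _, ?_, ?_⟩
  · intro z hz
    rw [Metric.isCover_iff_subset_iUnion_closedBall] at h1
    have := h1 hz
    simp only [Set.mem_iUnion] at this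
    obtain ⟨p, hp, hzp⟩ := this
    refine ⟨p, by simpa using hp, ?_⟩
    rw [Metric.mem_closedBall, h2δ, dist_eq_norm] at hzp
    exact hzp
  · have hdisj : (hPf.toFinset : Set (EuclideanSpace ℝ (Fin 2))).PairwiseDisjoint
        (fun p => Metric.ball p (δ / 2)) := by
      intro p hp q hq hpq
      apply Metric.ball_disjoint_ball
      have := h2 (by simpa using hp) (by simpa using hq) hpq
      simp only [edist_nndist] at this
      have h5 : (2 * δ' : NNReal) < nndist p q := by exact_mod_cast this
      have h6 : ((2 * δ' : NNReal) : ℝ) < dist p q := by exact_mod_cast h5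
      rw [h2δ] at h6; linarith
    have hvol : ∑ p ∈ hPf.toFinset, volume (Metric.ball p (δ / 2)) ≤ volume U := by
      rw [← measure_biUnion_finset hdisj (fun p _ => measurableSet_ball)]
      apply measure_mono
      intro x hx
      simp only [Set.mem_iUnion] at hx
      obtain ⟨p, hp, hx⟩ := hx
      apply hρU
      rw [Metric.mem_thickening_iff]
      refine ⟨p, h3 (by simpa using hp), ?_⟩
      rw [Metric.mem_ball] at hx
      have : δ ≤ ρ := min_le_right _ _
      linarith
    have hb : ∀ p : EuclideanSpace ℝ (Fin 2),
        ENNReal.ofReal (δ ^ 2 / 2) ≤ volume (Metric.ball p (δ / 2)) := by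
      intro p
      rw [EuclideanSpace.volume_ball_fin_two, ← ENNReal.ofReal_pow (by positivity)]
      rw [← ENNReal.ofReal_mul (by positivity)]
      apply ENNReal.ofReal_le_ofReal
      nlinarith [Real.pi_gt_three, sq_nonneg δ]
    have h7 : (hPf.toFinset.card : ENNReal) * ENNReal.ofReal (δ ^ 2 / 2) ≤
        ENNReal.ofReal (η / 2) := by
      refine le_trans ?_ (hvol.trans hUv.le)
      rw [← nsmul_eq_mul]
      exact Finset.card_nsmul_le_sum _ _ _ (fun p _ => hb p)
    rw [← ENNReal.ofReal_natCast, ← ENNReal.ofReal_mul (by positivity),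
      ENNReal.ofReal_le_ofReal_iff (by positivity)] at h7
    linarith

theorem two_functions (K : Set (EuclideanSpace ℝ (Fin 2))) (hK : IsCompact K)
    (hK0 : volume K = 0) (ε : ℝ) (hε : 0 < ε) :
    ∃ g : Fin 2 → EuclideanSpace ℝ (Fin 2) → ℝ, (∀ i, ContDiff ℝ (⊤ : ℕ∞) (g i)) ∧
      (∀ i z, |g i z| ≤ ε) ∧ (∀ i z, ‖fderiv ℝ (g i) z‖ ≤ 1) ∧
      (∀ i z, 0 ≤ fderiv ℝ (g i) z (![!₂[1, 1], !₂[1, -1]] i)) ∧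
      (∀ z ∈ K, ∃ i, 1 ≤ fderiv ℝ (g i) z (![!₂[1, 1], !₂[1, -1]] i)) := by
  classical
  obtain ⟨δ, P, hδ, hδε, hcov, hcard⟩ := packing K hK hK0 ((ε / 12) ^ 2) (ε / 12)
    (by positivity) (by positivity)
  let a : EuclideanSpace ℝ (Fin 2) →L[ℝ] ℝ := EuclideanSpace.proj 0
  let b : EuclideanSpace ℝ (Fin 2) →L[ℝ] ℝ := EuclideanSpace.proj 1
  have ha : ∀ z, |a z| ≤ ‖z‖ := fun z => PiLp.norm_apply_le z 0
  have hb : ∀ z, |b z| ≤ ‖z‖ := fun z => PiLp.norm_apply_le z 1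
  have hb' : ∀ z, |(-b) z| ≤ ‖z‖ := fun z => by simpa using hb z
  let m : ℕ := Nat.sqrt P.card + 1
  have hm : P.card ≤ m * m := (Nat.lt_succ_sqrt P.card).le
  have hbound : 6 * δ * m ≤ ε := by
    have h1 : (Nat.sqrt P.card : ℝ) * Nat.sqrt P.card ≤ P.card := by
      exact_mod_cast Nat.sqrt_le P.card
    have h2 : (Nat.sqrt P.card * δ) ^ 2 ≤ (ε / 12) ^ 2 := by
      refine le_trans ?_ hcard
      nlinarith [sq_nonneg δ]
    have h3 : Nat.sqrt P.card * δ ≤ ε / 12 := by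
      exact (pow_le_pow_iff_left₀ (by positivity) (by positivity) two_ne_zero).1 h2
    simp only [m]
    push_cast
    linarith
  obtain ⟨P1, P2, h12, h1, h2⟩ := chain_split (fun p q => a p < a q ∧ b p < b q)
    (fun p q => a p < a q ∧ (-b) p < (-b) q) (by
      intro p q h h'
      simp only [neg_apply, neg_lt_neg_iff] at h'
      rcases h with h | h <;> rcases h' with h' | h' <;> linarith [h.1, h.2, h'.1, h'.2]) m m P hm
  obtain ⟨g, gs, g0, gM, gl, ge, g1⟩ := one_direction a b ha hb !₂[1, 1] (by simp [a])
    (by simp [b]) δ hδ m P1 h1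
  obtain ⟨k, ks, k0, kM, kl, ke, k1⟩ := one_direction a (-b) ha hb' !₂[1, -1] (by simp [a])
    (by simp [b]) δ hδ m P2 h2
  refine ⟨![g, k], ?_, ?_, ?_, ?_, ?_⟩
  · rw [Fin.forall_fin_two]; exact ⟨gs, ks⟩
  · rw [Fin.forall_fin_two]
    refine ⟨fun z => ?_, fun z => ?_⟩
    · exact (abs_of_nonneg (g0 z)).trans_le ((gM z).trans hbound)
    · exact (abs_of_nonneg (k0 z)).trans_le ((kM z).trans hbound)
  · rw [Fin.forall_fin_two]; exact ⟨gl, kl⟩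
  · rw [Fin.forall_fin_two]; exact ⟨ge, ke⟩
  · intro z hz
    obtain ⟨p, hp, hzp⟩ := hcov z hz
    rcases Finset.mem_union.1 (h12 hp) with hp | hp
    · exact ⟨0, g1 p hp z hzp⟩
    · exact ⟨1, k1 p hp z hzp⟩

theorem good_direction (μ : Measure (EuclideanSpace ℝ (Fin 2))) [IsFiniteMeasureOnCompacts μ]
    (K : Set (EuclideanSpace ℝ (Fin 2))) (hK : IsCompact K) (hK0 : volume K = 0) :
    ∃ e : EuclideanSpace ℝ (Fin 2), ∀ ε : ℝ, 0 < ε → ∃ g : EuclideanSpace ℝ (Fin 2) → ℝ,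
      ContDiff ℝ (⊤ : ℕ∞) g ∧ (∀ z, |g z| ≤ ε) ∧ (∀ z, ‖fderiv ℝ g z‖ ≤ 1) ∧
      μ.real K / 2 ≤ ∫ x in K, fderiv ℝ g x e ∂μ := by
  by_contra! hcon
  have h1 := fun i : Fin 2 => hcon (![!₂[1, 1], !₂[1, -1]] i)
  choose ε hε h2 using h1
  obtain ⟨g, gs, gM, gl, ge, g1⟩ := two_functions K hK hK0 (min (ε 0) (ε 1)) (lt_min (hε 0) (hε 1))
  have k0 := h2 0 (g 0) (gs 0) (fun z => (gM 0 z).trans (min_le_left _ _)) (gl 0)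
  have k1 := h2 1 (g 1) (gs 1) (fun z => (gM 1 z).trans (min_le_right _ _)) (gl 1)
  have hint : ∀ i, IntegrableOn (fun x => fderiv ℝ (g i) x (![!₂[1, 1], !₂[1, -1]] i)) K μ := by
    intro i
    apply ContinuousOn.integrableOn_compact hK
    apply Continuous.continuousOn
    exact ((gs i).continuous_fderiv (by simp)).clm_apply continuous_const
  have hsum : μ.real K ≤ ∫ x in K, (fderiv ℝ (g 0) x (![!₂[1, 1], !₂[1, -1]] 0) +
      fderiv ℝ (g 1) x (![!₂[1, 1], !₂[1, -1]] 1)) ∂μ := by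
    have : μ.real K = ∫ x in K, (1 : ℝ) ∂μ := by simp
    rw [this]
    apply setIntegral_mono_on
    · exact integrableOn_const hK.measure_lt_top.ne
    · exact (hint 0).add (hint 1)
    · exact hK.measurableSet
    · intro x hx
      obtain ⟨i, hi⟩ := g1 x hx
      have e0 := ge 0 x
      have e1 := ge 1 x
      revert hi
      revert i
      rw [Fin.forall_fin_two]
      constructor <;> intro hi <;> linarith
  rw [integral_add (hint 0) (hint 1)] at hsum
  linarith

theorem hilbert_nested {H : Type*} [NormedAddCommGroup H] [InnerProductSpace ℝ H]
    [CompleteSpace H] (A : ℕ → Set H) (hne : ∀ n, (A n).Nonempty)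
    (hconv : ∀ n, ∀ x ∈ A n, ∀ y ∈ A n, (1 / 2 : ℝ) • (x + y) ∈ A n)
    (hanti : ∀ n k, n ≤ k → A k ⊆ A n) (C : ℝ) (hC : ∀ n, ∀ x ∈ A n, ‖x‖ ≤ C) :
    ∃ u : ℕ → H, (∀ n, u n ∈ A n) ∧ ∃ p, Tendsto u atTop (nhds p) := by
  let d : ℕ → ℝ := fun n => sInf (norm '' A n)
  have hbdd : ∀ n, BddBelow (norm '' A n) := fun n => ⟨0, by
    rintro _ ⟨x, _, rfl⟩; exact norm_nonneg x⟩
  have hdle : ∀ n, ∀ x ∈ A n, d n ≤ ‖x‖ := fun n x hx => csInf_le (hbdd n) ⟨x, hx, rfl⟩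
  have hd0 : ∀ n, 0 ≤ d n := fun n => Real.sInf_nonneg (by
    rintro _ ⟨x, _, rfl⟩; exact norm_nonneg x)
  have hmono : Monotone d := fun n k hnk =>
    csInf_le_csInf (hbdd n) ((hne k).image _) (Set.image_mono (hanti n k hnk))
  have hdC : ∀ n, d n ≤ C := fun n => by
    obtain ⟨x, hx⟩ := hne n
    exact (hdle n x hx).trans (hC n x hx)
  have hB : BddAbove (Set.range d) := ⟨C, by rintro _ ⟨n, rfl⟩; exact hdC n⟩
  have hlim := tendsto_atTop_ciSup hmono hB
  set L := ⨆ n, d n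
  have hdL : ∀ n, d n ≤ L := fun n => le_ciSup hB n
  have hex : ∀ n : ℕ, ∃ x ∈ A n, ‖x‖ < d n + 1 / ((n : ℝ) + 1) := fun n => by
    obtain ⟨_, ⟨x, hx, rfl⟩, hlt⟩ := exists_lt_of_csInf_lt ((hne n).image norm)
      (show sInf (norm '' A n) < d n + 1 / ((n : ℝ) + 1) from lt_add_of_pos_right _ (by positivity))
    exact ⟨x, hx, hlt⟩
  choose u hu hun using hex
  refine ⟨u, hu, ?_⟩
  apply cauchySeq_tendsto_of_complete
  apply cauchySeq_of_le_tendsto_0' (fun n : ℕ => Real.sqrt (4 * ((L + 1 / ((n : ℝ) + 1)) ^ 2 - d n ^ 2)))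
  · intro n k hnk
    apply Real.le_sqrt_of_sq_le
    rw [dist_eq_norm]
    have par := parallelogram_law_with_norm ℝ (u n) (u k)
    have h1 := hdle n _ (hconv n (u n) (hu n) (u k) (hanti n k hnk (hu k)))
    rw [norm_smul] at h1
    norm_num at h1
    have h2 : ‖u n‖ ≤ L + 1 / ((n : ℝ) + 1) := (hun n).le.trans (by linarith [hdL n])
    have h3 : ‖u k‖ ≤ L + 1 / ((n : ℝ) + 1) := by
      have : 1 / ((k : ℝ) + 1) ≤ 1 / ((n : ℝ) + 1) := by
        have : (n : ℝ) ≤ k := by exact_mod_cast hnk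
        gcongr
      linarith [hdL k, hun k]
    have h4 := pow_le_pow_left₀ (norm_nonneg _) h2 2
    have h5 := pow_le_pow_left₀ (norm_nonneg _) h3 2
    have h6 := pow_le_pow_left₀ (hd0 n) h1 2
    nlinarith
  · have t1 : Tendsto (fun n : ℕ => 4 * ((L + 1 / ((n : ℝ) + 1)) ^ 2 - d n ^ 2)) atTop
        (nhds (4 * ((L + 0) ^ 2 - L ^ 2))) :=
      (((tendsto_const_nhds.add tendsto_one_div_add_atTop_nhds_zero_nat).pow 2).sub
        (hlim.pow 2)).const_mul 4
    have := t1.sqrt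
    simpa using this

theorem exists_compact_null (μ : Measure (EuclideanSpace ℝ (Fin 2)))
    [IsFiniteMeasureOnCompacts μ] [μ.Regular] (hμ : μ ≠ 0)
    (hsing : μ.MutuallySingular (volume : Measure (EuclideanSpace ℝ (Fin 2)))) :
    ∃ K, IsCompact K ∧ volume K = 0 ∧ 0 < μ K := by
  obtain ⟨s, hs, h1, h2⟩ := hsing
  have h3 : 0 < μ sᶜ := by
    rw [pos_iff_ne_zero]
    intro h
    apply hμ
    rw [← Measure.measure_univ_eq_zero, ← Set.union_compl_self s]
    exact measure_union_null h1 h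
  obtain ⟨K, hKs, hK, hpos⟩ := hs.compl.exists_lt_isCompact h3
  exact ⟨K, hK, measure_mono_null hKs h2, hpos⟩

theorem cutoff_function (K : Set (EuclideanSpace ℝ (Fin 2))) (hK : IsCompact K) :
    ∃ (T : Set (EuclideanSpace ℝ (Fin 2))) (M : ℝ), IsCompact T ∧ 0 ≤ M ∧
      ∀ (g : EuclideanSpace ℝ (Fin 2) → ℝ) (ε : ℝ), ε ≤ 1 →
        ContDiff ℝ (⊤ : ℕ∞) g → (∀ z, |g z| ≤ ε) → (∀ z, ‖fderiv ℝ g z‖ ≤ 1) →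
        ∃ F : EuclideanSpace ℝ (Fin 2) → ℝ, ContDiff ℝ (⊤ : ℕ∞) F ∧ tsupport F ⊆ T ∧
          (∀ z, |F z| ≤ ε) ∧ (∀ z, ‖fderiv ℝ F z‖ ≤ M) ∧
          (∀ z ∈ K, fderiv ℝ F z = fderiv ℝ g z) := by
  obtain ⟨R, hR⟩ := hK.isBounded.subset_closedBall (0 : EuclideanSpace ℝ (Fin 2))
  let χ : ContDiffBump (0 : EuclideanSpace ℝ (Fin 2)) :=
    ⟨|R| + 1, |R| + 2, by positivity, by linarith⟩
  have χs : ContDiff ℝ (⊤ : ℕ∞) χ := χ.contDiff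
  obtain ⟨M, hM⟩ := (χ.hasCompactSupport.fderiv ℝ).exists_bound_of_continuous
    (χs.continuous_fderiv (by simp))
  have hM0 : 0 ≤ M := (norm_nonneg _).trans (hM 0)
  refine ⟨Metric.closedBall 0 (|R| + 2), M + 1, isCompact_closedBall _ _, by positivity, ?_⟩
  intro g ε hε gs gε gl
  have hε0 : 0 ≤ ε := (abs_nonneg _).trans (gε 0)
  refine ⟨fun z => χ z * g z, χs.mul gs, ?_, ?_, ?_, ?_⟩
  · refine (tsupport_mul_subset_left (f := χ) (g := g)).trans ?_
    rw [χ.tsupport_eq]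
  · intro z
    rw [abs_mul, abs_of_nonneg χ.nonneg]
    have h1 : χ z ≤ 1 := χ.le_one
    have h0 : 0 ≤ χ z := χ.nonneg
    calc χ z * |g z| ≤ 1 * ε := mul_le_mul h1 (gε z) (abs_nonneg _) zero_le_one
      _ = ε := one_mul _
  · intro z
    rw [fderiv_fun_mul (χs.differentiable (by simp) z) (gs.differentiable (by simp) z)]
    have h1 : χ z ≤ 1 := χ.le_one
    have h0 : 0 ≤ χ z := χ.nonneg
    calc _ ≤ ‖χ z • fderiv ℝ g z‖ + ‖g z • fderiv ℝ χ z‖ := norm_add_le _ _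
      _ = χ z * ‖fderiv ℝ g z‖ + |g z| * ‖fderiv ℝ χ z‖ := by
        rw [norm_smul, norm_smul, Real.norm_eq_abs, Real.norm_eq_abs, abs_of_nonneg h0]
      _ ≤ 1 * 1 + 1 * M := by
        gcongr
        · exact gl z
        · exact (gε z).trans hε
        · exact hM z
      _ = M + 1 := by ring
  · intro z hz
    apply Filter.EventuallyEq.fderiv_eq
    have : z ∈ Metric.ball (0 : EuclideanSpace ℝ (Fin 2)) χ.rIn := by
      have h1 := hR hz
      rw [Metric.mem_closedBall] at h1
      rw [Metric.mem_ball]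
      have : χ.rIn = |R| + 1 := rfl
      have := le_abs_self R
      linarith
    filter_upwards [Metric.isOpen_ball.mem_nhds this] with y hy
    rw [χ.one_of_mem_closedBall (Metric.ball_subset_closedBall hy), one_mul]

theorem gradient_inner (F : EuclideanSpace ℝ (Fin 2) → ℝ) (x e : EuclideanSpace ℝ (Fin 2)) :
    inner ℝ e (gradient F x) = fderiv ℝ F x e := by
  rw [real_inner_comm, gradient, InnerProductSpace.toDual_symm_apply]

theorem gradient_norm (F : EuclideanSpace ℝ (Fin 2) → ℝ) (x : EuclideanSpace ℝ (Fin 2)) :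
    ‖gradient F x‖ = ‖fderiv ℝ F x‖ := by
  rw [gradient, LinearIsometryEquiv.norm_map]

theorem gradient_half (F G : EuclideanSpace ℝ (Fin 2) → ℝ) (x : EuclideanSpace ℝ (Fin 2))
    (hF : DifferentiableAt ℝ F x) (hG : DifferentiableAt ℝ G x) :
    gradient (fun y => (1 / 2 : ℝ) * (F y + G y)) x
      = (1 / 2 : ℝ) • (gradient F x + gradient G x) := by
  have h : fderiv ℝ (fun y => (1 / 2 : ℝ) * (F y + G y)) x
      = (1 / 2 : ℝ) • (fderiv ℝ F x + fderiv ℝ G x) := by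
    rw [fderiv_const_mul (hF.fun_add hG), fderiv_fun_add hF hG]
  rw [gradient, h]
  simp [gradient]

theorem lintegral_sq_eq {α E : Type*} [MeasurableSpace α] [NormedAddCommGroup E] (μ : Measure α)
    (f : α → E) : ∫⁻ x, (‖f x‖₊ : ENNReal) ^ 2 ∂μ = eLpNorm f 2 μ ^ 2 := by
  rw [eLpNorm_eq_lintegral_rpow_enorm_toReal (by norm_num) (by norm_num)]
  rw [← ENNReal.rpow_natCast, ← ENNReal.rpow_mul]
  simp [enorm_eq_nnnorm]

theorem no_singular_Radon_measure_closable
    (μ : Measure (EuclideanSpace ℝ (Fin 2)))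
    [IsFiniteMeasureOnCompacts μ] [μ.Regular]
    (hμ : μ ≠ 0)
    (hsing : μ.MutuallySingular (volume : Measure (EuclideanSpace ℝ (Fin 2)))) :
    ∃ (f : ℕ → EuclideanSpace ℝ (Fin 2) → ℝ)
      (v : EuclideanSpace ℝ (Fin 2) → EuclideanSpace ℝ (Fin 2)),
      (∀ n, ContDiff ℝ (⊤ : ℕ∞) (f n)) ∧ (∀ n, HasCompactSupport (f n)) ∧
      Measurable v ∧ (∫⁻ x, (‖v x‖₊ : ℝ≥0∞) ^ 2 ∂μ) < ⊤ ∧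
      Tendsto (fun n => ∫⁻ x, (‖f n x‖₊ : ℝ≥0∞) ^ 2 ∂μ) atTop (nhds 0) ∧
      Tendsto (fun n => ∫⁻ x, (‖gradient (f n) x - v x‖₊ : ℝ≥0∞) ^ 2 ∂μ) atTop (nhds 0) ∧
      ¬ (v =ᵐ[μ] 0) := by
  obtain ⟨K, hK, hK0, hKpos⟩ := exists_compact_null μ hμ hsing
  obtain ⟨e, he⟩ := good_direction μ K hK hK0
  obtain ⟨T, M, hT, hM, hcut⟩ := cutoff_function K hK
  have hKμ : μ K ≠ ⊤ := hK.measure_lt_top.ne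
  have hTμ : μ T ≠ ⊤ := hT.measure_lt_top.ne
  have hKr : 0 < μ.real K := ENNReal.toReal_pos hKpos.ne' hKμ
  let w : Lp (EuclideanSpace ℝ (Fin 2)) 2 μ := indicatorConstLp 2 hK.measurableSet hKμ e
  let D : Lp ℝ 2 μ := indicatorConstLp 2 hT.measurableSet hTμ M
  let S : ℕ → Set (Lp (EuclideanSpace ℝ (Fin 2)) 2 μ) := fun n =>
    {u | (∃ F : EuclideanSpace ℝ (Fin 2) → ℝ, ContDiff ℝ (⊤ : ℕ∞) F ∧ tsupport F ⊆ T ∧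
      (∀ z, |F z| ≤ 1 / ((n : ℝ) + 1)) ∧ u =ᵐ[μ] gradient F) ∧ ‖u‖ ≤ ‖D‖ ∧
      μ.real K / 2 ≤ inner ℝ w u}
  have hne : ∀ n, (S n).Nonempty := by
    intro n
    obtain ⟨g, gs, gε, gl, gi⟩ := he (1 / ((n : ℝ) + 1)) (by positivity)
    obtain ⟨F, Fs, FT, Fε, Fl, FK⟩ := hcut g (1 / ((n : ℝ) + 1)) (by
      rw [div_le_one (by positivity)]; linarith [Nat.cast_nonneg (α := ℝ) n]) gs gε gl
    have hFc : HasCompactSupport F := hT.of_isClosed_subset (isClosed_tsupport _) FT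
    have hgc : Continuous (gradient F) :=
      (InnerProductSpace.toDual ℝ _).symm.continuous.comp (Fs.continuous_fderiv (by simp))
    have hgz : ∀ x, x ∉ T → gradient F x = 0 := by
      intro x hx
      rw [← norm_eq_zero, gradient_norm, norm_eq_zero]
      by_contra h
      exact hx (FT (support_fderiv_subset ℝ h))
    have hgs : HasCompactSupport (gradient F) := HasCompactSupport.intro hT hgz
    have hmem : MemLp (gradient F) 2 μ := hgc.memLp_of_hasCompactSupport hgs
    refine ⟨hmem.toLp, ⟨F, Fs, FT, Fε, hmem.coeFn_toLp⟩, ?_, ?_⟩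
    · apply Lp.norm_le_norm_of_ae_le
      filter_upwards [hmem.coeFn_toLp, indicatorConstLp_coeFn (p := 2) (hs := hT.measurableSet)
        (hμs := hTμ) (c := M)] with x h1 h2
      rw [h1, h2]
      by_cases hx : x ∈ T
      · rw [Set.indicator_of_mem hx, gradient_norm, Real.norm_eq_abs, abs_of_nonneg hM]
        exact Fl x
      · rw [hgz x hx]; simp
    · rw [L2.inner_indicatorConstLp_eq_setIntegral_inner]
      refine gi.trans (le_of_eq ?_)
      apply setIntegral_congr_ae hK.measurableSet
      filter_upwards [hmem.coeFn_toLp] with x h1 hx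
      rw [h1, gradient_inner, FK x hx]
  have hconv : ∀ n, ∀ x ∈ S n, ∀ y ∈ S n, (1 / 2 : ℝ) • (x + y) ∈ S n := by
    rintro n x ⟨⟨F, Fs, FT, Fε, Fx⟩, xD, xw⟩ y ⟨⟨G, Gs, GT, Gε, Gy⟩, yD, yw⟩
    refine ⟨⟨fun z => (1 / 2 : ℝ) * (F z + G z), contDiff_const.mul (Fs.add Gs), ?_, ?_, ?_⟩,
      ?_, ?_⟩
    · refine (tsupport_mul_subset_right (f := fun _ => (1 / 2 : ℝ))
        (g := fun z => F z + G z)).trans ?_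
      exact (tsupport_add F G).trans (Set.union_subset FT GT)
    · intro z
      have h1 := abs_le.1 (Fε z)
      have h2 := abs_le.1 (Gε z)
      rw [abs_le]; constructor <;> linarith [h1.1, h1.2, h2.1, h2.2]
    · filter_upwards [Fx, Gy, Lp.coeFn_smul (1 / 2 : ℝ) (x + y), Lp.coeFn_add x y] with z h1 h2 h3 h4
      rw [h3, Pi.smul_apply, h4, Pi.add_apply, h1, h2, gradient_half _ _ _
        (Fs.differentiable (by simp) z) (Gs.differentiable (by simp) z)]
    · rw [norm_smul]
      have := norm_add_le x y
      norm_num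
      linarith
    · rw [inner_smul_right, inner_add_right]
      linarith
  have hanti : ∀ n k, n ≤ k → S k ⊆ S n := by
    rintro n k hnk x ⟨⟨F, Fs, FT, Fε, Fx⟩, xD, xw⟩
    refine ⟨⟨F, Fs, FT, fun z => (Fε z).trans ?_, Fx⟩, xD, xw⟩
    have : (n : ℝ) ≤ k := by exact_mod_cast hnk
    gcongr
  obtain ⟨u, hu, p, hp⟩ := hilbert_nested S hne hconv hanti ‖D‖ (fun n x hx => hx.2.1)
  choose hF hD hw using hu
  choose f fs fT fε fu using hF
  have hpm := Lp.aestronglyMeasurable p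
  let v := hpm.mk p
  have hv : p =ᵐ[μ] v := hpm.ae_eq_mk
  refine ⟨f, v, fs, fun n => hT.of_isClosed_subset (isClosed_tsupport _) (fT n),
    hpm.stronglyMeasurable_mk.measurable, ?_, ?_, ?_, ?_⟩
  · rw [lintegral_sq_eq, ← eLpNorm_congr_ae hv]
    exact ENNReal.pow_lt_top (Lp.eLpNorm_lt_top p)
  · have hb : ∀ n, ∫⁻ x, (‖f n x‖₊ : ENNReal) ^ 2 ∂μ ≤
        ENNReal.ofReal (1 / ((n : ℝ) + 1)) ^ 2 * μ T := by
      intro n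
      rw [← lintegral_indicator_const hT.measurableSet]
      apply lintegral_mono
      intro x
      by_cases hx : x ∈ T
      · rw [Set.indicator_of_mem hx]
        apply pow_le_pow_left'
        rw [← enorm_eq_nnnorm, ← ofReal_norm_eq_enorm]
        exact ENNReal.ofReal_le_ofReal (fε n x)
      · have : f n x = 0 := by
          by_contra h
          exact hx (fT n (subset_tsupport _ h))
        simp [this]
    refine tendsto_of_tendsto_of_tendsto_of_le_of_le tendsto_const_nhds ?_ (fun _ => zero_le) hb
    have t1 : Tendsto (fun n : ℕ => ENNReal.ofReal (1 / ((n : ℝ) + 1))) atTop (nhds 0) := by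
      have := ENNReal.tendsto_ofReal (tendsto_one_div_add_atTop_nhds_zero_nat (𝕜 := ℝ))
      simpa using this
    have t2 := ENNReal.Tendsto.mul_const (ENNReal.Tendsto.pow (n := 2) t1) (Or.inr hTμ)
    simpa using t2
  · have h1 : ∀ n, ∫⁻ x, (‖gradient (f n) x - v x‖₊ : ENNReal) ^ 2 ∂μ = edist (u n) p ^ 2 := by
      intro n
      rw [lintegral_sq_eq μ (fun x => gradient (f n) x - v x), Lp.edist_def]
      congr 1
      apply eLpNorm_congr_ae
      filter_upwards [fu n, hv] with x h1 h2
      simp [h1, h2]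
    simp_rw [h1]
    have h2 : Tendsto (fun n => edist (u n) p) atTop (nhds 0) := tendsto_iff_edist_tendsto_0.1 hp
    simpa using ENNReal.Tendsto.pow (n := 2) h2
  · intro hv0
    have hp0 : p = 0 := by
      rw [Lp.eq_zero_iff_ae_eq_zero]
      exact hv.trans hv0
    have h1 : Tendsto (fun n => inner ℝ w (u n)) atTop (nhds (inner ℝ w p)) :=
      tendsto_const_nhds.inner hp
    have h2 := ge_of_tendsto' h1 hw
    rw [hp0, inner_zero_right] at h2
    linarith
end
end

section
/- There exists a Radon measure μ on ℝ that is absolutely continuous with respect to the Lebesgue measure 𝓛¹ (one may take μ = 𝓛¹ restricted to a Cantor-type compact set C ⊆ ℝ of positive Lebesgue measure with empty interior and totally disconnected) and for which the Sobolev norm is not closable on compactly-supported smooth functions: there exist a sequence (f_n)_n ⊆ C_c^∞(ℝ) and a Borel function v : ℝ → ℝ with v ∈ L²(μ) such that f_n → 0 in L²(μ), f_n' → v in L²(μ), and v is not μ-almost everywhere equal to 0. In particular, the converse of the implication 'closability implies absolute continuity' fails. -/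
open MeasureTheory Filter ENNReal

noncomputable section

def stair (n : ℕ) (x : ℝ) : ℝ :=
  ∑ k ∈ Finset.range (n+1), Real.smoothTransition (2^(n+2) * ((n+1) * x - k))

def fseq (b : ContDiffBump (0:ℝ)) (n : ℕ) (x : ℝ) : ℝ := b x * (x - stair n x / (n+1))

def bad (n : ℕ) : Set ℝ := ⋃ k ∈ Finset.range (n+1),
  Set.Icc ((k:ℝ)/(n+1)) ((k:ℝ)/(n+1) + 1/(2^(n+2)*(n+1)))

lemma stair_contDiff (n : ℕ) : ContDiff ℝ (⊤ : ℕ∞) (stair n) := by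
  unfold stair
  refine ContDiff.sum fun k _ => ?_
  exact Real.smoothTransition.contDiff.comp (by fun_prop)

lemma st_aux (m : ℕ) (c : ℝ) (hc : 1 ≤ c) (y : ℝ) (hy : 0 ≤ y) :
    |∑ k ∈ Finset.range m, Real.smoothTransition (c * (y - k)) - min y m| ≤ 1 := by
  induction m with
  | zero => simp [hy]
  | succ m ih =>
    rw [Finset.sum_range_succ]
    rcases le_total y m with h | h
    · rw [Real.smoothTransition.zero_of_nonpos (by nlinarith)]
      have h2 : y ≤ ((m+1 : ℕ) : ℝ) := by push_cast; linarith
      rw [min_eq_left h] at ih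
      rw [min_eq_left h2]; simpa using ih
    · have : ∑ k ∈ Finset.range m, Real.smoothTransition (c * (y - k)) = m := by
        rw [Finset.sum_congr rfl (g := fun _ => (1:ℝ))]
        · simp
        · intro k hk
          apply Real.smoothTransition.one_of_one_le
          have : (k:ℝ) + 1 ≤ m := by exact_mod_cast Finset.mem_range.1 hk
          nlinarith
      rw [this]
      have h0 := Real.smoothTransition.nonneg (c * (y - m))
      have h1 := Real.smoothTransition.le_one (c * (y - m))
      have h3 : (m:ℝ) ≤ min y ((m+1 : ℕ) : ℝ) := le_min h (by push_cast; linarith)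
      have h4 : min y ((m+1 : ℕ) : ℝ) ≤ m + 1 := (min_le_right _ _).trans (by push_cast; linarith)
      rw [abs_le]; constructor <;> linarith

lemma stair_close (n : ℕ) (x : ℝ) (h0 : 0 ≤ x) (h1 : x ≤ 1) :
    |x - stair n x / (n+1)| ≤ 1 / (n+1) := by
  have hn : (0:ℝ) < n + 1 := by positivity
  have := st_aux (n+1) (2^(n+2)) (one_le_pow₀ (by norm_num)) ((n+1)*x) (by positivity)
  rw [min_eq_left (by push_cast; nlinarith)] at this
  have e : x - stair n x / (n+1) = -((stair n x - (n+1)*x) / (n+1)) := by field_simp; ring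
  rw [e, abs_neg, abs_div, abs_of_pos hn]
  gcongr
  exact this

lemma st_deriv (t : ℝ) (ht : t < 0 ∨ 1 < t) : HasDerivAt Real.smoothTransition 0 t := by
  rcases ht with ht | ht
  · refine (hasDerivAt_const t (0:ℝ)).congr_of_eventuallyEq ?_
    filter_upwards [Iio_mem_nhds ht] with y hy
    exact Real.smoothTransition.zero_of_nonpos (le_of_lt hy)
  · refine (hasDerivAt_const t (1:ℝ)).congr_of_eventuallyEq ?_
    filter_upwards [Ioi_mem_nhds ht] with y hy
    exact Real.smoothTransition.one_of_one_le (le_of_lt hy)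

lemma stair_deriv (n : ℕ) (x : ℝ) (hx : x ∉ bad n) : HasDerivAt (stair n) 0 x := by
  have key : ∀ k ∈ Finset.range (n+1), HasDerivAt
      (fun x : ℝ => Real.smoothTransition (2^(n+2) * ((n+1) * x - k))) 0 x := by
    intro k hk
    have hx' : x ∉ Set.Icc ((k:ℝ)/(n+1)) ((k:ℝ)/(n+1) + 1/(2^(n+2)*(n+1))) := by
      intro h; exact hx (Set.mem_biUnion hk h)
    have hn : (0:ℝ) < n + 1 := by positivity
    have hp : (0:ℝ) < 2^(n+2) := by positivity
    have ht : 2^(n+2) * ((n+1) * x - k) < 0 ∨ 1 < 2^(n+2) * ((n+1) * x - k) := by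
      by_contra! h
      obtain ⟨ha, hb⟩ := h
      apply hx'
      constructor
      · rw [div_le_iff₀ hn]
        have := nonneg_of_mul_nonneg_right ha hp
        linarith
      · have : (k:ℝ)/(n+1) + 1/(2^(n+2)*(n+1)) = (k + 1/2^(n+2))/(n+1) := by
          field_simp
        rw [this, le_div_iff₀ hn]
        have : (n+1) * x - k ≤ 1/2^(n+2) := by
          rw [le_div_iff₀ hp]; linarith
        linarith
    have hd : HasDerivAt (fun x : ℝ => (2:ℝ)^(n+2) * ((n+1) * x - k)) (2^(n+2) * ((n+1)*1)) x :=
      (((hasDerivAt_id x).const_mul _).sub_const _).const_mul _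
    have h3 := (st_deriv _ ht).comp x hd
    rw [zero_mul] at h3
    exact h3
  have := HasDerivAt.fun_sum key
  rw [Finset.sum_const_zero] at this
  exact this

lemma bad_meas (n : ℕ) : MeasurableSet (bad n) :=
  Finset.measurableSet_biUnion _ fun _ _ => measurableSet_Icc

lemma bad_vol (n : ℕ) : volume (bad n) ≤ ENNReal.ofReal (1/2/2 * (1/2)^n) := by
  refine (measure_biUnion_finset_le _ _).trans ?_
  simp only [Real.volume_Icc, add_sub_cancel_left, Finset.sum_const, Finset.card_range]
  rw [nsmul_eq_mul, ← ENNReal.ofReal_natCast, ← ENNReal.ofReal_mul (by positivity)]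
  apply le_of_eq
  congr 1
  push_cast
  rw [one_div_pow]
  field_simp
  ring

def goodK : Set ℝ := Set.Icc 0 1 \ ⋃ n, bad n

lemma goodK_meas : MeasurableSet goodK :=
  measurableSet_Icc.diff (MeasurableSet.iUnion bad_meas)

lemma union_vol : volume (⋃ n, bad n) ≤ ENNReal.ofReal (1/2) := by
  refine (measure_iUnion_le _).trans ((ENNReal.tsum_le_tsum bad_vol).trans ?_)
  rw [← ENNReal.ofReal_tsum_of_nonneg (fun n => by positivity)
    (summable_geometric_two.mul_left _), tsum_mul_left, tsum_geometric_two]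
  norm_num

lemma goodK_pos : volume goodK ≠ 0 := by
  intro h
  have h1 : volume (Set.Icc (0:ℝ) 1) ≤ volume goodK + volume (⋃ n, bad n) := by
    refine (measure_mono ?_).trans (measure_union_le _ _)
    intro x hx
    by_cases hb : x ∈ ⋃ n, bad n
    · exact Or.inr hb
    · exact Or.inl ⟨hx, hb⟩
  rw [h, zero_add, Real.volume_Icc] at h1
  have := (ENNReal.ofReal_le_ofReal_iff (by norm_num)).1 (h1.trans union_vol)
  norm_num at this

lemma goodK_le : volume goodK ≤ 1 := by
  refine (measure_mono Set.sdiff_subset).trans ?_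
  simp [Real.volume_Icc]

/-- There exists a nonzero Radon measure `μ` on `ℝ`, absolutely continuous with respect
to the Lebesgue measure, for which the Sobolev norm is not closable on
compactly-supported smooth functions: there are `f n ∈ C_c^∞(ℝ)` and a Borel function
`v ∈ L²(μ)` with `f n → 0` in `L²(μ)`, `(f n)' → v` in `L²(μ)`, and `v` not μ-a.e. zero.
In particular the converse of "closability implies absolute continuity" fails. -/
theorem exists_ac_Radon_measure_not_closable :
    ∃ μ : Measure ℝ, IsFiniteMeasureOnCompacts μ ∧ μ.Regular ∧ μ ≠ 0 ∧
      μ ≪ (volume : Measure ℝ) ∧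
      ∃ (f : ℕ → ℝ → ℝ) (v : ℝ → ℝ),
        (∀ n, ContDiff ℝ (⊤ : ℕ∞) (f n)) ∧ (∀ n, HasCompactSupport (f n)) ∧
        Measurable v ∧ (∫⁻ x, (‖v x‖₊ : ℝ≥0∞) ^ 2 ∂μ) < ⊤ ∧
        Tendsto (fun n => ∫⁻ x, (‖f n x‖₊ : ℝ≥0∞) ^ 2 ∂μ) atTop (nhds 0) ∧
        Tendsto (fun n => ∫⁻ x, (‖deriv (f n) x - v x‖₊ : ℝ≥0∞) ^ 2 ∂μ) atTop (nhds 0) ∧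
        ¬ (v =ᵐ[μ] 0) := by
  have hfin : IsFiniteMeasure (volume.restrict goodK) :=
    ⟨by rw [Measure.restrict_apply_univ]; exact goodK_le.trans_lt ENNReal.one_lt_top⟩
  have hne : volume.restrict goodK ≠ 0 := by
    rw [Ne, Measure.restrict_eq_zero]; exact goodK_pos
  have hmu : (volume.restrict goodK) Set.univ ≤ 1 := by
    rw [Measure.restrict_apply_univ]; exact goodK_le
  let b : ContDiffBump (0:ℝ) := ⟨2, 3, by norm_num, by norm_num⟩
  refine ⟨volume.restrict goodK, inferInstance, inferInstance, hne,
    Measure.absolutelyContinuous_of_le Measure.restrict_le_self,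
    fseq b, fun _ => 1, ?_, ?_, measurable_const, ?_, ?_, ?_, ?_⟩
  · intro n
    exact b.contDiff.mul (contDiff_id.sub ((stair_contDiff n).div_const _))
  · intro n
    exact b.hasCompactSupport.mul_right
  · simpa using goodK_le.trans_lt ENNReal.one_lt_top
  · have hb : ∀ n, ∫⁻ x in goodK, (‖fseq b n x‖₊ : ℝ≥0∞) ^ 2 ≤
        ENNReal.ofReal (1 / ((n:ℝ)+1)) ^ 2 := by
      intro n
      calc _ ≤ ∫⁻ x in goodK, ENNReal.ofReal (1 / ((n:ℝ)+1)) ^ 2 := by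
            refine setLIntegral_mono measurable_const fun x hx => ?_
            gcongr
            rw [← enorm_eq_nnnorm, ← ofReal_norm]
            apply ENNReal.ofReal_le_ofReal
            have h1 := stair_close n x hx.1.1 hx.1.2
            rw [Real.norm_eq_abs, fseq, abs_mul, abs_of_nonneg b.nonneg]
            exact (mul_le_of_le_one_left (abs_nonneg _) b.le_one).trans h1
        _ ≤ _ := by
            rw [lintegral_const]
            exact mul_le_of_le_one_right' hmu
    refine tendsto_of_tendsto_of_tendsto_of_le_of_le tendsto_const_nhds ?_
      (fun _ => zero_le) hb
    have h1 : Tendsto (fun n : ℕ => ENNReal.ofReal (1 / ((n:ℝ)+1))) atTop (nhds 0) := by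
      simpa using ENNReal.tendsto_ofReal tendsto_one_div_add_atTop_nhds_zero_nat
    simpa using ENNReal.Tendsto.pow (n := 2) h1
  · have hz : ∀ n, ∫⁻ x in goodK, (‖deriv (fseq b n) x - 1‖₊ : ℝ≥0∞) ^ 2 = 0 := by
      intro n
      rw [setLIntegral_congr_fun (g := fun _ => 0) goodK_meas]
      · simp
      · intro x hx
        have hbad : x ∉ bad n := fun h => hx.2 (Set.mem_iUnion.2 ⟨n, h⟩)
        have hd : HasDerivAt (fun x => x - stair n x / (n+1)) (1 - 0 / ((n:ℝ)+1)) x :=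
          (hasDerivAt_id x).sub ((stair_deriv n x hbad).div_const _)
        have he : fseq b n =ᶠ[nhds x] fun x => x - stair n x / (n+1) := by
          have hxb : x ∈ Metric.ball (0:ℝ) b.rIn := by
            have h0 := hx.1.1
            have h1 := hx.1.2
            change x ∈ Metric.ball (0:ℝ) 2
            rw [Metric.mem_ball, Real.dist_eq, sub_zero, abs_lt]
            constructor <;> linarith
          filter_upwards [b.eventuallyEq_one_of_mem_ball hxb] with y hy
          simp [fseq, hy]
        have := (hd.congr_of_eventuallyEq he).deriv
        simp [this]
    simp only [hz]
    exact tendsto_const_nhds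
  · intro h
    have : ∀ᵐ x ∂(volume.restrict goodK), False := by
      filter_upwards [h] with x hx
      simp at hx
    rw [eventually_false_iff_eq_bot, ae_eq_bot] at this
    exact hne this
end
end

section
/- Let μ be a Radon measure on ℝ^d and suppose the Sobolev norm is closable on compactly-supported smooth functions. Then the functional f ↦ ∫|∇f|² dμ is L²(μ)-lower semicontinuous on C_c^∞(ℝ^d): for every f ∈ C_c^∞(ℝ^d) and every sequence (f_n)_n ⊆ C_c^∞(ℝ^d) with f_n → f in L²(μ), one has ∫|∇f|² dμ ≤ liminf_{n→∞} ∫|∇f_n|² dμ. -/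
open MeasureTheory Filter ENNReal

noncomputable section

open Topology in
theorem hilbert_aux {F H : Type*} [NormedAddCommGroup F] [NormedSpace ℝ F]
    [NormedAddCommGroup H] [InnerProductSpace ℝ H] [CompleteSpace H]
    (S : Set (F × H)) (hS : Convex ℝ S) (x : F) (c : ℝ)
    (h : ∀ ε > 0, ∃ p ∈ S, ‖p.1 - x‖ ≤ ε ∧ ‖p.2‖ ≤ c) :
    ∃ (p : ℕ → F × H) (w : H), (∀ n, p n ∈ S) ∧ Tendsto (fun n => (p n).1) atTop (𝓝 x) ∧
      Tendsto (fun n => (p n).2) atTop (𝓝 w) ∧ ‖w‖ ≤ c := by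
  let δ : ℕ → ℝ := fun n => 1 / ((n : ℝ) + 1)
  have hδ : ∀ n, 0 < δ n := fun n => Nat.one_div_pos_of_nat
  have hδa : Antitone δ := fun a b hab => Nat.one_div_le_one_div hab
  have hδ0 : Tendsto δ atTop (𝓝 0) := tendsto_one_div_add_atTop_nhds_zero_nat
  let A : ℕ → Set (F × H) := fun n => {p | p ∈ S ∧ ‖p.1 - x‖ ≤ δ n ∧ ‖p.2‖ ≤ c}
  have hAa : ∀ {a b}, a ≤ b → A b ⊆ A a :=
    fun hab p hp => ⟨hp.1, hp.2.1.trans (hδa hab), hp.2.2⟩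
  have hAne : ∀ n, (A n).Nonempty := fun n => by
    obtain ⟨p, hp, h1, h2⟩ := h (δ n) (hδ n)
    exact ⟨p, hp, h1, h2⟩
  let N : F × H → ℝ := fun p => ‖p.2‖
  let m : ℕ → ℝ := fun n => sInf (N '' A n)
  have hbdd : ∀ n, BddBelow (N '' A n) := fun n => ⟨0, by rintro _ ⟨p, -, rfl⟩; exact norm_nonneg _⟩
  have hmle : ∀ n, ∀ p ∈ A n, m n ≤ ‖p.2‖ := fun n p hp => csInf_le (hbdd n) ⟨p, hp, rfl⟩
  have hm0 : ∀ n, 0 ≤ m n := fun n => le_csInf ((hAne n).image N) (by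
    rintro _ ⟨p, -, rfl⟩; exact norm_nonneg _)
  have hmono : Monotone m := fun a b hab =>
    csInf_le_csInf (hbdd a) ((hAne b).image N) (Set.image_mono (hAa hab))
  have hmc : BddAbove (Set.range m) := ⟨c, by
    rintro _ ⟨n, rfl⟩
    obtain ⟨p, hp⟩ := hAne n
    exact (hmle n p hp).trans hp.2.2⟩
  let M := ⨆ n, m n
  have hM : Tendsto m atTop (𝓝 M) := tendsto_atTop_ciSup hmono hmc
  have hmM : ∀ n, m n ≤ M := fun n => le_ciSup hmc n
  have hex : ∀ n, ∃ p ∈ A n, ‖p.2‖ < m n + δ n := fun n => by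
    obtain ⟨_, ⟨p, hp, rfl⟩, h2⟩ := exists_lt_of_csInf_lt ((hAne n).image N)
      (show sInf (N '' A n) < m n + δ n from lt_add_of_pos_right _ (hδ n))
    exact ⟨p, hp, h2⟩
  choose p hpA hpn using hex
  let b : ℕ → ℝ := fun n => Real.sqrt (4 * (M + δ n) ^ 2 - 4 * (m n) ^ 2)
  have hb : Tendsto b atTop (𝓝 0) := by
    have : Tendsto b atTop (𝓝 (Real.sqrt (4 * (M + 0) ^ 2 - 4 * M ^ 2))) :=
      ((((tendsto_const_nhds.add hδ0).pow 2).const_mul 4).sub ((hM.pow 2).const_mul 4)).sqrt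
    simpa using this
  have hmid : ∀ n, ∀ q ∈ A n, ∀ r ∈ A n, m n ≤ ‖(1/2 : ℝ) • (q.2 + r.2)‖ := by
    intro n q hq r hr
    have hs : (1/2 : ℝ) • q + (1/2 : ℝ) • r ∈ A n := by
      refine ⟨hS hq.1 hr.1 (by norm_num) (by norm_num) (by norm_num), ?_, ?_⟩
      · have := (convex_closedBall x (δ n)) (mem_closedBall_iff_norm.2 hq.2.1)
          (mem_closedBall_iff_norm.2 hr.2.1) (a := 1/2) (b := 1/2)
          (by norm_num) (by norm_num) (by norm_num)
        exact mem_closedBall_iff_norm.1 this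
      · have := (convex_closedBall (0 : H) c) (mem_closedBall_zero_iff.2 hq.2.2)
          (mem_closedBall_zero_iff.2 hr.2.2) (a := 1/2) (b := 1/2)
          (by norm_num) (by norm_num) (by norm_num)
        exact mem_closedBall_zero_iff.1 this
    have := hmle n _ hs
    rw [smul_add]
    exact this
  have hcau : CauchySeq (fun n => (p n).2) := by
    refine cauchySeq_of_le_tendsto_0 b ?_ hb
    intro i j n hi hj
    have key := hmid n _ (hAa hi (hpA i)) _ (hAa hj (hpA j))
    have h1 : ‖(p i).2‖ ≤ M + δ n := (hpn i).le.trans (add_le_add (hmM i) (hδa hi))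
    have h2 : ‖(p j).2‖ ≤ M + δ n := (hpn j).le.trans (add_le_add (hmM j) (hδa hj))
    have par := parallelogram_law_with_norm ℝ (p i).2 (p j).2
    rw [norm_smul, Real.norm_of_nonneg (by norm_num)] at key
    rw [dist_eq_norm]
    apply Real.le_sqrt_of_sq_le
    have e1 := pow_le_pow_left₀ (norm_nonneg _) h1 2
    have e2 := pow_le_pow_left₀ (norm_nonneg _) h2 2
    have e3 := pow_le_pow_left₀ (hm0 n) key 2
    nlinarith
  obtain ⟨w, hw⟩ := cauchySeq_tendsto_of_complete hcau
  refine ⟨p, w, fun n => (hpA n).1, ?_, hw, ?_⟩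
  · rw [tendsto_iff_norm_sub_tendsto_zero]
    exact squeeze_zero (fun _ => norm_nonneg _) (fun n => (hpA n).2.1) hδ0
  · exact le_of_tendsto hw.norm (Eventually.of_forall fun n => (hpA n).2.2)

theorem grad_comb {d : ℕ} {u v : EuclideanSpace ℝ (Fin d) → ℝ}
    (hu : ContDiff ℝ (⊤ : ℕ∞) u) (hv : ContDiff ℝ (⊤ : ℕ∞) v) (a b : ℝ) :
    gradient (fun x => a * u x + b * v x) = fun x => a • gradient u x + b • gradient v x := by
  funext x
  have h1 : DifferentiableAt ℝ u x := hu.differentiable (by simp) x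
  have h2 : DifferentiableAt ℝ v x := hv.differentiable (by simp) x
  unfold gradient
  rw [fderiv_fun_add (h1.const_mul a) (h2.const_mul b), fderiv_const_mul h1, fderiv_const_mul h2]
  simp

theorem comb_smooth {d : ℕ} {u v : EuclideanSpace ℝ (Fin d) → ℝ}
    (hu : ContDiff ℝ (⊤ : ℕ∞) u) (hv : ContDiff ℝ (⊤ : ℕ∞) v) (a b : ℝ) :
    ContDiff ℝ (⊤ : ℕ∞) (fun x => a * u x + b * v x) :=
  (contDiff_const.mul hu).add (contDiff_const.mul hv)

theorem comb_supp {d : ℕ} {u v : EuclideanSpace ℝ (Fin d) → ℝ}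
    (hu : HasCompactSupport u) (hv : HasCompactSupport v) (a b : ℝ) :
    HasCompactSupport (fun x => a * u x + b * v x) :=
  (hu.mul_left (f := fun _ => a)).add (hv.mul_left (f := fun _ => b))

theorem memLp_fun {d : ℕ} (μ : Measure (EuclideanSpace ℝ (Fin d))) [IsFiniteMeasureOnCompacts μ]
    {u : EuclideanSpace ℝ (Fin d) → ℝ}
    (hu : ContDiff ℝ (⊤ : ℕ∞) u) (hu' : HasCompactSupport u) : MemLp u 2 μ :=
  hu.continuous.memLp_of_hasCompactSupport hu'

theorem memLp_grad {d : ℕ} (μ : Measure (EuclideanSpace ℝ (Fin d))) [IsFiniteMeasureOnCompacts μ]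
    {u : EuclideanSpace ℝ (Fin d) → ℝ}
    (hu : ContDiff ℝ (⊤ : ℕ∞) u) (hu' : HasCompactSupport u) : MemLp (gradient u) 2 μ := by
  have hc : Continuous (gradient u) :=
    (LinearIsometryEquiv.continuous _).comp (hu.continuous_fderiv (by simp))
  refine hc.memLp_of_hasCompactSupport ?_
  exact (hu'.fderiv (𝕜 := ℝ)).comp_left (map_zero _)

theorem lint_eq {α E : Type*} [MeasurableSpace α] [NormedAddCommGroup E] (μ : Measure α)
    (u : α → E) : ∫⁻ x, (‖u x‖₊ : ℝ≥0∞) ^ 2 ∂μ = eLpNorm u 2 μ ^ 2 := by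
  have := eLpNorm_nnreal_pow_eq_lintegral (μ := μ) (f := u) (p := 2) (by norm_num)
  simp only [ENNReal.coe_ofNat, NNReal.coe_ofNat, ENNReal.rpow_ofNat] at this
  exact this.symm

theorem lint_Lp {α E : Type*} [MeasurableSpace α] [NormedAddCommGroup E] {μ : Measure α}
    (p : Lp E 2 μ) {u : α → E} (h : p =ᵐ[μ] u) :
    ∫⁻ x, (‖u x‖₊ : ℝ≥0∞) ^ 2 ∂μ = ENNReal.ofReal ‖p‖ ^ 2 := by
  rw [lint_eq, ← eLpNorm_congr_ae h, ← Lp.enorm_def, ofReal_norm]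

theorem lint_tendsto {α E : Type*} [MeasurableSpace α] [NormedAddCommGroup E] {μ : Measure α}
    (p : ℕ → Lp E 2 μ) {u : ℕ → α → E} (h : ∀ n, p n =ᵐ[μ] u n)
    (hp : Tendsto p atTop (nhds 0)) :
    Tendsto (fun n => ∫⁻ x, (‖u n x‖₊ : ℝ≥0∞) ^ 2 ∂μ) atTop (nhds 0) := by
  have e : (fun n => ∫⁻ x, (‖u n x‖₊ : ℝ≥0∞) ^ 2 ∂μ) = fun n => ENNReal.ofReal ‖p n‖ ^ 2 :=
    funext fun n => lint_Lp (p n) (h n)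
  rw [e]
  have h1 : Tendsto (fun n => ENNReal.ofReal ‖p n‖) atTop (nhds 0) := by
    simpa using ENNReal.tendsto_ofReal hp.norm
  simpa using ENNReal.Tendsto.pow (n := 2) h1

/-- If `μ` is a Radon measure on `ℝ^d` and the Sobolev norm is closable on
compactly-supported smooth functions, then the Dirichlet energy `f ↦ ∫ |∇f|² dμ` is
`L²(μ)`-lower semicontinuous on `C_c^∞(ℝ^d)`. -/
theorem closable_implies_energy_lsc (d : ℕ)
    (μ : Measure (EuclideanSpace ℝ (Fin d)))
    [IsFiniteMeasureOnCompacts μ] [μ.Regular]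
    (hclos : SobolevClosable d μ)
    (f : EuclideanSpace ℝ (Fin d) → ℝ)
    (hf : ContDiff ℝ (⊤ : ℕ∞) f) (hf' : HasCompactSupport f)
    (g : ℕ → EuclideanSpace ℝ (Fin d) → ℝ)
    (hg : ∀ n, ContDiff ℝ (⊤ : ℕ∞) (g n)) (hg' : ∀ n, HasCompactSupport (g n))
    (hconv : Tendsto (fun n => ∫⁻ x, (‖g n x - f x‖₊ : ℝ≥0∞) ^ 2 ∂μ) atTop (nhds 0)) :
    (∫⁻ x, (‖gradient f x‖₊ : ℝ≥0∞) ^ 2 ∂μ) ≤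
      atTop.liminf (fun n => ∫⁻ x, (‖gradient (g n) x‖₊ : ℝ≥0∞) ^ 2 ∂μ) := by
  classical
  by_contra hlt
  rw [not_le] at hlt
  obtain ⟨c, hc1, hc2⟩ := exists_between hlt
  have hcT : c ≠ ⊤ := hc2.ne_top
  have hfreq := frequently_lt_of_liminf_lt (by isBoundedDefault) hc1
  let S : Set (Lp ℝ 2 μ × Lp (EuclideanSpace ℝ (Fin d)) 2 μ) :=
    {p | ∃ u : EuclideanSpace ℝ (Fin d) → ℝ, ContDiff ℝ (⊤ : ℕ∞) u ∧ HasCompactSupport u ∧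
      p.1 =ᵐ[μ] u ∧ p.2 =ᵐ[μ] gradient u}
  have hS : Convex ℝ S := by
    rintro p ⟨u, hu, hu', hp1, hp2⟩ q ⟨v, hv, hv', hq1, hq2⟩ a b - - -
    refine ⟨_, comb_smooth hu hv a b, comb_supp hu' hv' a b, ?_, ?_⟩
    · change ((a • p.1 + b • q.1 : Lp ℝ 2 μ) : _ → ℝ) =ᵐ[μ] _
      filter_upwards [Lp.coeFn_add (a • p.1) (b • q.1), Lp.coeFn_smul a p.1, Lp.coeFn_smul b q.1,
        hp1, hq1] with x h1 h2 h3 h4 h5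
      rw [h1, Pi.add_apply, h2, h3, Pi.smul_apply, Pi.smul_apply, h4, h5]; rfl
    · change ((a • p.2 + b • q.2 : Lp _ 2 μ) : _ → EuclideanSpace ℝ (Fin d)) =ᵐ[μ] _
      rw [grad_comb hu hv a b]
      filter_upwards [Lp.coeFn_add (a • p.2) (b • q.2), Lp.coeFn_smul a p.2, Lp.coeFn_smul b q.2,
        hp2, hq2] with x h1 h2 h3 h4 h5
      rw [h1, Pi.add_apply, h2, h3, Pi.smul_apply, Pi.smul_apply, h4, h5]
  let F : Lp ℝ 2 μ := (memLp_fun μ hf hf').toLp f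
  have hF : F =ᵐ[μ] f := MemLp.coeFn_toLp _
  let G : Lp (EuclideanSpace ℝ (Fin d)) 2 μ := (memLp_grad μ hf hf').toLp (gradient f)
  have hG : G =ᵐ[μ] gradient f := MemLp.coeFn_toLp _
  obtain ⟨p, w, hpS, hp1, hp2, hw⟩ := hilbert_aux S hS F (Real.sqrt c.toReal) (by
    intro ε hε
    have hev := hconv.eventually_lt_const (u := ENNReal.ofReal ε ^ 2)
      (ENNReal.pow_pos (ENNReal.ofReal_pos.2 hε) 2)
    obtain ⟨n, hn1, hn2⟩ := (hfreq.and_eventually hev).exists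
    have ha := (memLp_fun μ (hg n) (hg' n)).coeFn_toLp
    have hb := (memLp_grad μ (hg n) (hg' n)).coeFn_toLp
    refine ⟨((memLp_fun μ (hg n) (hg' n)).toLp (g n), (memLp_grad μ (hg n) (hg' n)).toLp _),
      ⟨g n, hg n, hg' n, ha, hb⟩, ?_, ?_⟩
    · rw [lint_Lp ((memLp_fun μ (hg n) (hg' n)).toLp (g n) - F)
        (u := fun x => g n x - f x) ((Lp.coeFn_sub _ _).trans (ha.sub hF)), ← ENNReal.ofReal_pow (norm_nonneg _),
        ← ENNReal.ofReal_pow hε.le, ENNReal.ofReal_lt_ofReal_iff (by positivity)] at hn2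
      exact (lt_of_pow_lt_pow_left₀ 2 hε.le hn2).le
    · rw [lint_Lp _ hb, ← ENNReal.ofReal_pow (norm_nonneg _)] at hn1
      apply Real.le_sqrt_of_sq_le
      exact (ENNReal.ofReal_le_iff_le_toReal hcT).1 hn1.le)
  choose u hu hu' hpu hpg using hpS
  have hwm := Lp.stronglyMeasurable (w - G)
  have hz := hclos (fun n x => 1 * u n x + (-1) * f x) (w - G : Lp _ 2 μ)
    (fun n => comb_smooth (hu n) hf _ _) (fun n => comb_supp (hu' n) hf' _ _) hwm.measurable
    (by rw [lint_Lp (w - G) EventuallyEq.rfl]; exact ENNReal.pow_lt_top ENNReal.ofReal_lt_top)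
    (by
      refine lint_tendsto (fun n => (p n).1 - F) (fun n => ?_)
        (by simpa using hp1.sub_const F)
      filter_upwards [Lp.coeFn_sub (p n).1 F, hpu n, hF] with x h1 h2 h3
      rw [h1, Pi.sub_apply, h2, h3]; ring)
    (by
      refine lint_tendsto (fun n => (p n).2 - w) (fun n => ?_)
        (by simpa using hp2.sub_const w)
      rw [grad_comb (hu n) hf]
      filter_upwards [Lp.coeFn_sub (p n).2 w, Lp.coeFn_sub w G, hpg n, hG] with x h1 h2 h3 h4
      rw [h1, Pi.sub_apply, h2, Pi.sub_apply, h3, h4]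
      simp only [one_smul, neg_smul]; abel)
  have hwG : w = G := sub_eq_zero.1 (Lp.eq_zero_iff_ae_eq_zero.2 hz)
  rw [lint_Lp G hG, ← hwG, ← ENNReal.ofReal_pow (norm_nonneg _)] at hc2
  refine absurd hc2 (not_lt.2 ?_)
  rw [ENNReal.ofReal_le_iff_le_toReal hcT]
  calc ‖w‖ ^ 2 ≤ Real.sqrt c.toReal ^ 2 := pow_le_pow_left₀ (norm_nonneg _) hw 2
    _ = c.toReal := Real.sq_sqrt ENNReal.toReal_nonneg
end
end

section
/- Let μ be a Radon measure on ℝ^d and suppose the functional f ↦ ∫|∇f|² dμ is L²(μ)-lower semicontinuous on C_c^∞(ℝ^d), i.e., for every f ∈ C_c^∞(ℝ^d) and every sequence (f_n)_n ⊆ C_c^∞(ℝ^d) with f_n → f in L²(μ) one has ∫|∇f|² dμ ≤ liminf_{n→∞} ∫|∇f_n|² dμ. Then the Sobolev norm is closable on compactly-supported smooth functions: whenever (f_n)_n ⊆ C_c^∞(ℝ^d) satisfies f_n → 0 in L²(μ) and ∇f_n → v in L²(μ; ℝ^d) for some Borel v : ℝ^d → ℝ^d with |v| ∈ L²(μ),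 it follows that v = 0 μ-almost everywhere. -/
open MeasureTheory Filter ENNReal

noncomputable section

theorem aux_sq {E : Type*} [NormedAddCommGroup E] (a b : E) :
    (‖a + b‖₊ : ℝ≥0∞) ^ 2 ≤ 2 * (‖a‖₊ : ℝ≥0∞) ^ 2 + 2 * (‖b‖₊ : ℝ≥0∞) ^ 2 := by
  have h : ‖a + b‖₊ ^ 2 ≤ 2 * ‖a‖₊ ^ 2 + 2 * ‖b‖₊ ^ 2 := by
    rw [← NNReal.coe_le_coe]
    push_cast
    have := norm_add_le a b
    nlinarith [sq_nonneg (‖a‖ - ‖b‖), norm_nonneg (a + b), norm_nonneg a, norm_nonneg b]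
  exact_mod_cast h

theorem aux_int {X E : Type*} [MeasurableSpace X] [NormedAddCommGroup E] [MeasurableSpace E]
    [BorelSpace E] (μ : Measure X) (a b c : X → E) (ha : Measurable a) (hb : Measurable b)
    (h : ∀ x, c x = a x + b x) :
    ∫⁻ x, (‖c x‖₊ : ℝ≥0∞) ^ 2 ∂μ ≤
      2 * ∫⁻ x, (‖a x‖₊ : ℝ≥0∞) ^ 2 ∂μ + 2 * ∫⁻ x, (‖b x‖₊ : ℝ≥0∞) ^ 2 ∂μ := by
  have ma : Measurable fun x => (‖a x‖₊ : ℝ≥0∞) ^ 2 := by fun_prop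
  have mb : Measurable fun x => (‖b x‖₊ : ℝ≥0∞) ^ 2 := by fun_prop
  rw [← lintegral_const_mul _ ma, ← lintegral_const_mul _ mb, ← lintegral_add_left (ma.const_mul 2)]
  exact lintegral_mono fun x => by rw [h]; exact aux_sq _ _

/-- If `μ` is a Radon measure on `ℝ^d` and the Dirichlet energy `f ↦ ∫ |∇f|² dμ` is
`L²(μ)`-lower semicontinuous on `C_c^∞(ℝ^d)`, then the Sobolev norm is closable on
compactly-supported smooth functions: whenever `f n ∈ C_c^∞(ℝ^d)` satisfy `f n → 0` in
`L²(μ)` and `∇(f n) → v` in `L²(μ; ℝ^d)` with `|v| ∈ L²(μ)`, then `v = 0` μ-a.e. -/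
theorem energy_lsc_implies_closable (d : ℕ)
    (μ : Measure (EuclideanSpace ℝ (Fin d)))
    [IsFiniteMeasureOnCompacts μ] [μ.Regular]
    (hlsc : ∀ (f : EuclideanSpace ℝ (Fin d) → ℝ),
      ContDiff ℝ (⊤ : ℕ∞) f → HasCompactSupport f →
      ∀ (g : ℕ → EuclideanSpace ℝ (Fin d) → ℝ),
        (∀ n, ContDiff ℝ (⊤ : ℕ∞) (g n)) → (∀ n, HasCompactSupport (g n)) →
        Tendsto (fun n => ∫⁻ x, (‖g n x - f x‖₊ : ℝ≥0∞) ^ 2 ∂μ) atTop (nhds 0) →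
        (∫⁻ x, (‖gradient f x‖₊ : ℝ≥0∞) ^ 2 ∂μ) ≤
          atTop.liminf (fun n => ∫⁻ x, (‖gradient (g n) x‖₊ : ℝ≥0∞) ^ 2 ∂μ)) :
    ∀ (f : ℕ → EuclideanSpace ℝ (Fin d) → ℝ)
      (v : EuclideanSpace ℝ (Fin d) → EuclideanSpace ℝ (Fin d)),
      (∀ n, ContDiff ℝ (⊤ : ℕ∞) (f n)) → (∀ n, HasCompactSupport (f n)) →
      Measurable v → (∫⁻ x, (‖v x‖₊ : ℝ≥0∞) ^ 2 ∂μ) < ⊤ →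
      Tendsto (fun n => ∫⁻ x, (‖f n x‖₊ : ℝ≥0∞) ^ 2 ∂μ) atTop (nhds 0) →
      Tendsto (fun n => ∫⁻ x, (‖gradient (f n) x - v x‖₊ : ℝ≥0∞) ^ 2 ∂μ) atTop (nhds 0) →
      v =ᵐ[μ] 0 := by
  intro f v hf hc hv hv2 hf0 hg
  have hd : ∀ n, Differentiable ℝ (f n) := fun n => (hf n).differentiable (by simp)
  have hgm : ∀ n, Measurable (gradient (f n)) := fun n => by
    have h1 : Continuous (fderiv ℝ (f n)) := (hf n).continuous_fderiv (by simp)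
    have h2 : Continuous (gradient (f n)) :=
      (InnerProductSpace.toDual ℝ (EuclideanSpace ℝ (Fin d))).symm.continuous.comp h1
    exact h2.measurable
  have hsub : ∀ m n x, gradient (fun y => f m y - f n y) x = gradient (f m) x - gradient (f n) x := by
    intro m n x
    simp only [gradient]
    rw [fderiv_fun_sub (hd m x) (hd n x), map_sub]
  have key : ∀ m, ∫⁻ x, (‖gradient (f m) x‖₊ : ℝ≥0∞) ^ 2 ∂μ ≤
      2 * ∫⁻ x, (‖gradient (f m) x - v x‖₊ : ℝ≥0∞) ^ 2 ∂μ := by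
    intro m
    refine (hlsc (f m) (hf m) (hc m) (fun n y => f m y - f n y) (fun n => (hf m).sub (hf n))
      (fun n => (hc m).sub (hc n)) ?_).trans ?_
    · simpa using hf0
    · have ht : Tendsto (fun n => 2 * ∫⁻ x, (‖gradient (f m) x - v x‖₊ : ℝ≥0∞) ^ 2 ∂μ +
          2 * ∫⁻ x, (‖gradient (f n) x - v x‖₊ : ℝ≥0∞) ^ 2 ∂μ) atTop
          (nhds (2 * ∫⁻ x, (‖gradient (f m) x - v x‖₊ : ℝ≥0∞) ^ 2 ∂μ)) := by
        simpa using (ENNReal.Tendsto.const_mul hg (Or.inr (by simp : (2 : ℝ≥0∞) ≠ ⊤))).const_add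
          (2 * ∫⁻ x, (‖gradient (f m) x - v x‖₊ : ℝ≥0∞) ^ 2 ∂μ)
      rw [← ht.liminf_eq]
      refine liminf_le_liminf (Eventually.of_forall fun n => ?_)
      have := aux_int μ (fun x => gradient (f m) x - v x) (fun x => -(gradient (f n) x - v x))
        (gradient (fun y => f m y - f n y)) ((hgm m).sub hv) ((hgm n).sub hv).neg
        (fun x => by rw [hsub]; abel)
      simpa only [nnnorm_neg] using this
  have hle : ∀ m, ∫⁻ x, (‖v x‖₊ : ℝ≥0∞) ^ 2 ∂μ ≤
      2 * (2 * ∫⁻ x, (‖gradient (f m) x - v x‖₊ : ℝ≥0∞) ^ 2 ∂μ) +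
      2 * ∫⁻ x, (‖gradient (f m) x - v x‖₊ : ℝ≥0∞) ^ 2 ∂μ := by
    intro m
    have := aux_int μ (gradient (f m)) (fun x => -(gradient (f m) x - v x)) v
      (hgm m) ((hgm m).sub hv).neg (fun x => by abel)
    simp only [nnnorm_neg] at this
    exact this.trans (by gcongr; exact key m)
  have h2 := ENNReal.Tendsto.const_mul hg (Or.inr (by simp : (2 : ℝ≥0∞) ≠ ⊤))
  have h4 := ENNReal.Tendsto.const_mul h2 (Or.inr (by simp : (2 : ℝ≥0∞) ≠ ⊤))
  have h0 : ∫⁻ x, (‖v x‖₊ : ℝ≥0∞) ^ 2 ∂μ ≤ 0 := by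
    have := ge_of_tendsto' (h4.add h2) hle
    simpa using this
  have h1 := (lintegral_eq_zero_iff (by fun_prop)).1 (le_antisymm h0 bot_le)
  filter_upwards [h1] with x hx
  simpa using hx
end
end

section
/- Let f : ℝ^d → ℝ be a Lipschitz function, let γ : ℝ → ℝ^d be a curve, and let t ∈ ℝ. Assume that γ is differentiable at t with derivative γ'(t) ∈ ℝ^d, and that the composition f ∘ γ : ℝ → ℝ is differentiable at t. Then f is differentiable at γ(t) in the direction γ'(t), with directional derivative equal to (f ∘ γ)'(t); that is, lim_{h→0} ( f(γ(t) + h·γ'(t)) − f(γ(t)) ) / h = (f ∘ γ)'(t). -/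
open Filter

noncomputable section

/-- Let `f : ℝ^d → ℝ` be Lipschitz, let `γ : ℝ → ℝ^d` be differentiable at `t` with
derivative `γ'`, and suppose `f ∘ γ` is differentiable at `t`. Then `f` is differentiable
at `γ t` in the direction `γ'`, with directional derivative `(f ∘ γ)'(t)`. -/
theorem lipschitz_directional_differentiable_along_curve (d : ℕ)
    (f : EuclideanSpace ℝ (Fin d) → ℝ)
    (hf : ∃ L : NNReal, LipschitzWith L f)
    (γ : ℝ → EuclideanSpace ℝ (Fin d)) (t : ℝ)
    (γ' : EuclideanSpace ℝ (Fin d)) (hγ : HasDerivAt γ γ' t)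
    (D : ℝ) (hD : HasDerivAt (f ∘ γ) D t) :
    Tendsto (fun h : ℝ => (f (γ t + h • γ') - f (γ t)) / h) (nhdsWithin 0 {0}ᶜ)
      (nhds D) := by
  obtain ⟨L, hL⟩ := hf
  have h1 := hasDerivAt_iff_isLittleO_nhds_zero.1 hγ
  have h2 := hasDerivAt_iff_isLittleO_nhds_zero.1 hD
  have h3 : (fun h : ℝ => f (γ t + h • γ') - f (γ (t + h))) =o[nhds 0] (fun h : ℝ => h) := by
    refine Asymptotics.IsBigO.trans_isLittleO ?_ h1
    refine Asymptotics.IsBigO.of_bound L (Eventually.of_forall fun h => ?_)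
    have := hL.dist_le_mul (γ t + h • γ') (γ (t + h))
    rw [dist_eq_norm, dist_comm, dist_eq_norm] at this
    rwa [sub_sub]
  have h4 : HasDerivAt (fun h : ℝ => f (γ t + h • γ')) D 0 := by
    rw [hasDerivAt_iff_isLittleO_nhds_zero]
    refine (h3.add h2).congr_left fun h => ?_
    simp
    ring
  have h5 := hasDerivAt_iff_tendsto_slope_zero.1 h4
  refine h5.congr fun h => ?_
  simp [div_eq_inv_mul]
end
end

section
/- Let X be a normed real vector space and let Q : X → [0, +∞] satisfy the parallelogram rule Q(u + w) + Q(u − w) = 2·Q(u) + 2·Q(w) for all u, w ∈ X (with the usual arithmetic of [0, +∞]). Define the lower semicontinuous relaxation F : X → [0, +∞] by F(u) := inf { liminf_{n→∞} Q(u_n) : (u_n)_n a sequence in X with u_n → u in X }. Then F also satisfies the parallelogram rule: F(u + w) + F(u − w) = 2·F(u) + 2·F(w) for all u, w ∈ X. -/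
open Filter ENNReal

noncomputable section

/-- If `Q : X → [0, ∞]` on a normed real vector space satisfies the parallelogram rule,
then so does its lower semicontinuous relaxation
`F u = inf { liminf_n Q (u n) : u n → u }`. -/
theorem relaxation_parallelogram {X : Type*} [NormedAddCommGroup X] [NormedSpace ℝ X]
    (Q : X → ℝ≥0∞)
    (hQ : ∀ u w : X, Q (u + w) + Q (u - w) = 2 * Q u + 2 * Q w)
    (F : X → ℝ≥0∞)
    (hF : ∀ u : X, F u = ⨅ (s : ℕ → X) (_ : Tendsto s atTop (nhds u)),
      atTop.liminf fun n => Q (s n)) :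
    ∀ u w : X, F (u + w) + F (u - w) = 2 * F u + 2 * F w := by
  have hle : ∀ (u : X) (s : ℕ → X), Tendsto s atTop (nhds u) →
      F u ≤ atTop.liminf fun n => Q (s n) := by
    intro u s hs
    rw [hF]
    exact iInf₂_le s hs
  have hfr : ∀ (u : X) (a : ℝ≥0∞), F u < a → ∃ s : ℕ → X,
      Tendsto s atTop (nhds u) ∧ ∀ n, Q (s n) < a := by
    intro u a h
    rw [hF] at h
    simp only [iInf_lt_iff] at h
    obtain ⟨s, hs, h⟩ := h
    have hf : ∃ᶠ n in atTop, Q (s n) < a := frequently_lt_of_liminf_lt (by isBoundedDefault) h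
    obtain ⟨φ, hφ, h2⟩ := extraction_of_frequently_atTop hf
    exact ⟨s ∘ φ, hs.comp hφ.tendsto_atTop, h2⟩
  have hQ0 : ∀ x, Q ((2:ℝ) • x) = 4 * Q x := by
    intro x
    have h0 := hQ 0 0
    have hx := hQ x x
    have e4 : 2 * Q x + 2 * Q x = 4 * Q x := by ring
    simp only [add_zero, sub_zero] at h0
    rw [sub_self, e4, ← two_smul ℝ x] at hx
    by_cases ht : Q 0 = ⊤
    · have hall : ∀ y, Q y = ⊤ := by
        intro y
        have := hQ y y
        rw [sub_self, ht, add_top] at this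
        by_contra hy
        have h3 : 2 * Q y + 2 * Q y < ⊤ := by
          have : Q y < ⊤ := lt_top_iff_ne_top.2 hy
          finiteness
        exact absurd this.symm h3.ne
      rw [hall, hall]; simp
    · have : Q 0 = 0 := by
        lift Q 0 to NNReal using ht with q
        norm_cast at h0 ⊢
        have : (q:ℝ) + q = 2 * q + 2 * q := by exact_mod_cast h0
        have : (q:ℝ) = 0 := by linarith
        exact_mod_cast this
      rwa [this, add_zero] at hx
  have hF4 : ∀ x, 4 * F x ≤ F ((2:ℝ) • x) := by
    intro x
    refine le_of_forall_gt fun a ha => ?_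
    obtain ⟨b, hb, hba⟩ := exists_between ha
    obtain ⟨s, hs, h⟩ := hfr _ _ hb
    have h1 : F x ≤ b / 4 := by
      have hs' : Tendsto (fun n => (2:ℝ)⁻¹ • s n) atTop (nhds x) := by
        simpa using hs.const_smul (2:ℝ)⁻¹
      refine (hle x _ hs').trans ?_
      refine liminf_le_of_frequently_le' (Frequently.of_forall fun n => ?_)
      rw [ENNReal.le_div_iff_mul_le (by simp) (by simp), mul_comm, ← hQ0]
      simpa using (h n).le
    refine lt_of_le_of_lt ?_ hba
    rw [ENNReal.le_div_iff_mul_le (by simp) (by simp)] at h1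
    rwa [mul_comm]
  have key : ∀ u w : X, F (u + w) + F (u - w) ≤ 2 * F u + 2 * F w := by
    intro u w
    by_cases hu : F u = ⊤
    · simp [hu]
    by_cases hw : F w = ⊤
    · simp [hw]
    refine ENNReal.le_of_forall_pos_le_add fun ε hε _ => ?_
    have he : (ε : ℝ≥0∞) / 4 ≠ 0 := by simp [hε.ne']
    obtain ⟨s, hs, h1⟩ := hfr u _ (ENNReal.lt_add_right hu he)
    obtain ⟨t, ht, h2⟩ := hfr w _ (ENNReal.lt_add_right hw he)
    have h3 := hle _ _ (hs.add ht)
    have h4 := hle _ _ (hs.sub ht)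
    refine (add_le_add h3 h4).trans ?_
    have hb : ∀ n, Q (s n + t n) + Q (s n - t n) ≤ 2 * F u + 2 * F w + ε := by
      intro n
      rw [hQ]
      calc _ ≤ 2 * (F u + ε / 4) + 2 * (F w + ε / 4) := by
            gcongr
            exacts [(h1 n).le, (h2 n).le]
        _ = 2 * F u + 2 * F w + 4 * (ε / 4) := by ring
        _ = _ := by rw [ENNReal.mul_div_cancel (by simp) (by simp)]
    simp only [liminf_eq_iSup_iInf_of_nat]
    rw [ENNReal.iSup_add_iSup_of_monotone]
    · refine iSup_le fun n => ?_
      exact (add_le_add (iInf₂_le n le_rfl) (iInf₂_le n le_rfl)).trans (hb n)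
    · exact fun i j hij => biInf_mono fun k hk => hij.trans hk
    · exact fun i j hij => biInf_mono fun k hk => hij.trans hk
  intro u w
  refine le_antisymm (key u w) ?_
  have h := key (u + w) (u - w)
  have e1 : u + w + (u - w) = (2:ℝ) • u := by rw [two_smul]; abel
  have e2 : u + w - (u - w) = (2:ℝ) • w := by rw [two_smul]; abel
  rw [e1, e2] at h
  have h2 := (add_le_add (hF4 u) (hF4 w)).trans h
  have h3 : 2 * (2 * F u + 2 * F w) ≤ 2 * (F (u + w) + F (u - w)) := by
    calc _ = 4 * F u + 4 * F w := by ring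
      _ ≤ _ := h2
      _ = _ := by ring
  exact (ENNReal.mul_le_mul_iff_right (by simp) (by simp)).1 h3
end
end
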